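/- Let q₁, q₂ : ℝ³ → ℝ be smooth functions supported in the closed unit ball B̄ and each vanishing on some neighborhood of the origin. For i = 1,2 suppose: (a) vᵢ is a smooth function on {(x,t) ∈ ℝ³×ℝ : t ≥ |x|} satisfying ∂ₜ²vᵢ − Δₓvᵢ + qᵢ·vᵢ = 0 on {t > |x|} and vᵢ(x,|x|) = −(1/(8π))∫₀¹ qᵢ(sx) ds for all x ∈ ℝ³; (b) wᵢ is a smooth function on {(x,t) ∈ ℝ³×ℝ : x ≠ 0, −|x| ≤ t < |x|} satisfying ∂ₜ²wᵢ − Δₓwᵢ + qᵢ·wᵢ = 0 on {x ≠ 0, −|x| < t < |x|}, wᵢ(x,−|x|) = −(1/(8π))∫₁^∞ qᵢ(sx) ds for all x ≠ 0, and wᵢ(x,t) = 0 whenever −|x| ≤ t < −1. If v₁(x,t) = v₂(x,t) for all x with |x| = 1 and t ∈ [1,3], and w₁(x,t) = w₂(x,t) for all x with |x| = 1 and t ∈ [−1,1), then q₁ = q₂ on ℝ³. -/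

import Mathlib

open MeasureTheory

/-- Second directional derivative of `f` at `p` in direction `v`. -/
noncomputable def dir2 {E : Type*} [NormedAddCommGroup E] [NormedSpace ℝ E]
    (f : E → ℝ) (p v : E) : ℝ :=
  iteratedDeriv 2 (fun s : ℝ => f (p + s • v)) 0

/-- The wave operator `□u = ∂ₜ²u − Δₓu` on `ℝ³ × ℝ`. -/
noncomputable def waveOp3 (u : EuclideanSpace ℝ (Fin 3) × ℝ → ℝ)
    (p : EuclideanSpace ℝ (Fin 3) × ℝ) : ℝ :=
  dir2 u p (0, 1) - ∑ i : Fin 3, dir2 u p (EuclideanSpace.single i 1, 0)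

namespace WaveUniqueness

open Set Filter Topology
open scoped ContDiff

/-- Three-dimensional Euclidean space. -/
abbrev Space := EuclideanSpace ℝ (Fin 3)

/-! ### Differentiation along vector fields -/

section Along

variable {V : Type*} [NormedAddCommGroup V] [NormedSpace ℝ V]

/-- The derivative of the function `g` along the vector field `ξ`. -/
noncomputable def along (ξ : V → V) (g : V → ℝ) : V → ℝ := fun p => fderiv ℝ g p (ξ p)

variable {ξ η : V → V} {g h : V → ℝ} {p : V}

theorem contDiffAt_along (hξ : ContDiff ℝ ∞ ξ) (hg : ContDiffAt ℝ ∞ g p) :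
    ContDiffAt ℝ ∞ (along ξ g) p := by
  have h1 : ContDiffAt ℝ ∞ (fderiv ℝ g) p := hg.fderiv_right (by simp)
  exact h1.clm_apply hξ.contDiffAt

theorem along_congr (hgh : g =ᶠ[𝓝 p] h) : along ξ g =ᶠ[𝓝 p] along ξ h := by
  filter_upwards [hgh.fderiv (𝕜 := ℝ)] with y hy
  simp [along, hy]

theorem along_add (hg : DifferentiableAt ℝ g p) (hh : DifferentiableAt ℝ h p) :
    along ξ (fun y => g y + h y) p = along ξ g p + along ξ h p := by
  simp [along, fderiv_fun_add hg hh]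

theorem along_sub (hg : DifferentiableAt ℝ g p) (hh : DifferentiableAt ℝ h p) :
    along ξ (fun y => g y - h y) p = along ξ g p - along ξ h p := by
  simp [along, fderiv_fun_sub hg hh]

theorem along_mul (hg : DifferentiableAt ℝ g p) (hh : DifferentiableAt ℝ h p) :
    along ξ (fun y => g y * h y) p = along ξ g p * h p + g p * along ξ h p := by
  simp [along, fderiv_fun_mul hg hh]
  ring

theorem along_const (c : ℝ) : along ξ (fun _ => c) p = 0 := by
  simp [along]

theorem along_pow_two (hg : DifferentiableAt ℝ g p) :
    along ξ (fun y => g y ^ 2) p = 2 * g p * along ξ g p := by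
  simp only [pow_two]
  rw [along_mul hg hg]
  ring

theorem along_comp {F : ℝ → ℝ} (hF : DifferentiableAt ℝ F (g p)) (hg : DifferentiableAt ℝ g p) :
    along ξ (fun y => F (g y)) p = deriv F (g p) * along ξ g p := by
  have := (hF.hasDerivAt.comp_hasFDerivAt p hg.hasFDerivAt).fderiv
  simp only [along]
  change fderiv ℝ (F ∘ g) p (ξ p) = _
  rw [this]
  simp

theorem along_along (hη : DifferentiableAt ℝ η p) (hg : ContDiffAt ℝ ∞ g p) :
    along ξ (along η g) p =
      fderiv ℝ (fderiv ℝ g) p (ξ p) (η p) + fderiv ℝ g p (fderiv ℝ η p (ξ p)) := by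
  have h1 : ContDiffAt ℝ ∞ (fderiv ℝ g) p := hg.fderiv_right (by simp)
  have h2 : DifferentiableAt ℝ (fderiv ℝ g) p := h1.differentiableAt (by simp)
  have h3 := (h2.hasFDerivAt.clm_apply hη.hasFDerivAt).fderiv
  change fderiv ℝ (fun y => fderiv ℝ g y (η y)) p (ξ p) = _
  rw [h3]
  simp [add_comm]

theorem along_comm (hξ : DifferentiableAt ℝ ξ p) (hη : DifferentiableAt ℝ η p)
    (hg : ContDiffAt ℝ ∞ g p) (hbr : fderiv ℝ η p (ξ p) = fderiv ℝ ξ p (η p)) :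
    along ξ (along η g) p = along η (along ξ g) p := by
  have hs : IsSymmSndFDerivAt ℝ g p := hg.isSymmSndFDerivAt (by
    simp only [minSmoothness_of_isRCLikeNormedField]
    exact WithTop.coe_le_coe.2 le_top)
  rw [along_along hη hg, along_along hξ hg, hs.eq, hbr]

end Along

/-- The generator of rotations about the `i`-th coordinate axis. -/
noncomputable def rot (i : Fin 3) : Space →L[ℝ] Space :=
  (EuclideanSpace.proj (i + 2) : Space →L[ℝ] ℝ).smulRight (EuclideanSpace.single (i + 1) (1 : ℝ)) -
    (EuclideanSpace.proj (i + 1) : Space →L[ℝ] ℝ).smulRight (EuclideanSpace.single (i + 2) (1 : ℝ))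

theorem rot_apply (i : Fin 3) (x : Space) :
    rot i x = x (i + 2) • EuclideanSpace.single (i + 1) (1 : ℝ) -
      x (i + 1) • EuclideanSpace.single (i + 2) (1 : ℝ) := by
  simp [rot]

/-- The radial field `x·∇ₓ`. -/
def radialField : Space × ℝ → Space × ℝ := fun p => (p.1, 0)

/-- The time-translation field. -/
def timeField : Space × ℝ → Space × ℝ := fun _ => (0, 1)

/-- The rotation fields. -/
noncomputable def rotField (i : Fin 3) : Space × ℝ → Space × ℝ := fun p => (rot i p.1, 0)

theorem contDiff_radialField : ContDiff ℝ ∞ radialField := by unfold radialField; fun_prop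
theorem contDiff_timeField : ContDiff ℝ ∞ timeField := by unfold timeField; fun_prop
theorem contDiff_rotField (i : Fin 3) : ContDiff ℝ ∞ (rotField i) := by
  unfold rotField; fun_prop

theorem fderiv_radialField (p v : Space × ℝ) : fderiv ℝ radialField p v = (v.1, 0) := by
  have : HasFDerivAt radialField
      ((ContinuousLinearMap.fst ℝ Space ℝ).prod (0 : Space × ℝ →L[ℝ] ℝ)) p :=
    hasFDerivAt_fst.prodMk (hasFDerivAt_const (0 : ℝ) p)
  rw [this.fderiv]; simp

theorem fderiv_timeField (p v : Space × ℝ) : fderiv ℝ timeField p v = 0 := by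
  have : timeField = fun _ => (0, 1) := rfl
  rw [this]; simp

theorem fderiv_rotField (i : Fin 3) (p v : Space × ℝ) :
    fderiv ℝ (rotField i) p v = (rot i v.1, 0) := by
  have : HasFDerivAt (rotField i)
      (((rot i).comp (ContinuousLinearMap.fst ℝ Space ℝ)).prod (0 : Space × ℝ →L[ℝ] ℝ)) p :=
    ((rot i).hasFDerivAt.comp p hasFDerivAt_fst).prodMk (hasFDerivAt_const (0 : ℝ) p)
  rw [this.fderiv]; simp

/-- The derivative `r∂ᵣ` of a function of `(x, τ)`. -/
notation:max "dR" => along radialField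

/-- The time derivative of a function of `(x, τ)`. -/
notation:max "dT" => along timeField

/-- The angular derivatives of a function of `(x, τ)`. -/
notation:max "dO" i:max => along (rotField i)

section Smoothness

variable {g : Space × ℝ → ℝ} {p : Space × ℝ}

theorem contDiffAt_dR (hg : ContDiffAt ℝ ∞ g p) : ContDiffAt ℝ ∞ (dR g) p :=
  contDiffAt_along contDiff_radialField hg
theorem contDiffAt_dT (hg : ContDiffAt ℝ ∞ g p) : ContDiffAt ℝ ∞ (dT g) p :=
  contDiffAt_along contDiff_timeField hg
theorem contDiffAt_dO (i : Fin 3) (hg : ContDiffAt ℝ ∞ g p) : ContDiffAt ℝ ∞ (dO i g) p :=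
  contDiffAt_along (contDiff_rotField i) hg

theorem dT_dR (hg : ContDiffAt ℝ ∞ g p) : dT (dR g) p = dR (dT g) p := by
  apply along_comm (contDiff_timeField.differentiable (by simp) p)
    (contDiff_radialField.differentiable (by simp) p) hg
  rw [fderiv_radialField, fderiv_timeField]; rfl

theorem dT_dO (i : Fin 3) (hg : ContDiffAt ℝ ∞ g p) : dT (dO i g) p = dO i (dT g) p := by
  apply along_comm (contDiff_timeField.differentiable (by simp) p)
    ((contDiff_rotField i).differentiable (by simp) p) hg
  rw [fderiv_rotField, fderiv_timeField]; simp [timeField]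

theorem dR_dO (i : Fin 3) (hg : ContDiffAt ℝ ∞ g p) : dR (dO i g) p = dO i (dR g) p := by
  apply along_comm (contDiff_radialField.differentiable (by simp) p)
    ((contDiff_rotField i).differentiable (by simp) p) hg
  rw [fderiv_rotField, fderiv_radialField]; simp [radialField, rotField]

end Smoothness

/-- The operator `r²(2 s ∂ᵣ∂_τ - ∂ᵣ² - r⁻²Δ_S)`, with `r∂ᵣ` written as `dR`. -/
noncomputable def charOp (s : ℝ) (g : Space × ℝ → ℝ) (p : Space × ℝ) : ℝ :=
  2 * s * ‖p.1‖ * dR (dT g) p - dR (dR g) p + dR g p - ∑ i, dO i (dO i g) p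

theorem charOp_congr {s : ℝ} {g h : Space × ℝ → ℝ} {p : Space × ℝ} (hgh : g =ᶠ[𝓝 p] h) :
    charOp s g p = charOp s h p := by
  have h1 (ξ η : Space × ℝ → Space × ℝ) : along ξ (along η g) p = along ξ (along η h) p :=
    (along_congr (along_congr hgh)).eq_of_nhds
  simp only [charOp, h1, (along_congr hgh).eq_of_nhds]

/-! ### The functions `r` and `τ` -/

section Weights

variable {p : Space × ℝ}

theorem contDiffAt_norm_fst (hp : p.1 ≠ 0) : ContDiffAt ℝ ∞ (fun y : Space × ℝ => ‖y.1‖) p :=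
  (contDiffAt_norm ℝ hp).comp p contDiffAt_fst

theorem inner_rot (i : Fin 3) (x : Space) : inner ℝ x (rot i x) = 0 := by
  rw [rot_apply]
  simp only [inner_sub_right, inner_smul_right, EuclideanSpace.inner_single_right]
  simp [mul_comm]

theorem fderiv_norm_sq_fst (p v : Space × ℝ) :
    fderiv ℝ (fun y : Space × ℝ => ‖y.1‖ ^ 2) p v = 2 * inner ℝ p.1 v.1 := by
  have := (hasStrictFDerivAt_norm_sq p.1).hasFDerivAt.comp p
    (hasFDerivAt_fst (𝕜 := ℝ) (p := p))
  change fderiv ℝ ((fun x : Space => ‖x‖ ^ 2) ∘ Prod.fst) p v = _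
  rw [this.fderiv]; simp

theorem along_norm_sq (ξ : Space × ℝ → Space × ℝ) :
    along ξ (fun y : Space × ℝ => ‖y.1‖ ^ 2) p = 2 * inner ℝ p.1 (ξ p).1 :=
  fderiv_norm_sq_fst p _

theorem along_norm (ξ : Space × ℝ → Space × ℝ) (hp : p.1 ≠ 0) :
    along ξ (fun y : Space × ℝ => ‖y.1‖) p = inner ℝ p.1 (ξ p).1 / ‖p.1‖ := by
  have h := along_norm_sq (p := p) ξ
  rw [along_pow_two ((contDiffAt_norm_fst hp).differentiableAt (by simp))] at h
  have : ‖p.1‖ ≠ 0 := norm_ne_zero_iff.2 hp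
  field_simp
  linarith

theorem dR_norm (hp : p.1 ≠ 0) : dR (fun y : Space × ℝ => ‖y.1‖) p = ‖p.1‖ := by
  have : ‖p.1‖ ≠ 0 := norm_ne_zero_iff.2 hp
  rw [along_norm _ hp]
  simp only [radialField, real_inner_self_eq_norm_sq]
  field_simp

theorem dT_norm (hp : p.1 ≠ 0) : dT (fun y : Space × ℝ => ‖y.1‖) p = 0 := by
  rw [along_norm _ hp]; simp [timeField]

theorem dO_norm (i : Fin 3) (hp : p.1 ≠ 0) : dO i (fun y : Space × ℝ => ‖y.1‖) p = 0 := by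
  rw [along_norm _ hp]; simp [rotField, inner_rot]

theorem along_snd (ξ : Space × ℝ → Space × ℝ) :
    along ξ (fun y : Space × ℝ => y.2) p = (ξ p).2 := by
  simp only [along]
  rw [hasFDerivAt_snd.fderiv]; rfl

end Weights

/-! ### Functions smooth away from the axis -/

/-- Smoothness away from the time axis `x = 0`. -/
def OffAxis (H : Space × ℝ → ℝ) : Prop := ∀ p : Space × ℝ, p.1 ≠ 0 → ContDiffAt ℝ ∞ H p

/-- Compactly supported functions that are smooth away from the time axis. -/
structure TestFun (H : Space × ℝ → ℝ) : Prop where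
  smooth : OffAxis H
  supp : HasCompactSupport H

section Closure

variable {H G k : Space × ℝ → ℝ}

theorem OffAxis.diff (h : OffAxis H) {p : Space × ℝ} (hp : p.1 ≠ 0) : DifferentiableAt ℝ H p :=
  (h p hp).differentiableAt (by simp)

theorem OffAxis.const (c : ℝ) : OffAxis fun _ => c := fun _ _ => contDiffAt_const

theorem OffAxis.norm : OffAxis fun p => ‖p.1‖ := fun _ hp => contDiffAt_norm_fst hp

theorem OffAxis.snd : OffAxis fun p => p.2 := fun _ _ => contDiffAt_snd

theorem OffAxis.add (h : OffAxis H) (h' : OffAxis G) : OffAxis fun p => H p + G p :=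
  fun p hp => (h p hp).add (h' p hp)

theorem OffAxis.sub (h : OffAxis H) (h' : OffAxis G) : OffAxis fun p => H p - G p :=
  fun p hp => (h p hp).sub (h' p hp)

theorem OffAxis.mul (h : OffAxis H) (h' : OffAxis G) : OffAxis fun p => H p * G p :=
  fun p hp => (h p hp).mul (h' p hp)

theorem OffAxis.pow (h : OffAxis H) (n : ℕ) : OffAxis fun p => H p ^ n :=
  fun p hp => (h p hp).pow n

theorem OffAxis.comp {F : ℝ → ℝ} (hF : ContDiff ℝ ∞ F) (h : OffAxis H) : OffAxis fun p => F (H p) :=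
  fun p hp => hF.contDiffAt.comp p (h p hp)

theorem OffAxis.inv_norm : OffAxis fun p => ‖p.1‖⁻¹ :=
  fun _ hp => (contDiffAt_norm_fst hp).inv (norm_ne_zero_iff.2 hp)

theorem OffAxis.along {ξ : Space × ℝ → Space × ℝ} (hξ : ContDiff ℝ ∞ ξ) (h : OffAxis H) :
    OffAxis (along ξ H) := fun p hp => contDiffAt_along hξ (h p hp)

theorem TestFun.add (h : TestFun H) (h' : TestFun G) : TestFun fun p => H p + G p :=
  ⟨h.smooth.add h'.smooth, h.supp.add h'.supp⟩

theorem TestFun.weight (hk : OffAxis k) (h : TestFun H) : TestFun fun p => k p * H p :=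
  ⟨hk.mul h.smooth, h.supp.mul_left⟩

theorem TestFun.mul (h : TestFun H) (h' : TestFun G) : TestFun fun p => H p * G p :=
  TestFun.weight h.smooth h'

theorem TestFun.sq (h : TestFun H) : TestFun fun p => H p ^ 2 := by
  simpa only [pow_two] using h.mul h

theorem TestFun.along {ξ : Space × ℝ → Space × ℝ} (hξ : ContDiff ℝ ∞ ξ) (h : TestFun H) :
    TestFun (along ξ H) := by
  refine ⟨h.smooth.along hξ, h.supp.mono' ?_⟩
  intro p hp
  by_contra hcon
  apply hp
  have := notMem_tsupport_iff_eventuallyEq.1 hcon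
  have h2 := along_congr (ξ := ξ) this
  rw [h2.eq_of_nhds]
  exact along_const 0

theorem TestFun.dR (h : TestFun H) : TestFun (dR H) := h.along contDiff_radialField
theorem TestFun.dT (h : TestFun H) : TestFun (dT H) := h.along contDiff_timeField
theorem TestFun.dO (i : Fin 3) (h : TestFun H) : TestFun (dO i H) := h.along (contDiff_rotField i)

theorem TestFun.sum {ι : Type*} {F : ι → Space × ℝ → ℝ} (s : Finset ι) (h : ∀ i, TestFun (F i)) :
    TestFun fun p => ∑ i ∈ s, F i p := by
  classical
  induction s using Finset.induction_on with
  | empty =>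
    exact ⟨by simpa using OffAxis.const 0, (HasCompactSupport.zero : HasCompactSupport fun _ => (0 : ℝ))⟩
  | insert i s hi ih => simpa only [Finset.sum_insert hi] using (h i).add ih

end Closure

/-! ### Integration by parts on exterior cylinders -/

/-- The complement of the closed ball of radius `ρ`. -/
def ext (ρ : ℝ) : Set Space := {x | ρ < ‖x‖}

theorem isOpen_ext (ρ : ℝ) : IsOpen (ext ρ) := isOpen_lt continuous_const continuous_norm

theorem measurableSet_ext (ρ : ℝ) : MeasurableSet (ext ρ) := (isOpen_ext ρ).measurableSet

/-- A smooth radial function vanishing for `‖x‖ ≤ ρ` and tending to the indicator of `ext ρ`. -/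
noncomputable def ramp (ρ : ℝ) (n : ℕ) (x : Space) : ℝ := Real.smoothTransition (n * (‖x‖ - ρ))

theorem ramp_eq_zero {ρ : ℝ} {n : ℕ} {x : Space} (hx : ‖x‖ ≤ ρ) : ramp ρ n x = 0 :=
  Real.smoothTransition.zero_of_nonpos
    (mul_nonpos_of_nonneg_of_nonpos (Nat.cast_nonneg n) (by linarith))

theorem contDiff_ramp {ρ : ℝ} (hρ : 0 < ρ) (n : ℕ) : ContDiff ℝ ∞ (ramp ρ n) := by
  rw [contDiff_iff_contDiffAt]
  intro x
  by_cases hx : x = 0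
  · have : ramp ρ n =ᶠ[𝓝 x] fun _ => 0 := by
      have : ∀ᶠ y in 𝓝 x, ‖y‖ < ρ :=
        continuous_norm.continuousAt.eventually_lt continuousAt_const (by simpa [hx] using hρ)
      filter_upwards [this] with y hy using ramp_eq_zero hy.le
    exact contDiffAt_const.congr_of_eventuallyEq this
  · exact Real.smoothTransition.contDiff.contDiffAt.comp x
      (contDiffAt_const.mul ((contDiffAt_norm ℝ hx).sub contDiffAt_const))

theorem ramp_nonneg (ρ : ℝ) (n : ℕ) (x : Space) : 0 ≤ ramp ρ n x := Real.smoothTransition.nonneg _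

theorem ramp_le_one (ρ : ℝ) (n : ℕ) (x : Space) : ramp ρ n x ≤ 1 := Real.smoothTransition.le_one _

theorem tendsto_ramp (ρ : ℝ) (x : Space) :
    Tendsto (fun n => ramp ρ n x) atTop (𝓝 ((ext ρ).indicator (fun _ => 1) x)) := by
  by_cases hx : x ∈ ext ρ
  · rw [indicator_of_mem hx]
    apply tendsto_const_nhds.congr'
    have h1 : Tendsto (fun n : ℕ => (n : ℝ) * (‖x‖ - ρ)) atTop atTop :=
      tendsto_natCast_atTop_atTop.atTop_mul_const (sub_pos.2 hx)
    filter_upwards [h1.eventually_ge_atTop 1] with n hn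
    exact (Real.smoothTransition.one_of_one_le hn).symm
  · rw [indicator_of_notMem hx]
    simp only [ext, mem_ofPred_eq, not_lt] at hx
    simp [ramp_eq_zero hx]

/-- The divergence theorem for a linear vector field. -/
theorem integral_fderiv_linear (A : Space →L[ℝ] Space) {F : Space → ℝ} (hF : ContDiff ℝ ∞ F)
    (hs : HasCompactSupport F) :
    ∫ x, (fderiv ℝ F x (A x) + (∑ j, A (EuclideanSpace.single j 1) j) * F x) = 0 := by
  have hd : Differentiable ℝ F := hF.differentiable (by simp)
  have hcd : Continuous (fderiv ℝ F) := hF.continuous_fderiv (by simp)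
  have hcs : HasCompactSupport (fderiv ℝ F) := hs.fderiv ℝ
  have hpt (x : Space) : fderiv ℝ F x (A x) + (∑ j, A (EuclideanSpace.single j 1) j) * F x
      = ∑ j, (fderiv ℝ F x (EuclideanSpace.single j 1) * A x j +
        F x * fderiv ℝ (fun y => A y j) x (EuclideanSpace.single j 1)) := by
    have hA : A x = ∑ j, (A x j) • (EuclideanSpace.single j (1 : ℝ)) := by
      ext k; simp [Finset.sum_apply, Pi.single_apply]
    have hB (j : Fin 3) : fderiv ℝ (fun y => A y j) x =
        (EuclideanSpace.proj j : Space →L[ℝ] ℝ).comp A :=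
      ((EuclideanSpace.proj j : Space →L[ℝ] ℝ).comp A).fderiv
    conv_lhs => rw [hA]
    simp only [map_sum, map_smul, hB, Finset.sum_add_distrib, Finset.sum_mul]
    congr 1
    · exact Finset.sum_congr rfl fun j _ => by simp [mul_comm]
    · exact Finset.sum_congr rfl fun j _ => by simp [mul_comm]
  have hdA (j : Fin 3) : Differentiable ℝ (fun y : Space => A y j) :=
    ((EuclideanSpace.proj j : Space →L[ℝ] ℝ).comp A).differentiable
  have hcA (j : Fin 3) : Continuous (fun y : Space => A y j) := (hdA j).continuous
  have hfA (j : Fin 3) : Continuous fun x : Space =>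
      fderiv ℝ (fun y => A y j) x (EuclideanSpace.single j 1) := by
    have : (fun x : Space => fderiv ℝ (fun y => A y j) x (EuclideanSpace.single j 1)) =
        fun _ => A (EuclideanSpace.single j 1) j := by
      funext x
      have : fderiv ℝ (fun y => A y j) x = (EuclideanSpace.proj j : Space →L[ℝ] ℝ).comp A :=
        ((EuclideanSpace.proj j : Space →L[ℝ] ℝ).comp A).fderiv
      simp [this]
    rw [this]; exact continuous_const
  have hi1 (j : Fin 3) : Integrable fun x : Space =>
      fderiv ℝ F x (EuclideanSpace.single j 1) * A x j := by
    apply Continuous.integrable_of_hasCompactSupport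
    · exact (hcd.clm_apply continuous_const).mul (hcA j)
    · exact (hs.fderiv_apply ℝ _).mul_right
  have hi2 (j : Fin 3) : Integrable fun x : Space =>
      F x * fderiv ℝ (fun y => A y j) x (EuclideanSpace.single j 1) := by
    apply Continuous.integrable_of_hasCompactSupport
    · exact hF.continuous.mul (hfA j)
    · exact hs.mul_right
  have hi3 (j : Fin 3) : Integrable fun x : Space => F x * A x j :=
    (hF.continuous.mul (hcA j)).integrable_of_hasCompactSupport hs.mul_right
  simp_rw [hpt]
  rw [integral_finsetSum _ fun j _ => by exact (hi1 j).add (hi2 j)]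
  apply Finset.sum_eq_zero
  intro j _
  rw [integral_add (hi1 j) (hi2 j),
    integral_mul_fderiv_eq_neg_fderiv_mul_of_integrable (hi1 j) (hi2 j) (hi3 j)
      (fun x _ => hd x) (fun x _ => hdA j x)]
  ring

theorem deriv_smoothTransition_of_one_lt {y : ℝ} (hy : 1 < y) :
    deriv Real.smoothTransition y = 0 := by
  have : Real.smoothTransition =ᶠ[𝓝 y] fun _ => 1 := by
    filter_upwards [lt_mem_nhds hy] with z hz using Real.smoothTransition.one_of_one_le hz.le
  rw [this.deriv_eq]; simp

theorem deriv_smoothTransition_of_neg {y : ℝ} (hy : y < 0) :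
    deriv Real.smoothTransition y = 0 := by
  have : Real.smoothTransition =ᶠ[𝓝 y] fun _ => 0 := by
    filter_upwards [gt_mem_nhds hy] with z hz using Real.smoothTransition.zero_of_nonpos hz.le
  rw [this.deriv_eq]; simp

theorem exists_bound_deriv_smoothTransition :
    ∃ B : ℝ, 0 ≤ B ∧ ∀ y : ℝ, |y * deriv Real.smoothTransition y| ≤ B := by
  have hc : Continuous (deriv Real.smoothTransition) :=
    (Real.smoothTransition.contDiff (n := 1)).continuous_deriv le_rfl
  obtain ⟨B, hB⟩ := (isCompact_Icc (a := (0 : ℝ)) (b := 1)).exists_bound_of_continuousOn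
    (continuous_id.mul hc).continuousOn
  have hB0 : 0 ≤ B := (norm_nonneg _).trans (hB 0 (by simp))
  refine ⟨B, hB0, fun y => ?_⟩
  rcases lt_or_ge y 0 with hy | hy
  · simpa [deriv_smoothTransition_of_neg hy] using hB0
  rcases lt_or_ge 1 y with hy' | hy'
  · simpa [deriv_smoothTransition_of_one_lt hy'] using hB0
  · exact hB y ⟨hy, hy'⟩

section Slice

variable {F : Space → ℝ} {ρ : ℝ}

theorem integrableOn_ext (hρ : 0 < ρ) (hF : ContinuousOn F {x | x ≠ 0})
    (hs : HasCompactSupport F) : IntegrableOn F (ext ρ) := by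
  have hK : IsCompact (tsupport F ∩ {x | ρ ≤ ‖x‖}) :=
    hs.isCompact.inter_right (isClosed_le continuous_const continuous_norm)
  have h1 : IntegrableOn F (tsupport F ∩ {x | ρ ≤ ‖x‖}) :=
    ContinuousOn.integrableOn_compact hK (hF.mono fun x hx => by
      have : 0 < ‖x‖ := hρ.trans_le hx.2
      exact norm_pos_iff.1 this)
  apply h1.of_forall_sdiff_eq_zero (measurableSet_ext ρ)
  rintro x ⟨hx, hx'⟩
  apply image_eq_zero_of_notMem_tsupport
  intro h
  exact hx' ⟨h, (show ρ < ‖x‖ from hx).le⟩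

theorem abs_le_of_vanish (hρ : 0 < ρ) (hF : ∀ x ≠ 0, ContDiffAt ℝ ∞ F x)
    (hs : HasCompactSupport F) (h0 : ∀ x, ‖x‖ = ρ → F x = 0) :
    ∃ M : ℝ, 0 ≤ M ∧ ∀ x, ρ ≤ ‖x‖ → |F x| ≤ M * (‖x‖ - ρ) := by
  have hK : IsCompact (tsupport F ∩ {x | ρ ≤ ‖x‖}) :=
    hs.isCompact.inter_right (isClosed_le continuous_const continuous_norm)
  have hc : ContinuousOn (fderiv ℝ F) (tsupport F ∩ {x | ρ ≤ ‖x‖}) := fun x hx => by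
    have hx0 : x ≠ 0 := norm_pos_iff.1 (hρ.trans_le hx.2)
    have : ContDiffAt ℝ ∞ (fderiv ℝ F) x := (hF x hx0).fderiv_right (by simp)
    exact this.continuousAt.continuousWithinAt
  obtain ⟨M, hM⟩ := hK.exists_bound_of_continuousOn hc
  have hM' : ∀ x, ρ ≤ ‖x‖ → ‖fderiv ℝ F x‖ ≤ max M 0 := fun x hx => by
    by_cases h : x ∈ tsupport F
    · exact (hM x ⟨h, hx⟩).trans (le_max_left _ _)
    · rw [image_eq_zero_of_notMem_tsupport (f := fderiv ℝ F)
        (fun h' => h (tsupport_fderiv_subset ℝ h'))]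
      simp
  refine ⟨max M 0, le_max_right _ _, fun x hx => ?_⟩
  have hx0 : 0 < ‖x‖ := hρ.trans_le hx
  set e : Space := ‖x‖⁻¹ • x with he
  have hne : ‖e‖ = 1 := by rw [he, norm_smul, norm_inv, norm_norm]; field_simp
  have hxe : x = ‖x‖ • e := by rw [he, smul_smul]; field_simp; simp
  have key := norm_image_sub_le_of_norm_deriv_le_segment' (f := fun y : ℝ => F (y • e))
    (f' := fun y => fderiv ℝ F (y • e) e) (a := ρ) (b := ‖x‖) (C := max M 0) ?_ ?_ ‖x‖
    ⟨hx, le_rfl⟩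
  · have h1 : F (ρ • e) = 0 := h0 _ (by rw [norm_smul, hne, Real.norm_of_nonneg hρ.le, mul_one])
    simp only [h1, ← hxe, sub_zero] at key
    exact key
  · intro y hy
    have hy0 : y • e ≠ 0 := by
      rw [← norm_pos_iff, norm_smul, hne, mul_one, Real.norm_eq_abs]
      exact abs_pos.2 (by linarith [hy.1])
    have h1 := ((hF _ hy0).differentiableAt (by simp)).hasFDerivAt
    have h2 : HasDerivAt (fun y : ℝ => y • e) e y := by
      simpa using (hasDerivAt_id y).smul_const e
    exact (h1.comp_hasDerivAt y h2).hasDerivWithinAt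
  · intro y hy
    have : ρ ≤ ‖y • e‖ := by
      rw [norm_smul, hne, mul_one, Real.norm_eq_abs]; exact hy.1.trans (le_abs_self y)
    calc ‖fderiv ℝ F (y • e) e‖ ≤ ‖fderiv ℝ F (y • e)‖ * ‖e‖ := ContinuousLinearMap.le_opNorm _ _
      _ ≤ max M 0 := by rw [hne, mul_one]; exact hM' _ this

theorem integral_ext_linear (hρ : 0 < ρ) (hF : ∀ x ≠ 0, ContDiffAt ℝ ∞ F x)
    (hs : HasCompactSupport F) (A : Space →L[ℝ] Space) (c : ℝ)
    (hA : ∀ x, inner ℝ x (A x) = c * ‖x‖ ^ 2) (h0 : ∀ x, ‖x‖ = ρ → c * F x = 0) :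
    ∫ x in ext ρ, (fderiv ℝ F x (A x) + (∑ j, A (EuclideanSpace.single j 1) j) * F x) = 0 := by
  set d := ∑ j, A (EuclideanSpace.single j 1) j with hd
  set G : Space → ℝ := fun x => fderiv ℝ F x (A x) + d * F x with hG
  have hcF : ContinuousOn F {x | x ≠ 0} := fun x hx => (hF x hx).continuousAt.continuousWithinAt
  have hcG : ContinuousOn G {x | x ≠ 0} := fun x hx => by
    have h1 : ContDiffAt ℝ ∞ (fderiv ℝ F) x := (hF x hx).fderiv_right (by simp)
    exact ((h1.continuousAt.clm_apply A.continuous.continuousAt).add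
      (continuousAt_const.mul (hF x hx).continuousAt)).continuousWithinAt
  have hsG : HasCompactSupport G := by
    refine hs.mono' fun x hx => ?_
    by_contra hcon
    apply hx
    have e1 := image_eq_zero_of_notMem_tsupport hcon
    have e2 : fderiv ℝ F x = 0 := image_eq_zero_of_notMem_tsupport (f := fderiv ℝ F)
        (fun h' => hcon (tsupport_fderiv_subset ℝ h'))
    simp [hG, e1, e2]
  have hiG := integrableOn_ext hρ hcG hsG
  -- the remainder coming from the derivative of the ramp
  set E : ℕ → Space → ℝ := fun n x =>
    deriv Real.smoothTransition (n * (‖x‖ - ρ)) * n * ‖x‖ * (c * F x) with hE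
  have hsmooth (n : ℕ) : ContDiff ℝ ∞ fun x => ramp ρ n x * F x := by
    rw [contDiff_iff_contDiffAt]
    intro x
    by_cases hx : x = 0
    · have : (fun x => ramp ρ n x * F x) =ᶠ[𝓝 x] fun _ => 0 := by
        have : ∀ᶠ y in 𝓝 x, ‖y‖ < ρ :=
          continuous_norm.continuousAt.eventually_lt continuousAt_const (by simpa [hx] using hρ)
        filter_upwards [this] with y hy
        rw [ramp_eq_zero hy.le, zero_mul]
      exact contDiffAt_const.congr_of_eventuallyEq this
    · exact (contDiff_ramp hρ n).contDiffAt.mul (hF x hx)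
  have hdr (n : ℕ) (x : Space) (hx : x ≠ 0) : fderiv ℝ (ramp ρ n) x (A x) =
      deriv Real.smoothTransition (n * (‖x‖ - ρ)) * n * (c * ‖x‖) := by
    have hn : DifferentiableAt ℝ (fun x : Space => ‖x‖) x :=
      (contDiffAt_norm ℝ hx).differentiableAt one_ne_zero
    have h1 : HasFDerivAt (fun x : Space => (n : ℝ) * (‖x‖ - ρ))
        ((n : ℝ) • fderiv ℝ (fun x : Space => ‖x‖) x) x :=
      (hn.hasFDerivAt.sub_const ρ).const_mul (n : ℝ)
    have h2 := (((Real.smoothTransition.contDiff (n := 1)).differentiable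
      one_ne_zero _).hasDerivAt).comp_hasFDerivAt x h1
    have h3 : fderiv ℝ (fun x : Space => ‖x‖) x (A x) = c * ‖x‖ := by
      have h4 : HasFDerivAt (fun x : Space => ‖x‖ ^ 2)
        ((2 * ‖x‖) • fderiv ℝ (fun x : Space => ‖x‖) x) x := by
        simpa using hn.hasFDerivAt.pow 2
      have h5 := congrArg (fun L : Space →L[ℝ] ℝ => L (A x))
        (h4.unique (hasStrictFDerivAt_norm_sq x).hasFDerivAt)
      simp only [FunLike.coe_smul, Pi.smul_apply, smul_eq_mul, innerSL_apply_apply, hA] at h5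
      have : ‖x‖ ≠ 0 := norm_ne_zero_iff.2 hx
      apply mul_left_cancel₀ (mul_ne_zero two_ne_zero this)
      simp only [nsmul_eq_mul] at h5
      push_cast at h5
      linarith
    have h6 : fderiv ℝ (ramp ρ n) x = _ := h2.fderiv
    rw [h6]
    simp only [FunLike.coe_smul, Pi.smul_apply, smul_eq_mul, h3]
    ring
  have hexact (n : ℕ) : ∫ x, (ramp ρ n x * G x + E n x) = 0 := by
    rw [← integral_fderiv_linear A (hsmooth n) hs.mul_left]
    congr 1
    funext x
    by_cases hx : x = 0
    · subst hx
      have : (fun x => ramp ρ n x * F x) =ᶠ[𝓝 (0 : Space)] fun _ => 0 := by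
        have : ∀ᶠ y in 𝓝 (0 : Space), ‖y‖ < ρ :=
          continuous_norm.continuousAt.eventually_lt continuousAt_const (by simpa using hρ)
        filter_upwards [this] with y hy
        rw [ramp_eq_zero hy.le, zero_mul]
      have h0 : ramp ρ n (0 : Space) = 0 := ramp_eq_zero (by simpa using hρ.le)
      simp [hE, h0]
    · rw [fderiv_fun_mul ((contDiff_ramp hρ n).differentiable (by simp) x)
        ((hF x hx).differentiableAt (by simp))]
      simp only [FunLike.coe_add, FunLike.coe_smul, Pi.add_apply,
        Pi.smul_apply, smul_eq_mul, hdr n x hx, hG, hE]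
      ring
  obtain ⟨B, hB0, hB⟩ := exists_bound_deriv_smoothTransition
  obtain ⟨M, hM0, hM⟩ := abs_le_of_vanish (F := fun x => c * F x) hρ
    (fun x hx => contDiffAt_const.mul (hF x hx)) hs.mul_left h0
  have hEbound (n : ℕ) (x : Space) :
      ‖E n x‖ ≤ (tsupport F).indicator (fun x => B * M * ‖x‖) x := by
    by_cases hx : x ∈ tsupport F
    · rw [indicator_of_mem hx]
      rcases lt_or_ge ‖x‖ ρ with hr | hr
      · rcases Nat.eq_zero_or_pos n with hn | hn
        · simp only [hE, hn]; simp; positivity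
        · have : (n : ℝ) * (‖x‖ - ρ) < 0 :=
            mul_neg_of_pos_of_neg (by exact_mod_cast hn) (by linarith)
          simp only [hE, deriv_smoothTransition_of_neg this]; simp; positivity
      · have e1 := hM x hr
        have e2 := hB (n * (‖x‖ - ρ))
        rw [Real.norm_eq_abs]
        simp only [hE]
        rw [abs_mul, abs_mul, abs_norm]
        have h3 : |deriv Real.smoothTransition (↑n * (‖x‖ - ρ)) * ↑n| * (‖x‖ - ρ) ≤ B := by
          refine le_of_eq_of_le ?_ e2
          nth_rewrite 2 [← abs_of_nonneg (sub_nonneg.2 hr)]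
          rw [← abs_mul]
          congr 1; ring
        calc _ ≤ |deriv Real.smoothTransition (↑n * (‖x‖ - ρ)) * ↑n| * ‖x‖ * (M * (‖x‖ - ρ)) := by
              gcongr
          _ = |deriv Real.smoothTransition (↑n * (‖x‖ - ρ)) * ↑n| * (‖x‖ - ρ) * (M * ‖x‖) := by ring
          _ ≤ B * (M * ‖x‖) := by gcongr
          _ = _ := by ring
    · rw [indicator_of_notMem hx]
      simp [hE, image_eq_zero_of_notMem_tsupport hx]
  have hElim (x : Space) : Tendsto (fun n => E n x) atTop (𝓝 0) := by
    rcases lt_trichotomy ‖x‖ ρ with hr | hr | hr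
    · apply tendsto_const_nhds.congr'
      filter_upwards [eventually_gt_atTop 0] with n hn
      have : (n : ℝ) * (‖x‖ - ρ) < 0 :=
        mul_neg_of_pos_of_neg (by exact_mod_cast hn) (by linarith)
      simp [hE, deriv_smoothTransition_of_neg this]
    · simp [hE, h0 x hr]
    · apply tendsto_const_nhds.congr'
      have h1 : Tendsto (fun n : ℕ => (n : ℝ) * (‖x‖ - ρ)) atTop atTop :=
        tendsto_natCast_atTop_atTop.atTop_mul_const (sub_pos.2 hr)
      filter_upwards [h1.eventually_gt_atTop 1] with n hn
      simp [hE, deriv_smoothTransition_of_one_lt hn]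
  have hibound : Integrable (fun x => ‖(ext ρ).indicator G x‖ +
      (tsupport F).indicator (fun x : Space => B * M * ‖x‖) x) := by
    refine ((integrable_indicator_iff (measurableSet_ext ρ)).2 hiG).norm.add ?_
    rw [integrable_indicator_iff (isClosed_tsupport F).measurableSet]
    exact (continuous_const.mul continuous_norm).continuousOn.integrableOn_compact hs.isCompact
  have hlim := tendsto_integral_of_dominated_convergence
    (F := fun n x => ramp ρ n x * G x + E n x) (f := (ext ρ).indicator G) (μ := volume) _
    (fun n => ?_) hibound (fun n => Eventually.of_forall fun x => ?_)
    (Eventually.of_forall fun x => ?_)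
  · simp only [hexact] at hlim
    rw [← integral_indicator (measurableSet_ext ρ)]
    exact (tendsto_nhds_unique hlim tendsto_const_nhds)
  · have hEeq : (fun x => ramp ρ n x * G x + E n x) =
        fun x => fderiv ℝ (fun x => ramp ρ n x * F x) x (A x) + d * (ramp ρ n x * F x) := by
      funext x
      by_cases hx : x = 0
      · subst hx
        have h0 : ramp ρ n (0 : Space) = 0 := ramp_eq_zero (by simpa using hρ.le)
        simp [hE, h0]
      · rw [fderiv_fun_mul ((contDiff_ramp hρ n).differentiable (by simp) x)
          ((hF x hx).differentiableAt (by simp))]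
        simp only [FunLike.coe_add, FunLike.coe_smul, Pi.add_apply,
          Pi.smul_apply, smul_eq_mul, hdr n x hx, hG, hE]
        ring
    rw [hEeq]
    exact ((((hsmooth n).continuous_fderiv (by simp)).clm_apply A.continuous).add
      (continuous_const.mul (hsmooth n).continuous)).aestronglyMeasurable
  · refine (norm_add_le _ _).trans (add_le_add ?_ (hEbound n x))
    by_cases hx : x ∈ ext ρ
    · rw [indicator_of_mem hx, norm_mul, Real.norm_of_nonneg (ramp_nonneg _ _ _)]
      exact mul_le_of_le_one_left (norm_nonneg _) (ramp_le_one _ _ _)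
    · have : ‖x‖ ≤ ρ := not_lt.1 hx
      simp [ramp_eq_zero this]
  · have h1 := ((tendsto_ramp ρ x).mul_const (G x)).add (hElim x)
    convert h1 using 2
    by_cases hx : x ∈ ext ρ
    · simp [indicator_of_mem hx]
    · simp [indicator_of_notMem hx]

end Slice

section Cylinder

variable {H : Space × ℝ → ℝ} {ρ a b : ℝ}

theorem TestFun.continuousOn (h : TestFun H) : ContinuousOn H {p | p.1 ≠ 0} :=
  fun p hp => (h.smooth p hp).continuousAt.continuousWithinAt

theorem TestFun.slice_smooth (h : TestFun H) (τ : ℝ) {x : Space} (hx : x ≠ 0) :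
    ContDiffAt ℝ ∞ (fun x => H (x, τ)) x :=
  (h.smooth (x, τ) hx).comp x (contDiffAt_id.prodMk contDiffAt_const)

theorem TestFun.slice_supp (h : TestFun H) (τ : ℝ) : HasCompactSupport fun x => H (x, τ) := by
  have : IsClosedEmbedding fun x : Space => (x, τ) := by
    refine ⟨isEmbedding_prodMkLeft τ, ?_⟩
    have : range (fun x : Space => (x, τ)) = {p | p.2 = τ} := by
      ext p; constructor
      · rintro ⟨x, rfl⟩; rfl
      · intro hp; exact ⟨p.1, by rw [← show p.2 = τ from hp]⟩
    rw [this]; exact isClosed_eq continuous_snd continuous_const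
  exact h.supp.comp_isClosedEmbedding this

theorem TestFun.slice_continuousOn (h : TestFun H) (τ : ℝ) :
    ContinuousOn (fun x => H (x, τ)) {x | x ≠ 0} :=
  fun _ hx => (h.slice_smooth τ hx).continuousAt.continuousWithinAt

theorem TestFun.slice_integrable (h : TestFun H) (hρ : 0 < ρ) (τ : ℝ) :
    IntegrableOn (fun x => H (x, τ)) (ext ρ) :=
  integrableOn_ext hρ (h.slice_continuousOn τ) (h.slice_supp τ)

theorem TestFun.integrableOn (h : TestFun H) (hρ : 0 < ρ) :
    IntegrableOn H (ext ρ ×ˢ Ioc a b) := by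
  have hK : IsCompact (tsupport H ∩ {p | ρ ≤ ‖p.1‖}) :=
    h.supp.isCompact.inter_right (isClosed_le continuous_const (by fun_prop))
  have h1 : IntegrableOn H (tsupport H ∩ {p | ρ ≤ ‖p.1‖}) :=
    ContinuousOn.integrableOn_compact hK (h.continuousOn.mono fun x hx => by
      have : 0 < ‖x.1‖ := hρ.trans_le hx.2
      exact norm_pos_iff.1 this)
  apply h1.of_forall_sdiff_eq_zero ((measurableSet_ext ρ).prod measurableSet_Ioc)
  rintro x ⟨hx, hx'⟩
  apply image_eq_zero_of_notMem_tsupport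
  intro h
  exact hx' ⟨h, (show ρ < ‖x.1‖ from hx.1).le⟩

theorem fderiv_slice {x : Space} {τ : ℝ} (hH : DifferentiableAt ℝ H (x, τ)) (v : Space) :
    fderiv ℝ (fun x => H (x, τ)) x v = fderiv ℝ H (x, τ) (v, 0) := by
  have h1 : HasFDerivAt (fun x : Space => (x, τ))
      ((ContinuousLinearMap.id ℝ Space).prod (0 : Space →L[ℝ] ℝ)) x :=
    (hasFDerivAt_id x).prodMk (hasFDerivAt_const τ x)
  have h2 : HasFDerivAt (fun x => H (x, τ)) _ x := hH.hasFDerivAt.comp x h1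
  rw [h2.fderiv]; simp

theorem integral_cylinder_symm (h : IntegrableOn H (ext ρ ×ˢ Ioc a b)) :
    ∫ p in ext ρ ×ˢ Ioc a b, H p = ∫ τ in Ioc a b, ∫ x in ext ρ, H (x, τ) := by
  rw [IntegrableOn, Measure.volume_eq_prod, ← Measure.prod_restrict] at h
  rw [Measure.volume_eq_prod, ← Measure.prod_restrict, integral_prod_symm _ h]

theorem integral_dR (h : TestFun H) (hρ : 0 < ρ)
    (h0 : ∀ p : Space × ℝ, ‖p.1‖ = ρ → p.2 ∈ Ioc a b → H p = 0) :
    ∫ p in ext ρ ×ˢ Ioc a b, (dR H p + 3 * H p) = 0 := by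
  have hT : TestFun fun p => dR H p + 3 * H p :=
    h.dR.add (TestFun.weight (OffAxis.const 3) h)
  rw [integral_cylinder_symm (hT.integrableOn hρ)]
  rw [setIntegral_congr_fun (g := fun _ => (0 : ℝ)) measurableSet_Ioc, integral_zero]
  intro τ hτ
  have := integral_ext_linear hρ (fun x hx => h.slice_smooth τ hx) (h.slice_supp τ)
    (ContinuousLinearMap.id ℝ Space) 1 (by simp)
    (fun x hx => by simpa using h0 (x, τ) hx hτ)
  dsimp only
  rw [← this]
  refine setIntegral_congr_fun (measurableSet_ext ρ) fun x hx => ?_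
  have hx0 : x ≠ 0 := norm_pos_iff.1 (hρ.trans hx)
  dsimp only
  rw [fderiv_slice ((h.smooth (x, τ) hx0).differentiableAt (by simp))]
  simp [along, radialField]

theorem integral_dO (i : Fin 3) (h : TestFun H) (hρ : 0 < ρ) :
    ∫ p in ext ρ ×ˢ Ioc a b, dO i H p = 0 := by
  rw [integral_cylinder_symm ((h.dO i).integrableOn hρ)]
  rw [setIntegral_congr_fun (g := fun _ => (0 : ℝ)) measurableSet_Ioc, integral_zero]
  intro τ hτ
  have := integral_ext_linear hρ (fun x hx => h.slice_smooth τ hx) (h.slice_supp τ)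
    (rot i) 0 (by simp [inner_rot]) (fun x hx => by simp)
  dsimp only
  rw [← this]
  refine setIntegral_congr_fun (measurableSet_ext ρ) fun x hx => ?_
  have hx0 : x ≠ 0 := norm_pos_iff.1 (hρ.trans hx)
  dsimp only
  rw [fderiv_slice ((h.smooth (x, τ) hx0).differentiableAt (by simp))]
  have : ∑ j, (rot i) (EuclideanSpace.single j 1) j = 0 := by
    fin_cases i <;> simp [rot_apply, Fin.sum_univ_three]
  simp only [this]
  simp [along, rotField]

theorem integral_dT (h : TestFun H) (hρ : 0 < ρ) (hab : a ≤ b) :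
    ∫ p in ext ρ ×ˢ Ioc a b, dT H p =
      (∫ x in ext ρ, H (x, b)) - ∫ x in ext ρ, H (x, a) := by
  have h1 := h.dT.integrableOn (a := a) (b := b) hρ
  rw [Measure.volume_eq_prod] at h1 ⊢
  rw [setIntegral_prod _ h1, ← integral_sub (h.slice_integrable hρ b) (h.slice_integrable hρ a)]
  refine setIntegral_congr_fun (measurableSet_ext ρ) fun x hx => ?_
  have hx0 : x ≠ 0 := norm_pos_iff.1 (hρ.trans hx)
  rw [← intervalIntegral.integral_of_le hab]
  have hc : Continuous fun τ : ℝ => dT H (x, τ) := by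
    rw [continuous_iff_continuousAt]
    intro τ
    exact (h.dT.smooth (x, τ) hx0).continuousAt.comp (by fun_prop)
  apply intervalIntegral.integral_eq_sub_of_hasDerivAt _ (hc.intervalIntegrable _ _)
  intro τ _
  have h2 : HasDerivAt (fun τ : ℝ => (x, τ)) ((0 : Space), (1 : ℝ)) τ :=
    (hasDerivAt_const τ x).prodMk (hasDerivAt_id τ)
  exact ((h.smooth (x, τ) hx0).differentiableAt (by simp)).hasFDerivAt.comp_hasDerivAt τ h2

/-- The divergence theorem on the cylinder `{‖x‖ > ρ} × (a, b]`, for fields that do not cross the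
lateral boundary. -/
theorem integral_divergence {HR HT : Space × ℝ → ℝ} {HO : Fin 3 → Space × ℝ → ℝ}
    (hR : TestFun HR) (hT : TestFun HT) (hO : ∀ i, TestFun (HO i)) (hρ : 0 < ρ) (hab : a ≤ b)
    (h0 : ∀ p : Space × ℝ, ‖p.1‖ = ρ → p.2 ∈ Ioc a b → HR p = 0) :
    ∫ p in ext ρ ×ˢ Ioc a b, (dR HR p + 3 * HR p + dT HT p + ∑ i, dO i (HO i) p) =
      (∫ x in ext ρ, HT (x, b)) - ∫ x in ext ρ, HT (x, a) := by
  have hT1 : TestFun fun p => dR HR p + 3 * HR p :=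
    hR.dR.add (TestFun.weight (OffAxis.const 3) hR)
  have i1 := hT1.integrableOn (a := a) (b := b) hρ
  have i2 := hT.dT.integrableOn (a := a) (b := b) hρ
  have i3 (i : Fin 3) := ((hO i).dO i).integrableOn (a := a) (b := b) hρ
  rw [integral_add (by exact i1.add i2) (integrable_finsetSum _ fun i _ => i3 i),
    integral_add i1 i2, integral_finsetSum _ fun i _ => i3 i, integral_dR hR hρ h0,
    integral_dT hT hρ hab]
  simp [integral_dO _ (hO _) hρ]

end Cylinder

/-- Localization of a smooth function by a cutoff equal to one near a compact set. -/
theorem exists_localization {f : Space × ℝ → ℝ} {W C : Set (Space × ℝ)} (hW : IsOpen W)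
    (hC : IsCompact C) (hCW : C ⊆ W) (hf : ContDiffOn ℝ ∞ f W) :
    ∃ g : Space × ℝ → ℝ, TestFun g ∧ (∀ p ∈ C, g =ᶠ[𝓝 p] f) ∧
      ∀ p, (p ∉ W ∨ f p = 0) → g p = 0 := by
  obtain ⟨L, hL, hCL, hLW⟩ := exists_compact_between hC hW hCW
  obtain ⟨θ, h1, h0, -⟩ := exists_contMDiffMap_one_nhds_of_subset_interior
    (modelWithCornersSelf ℝ (Space × ℝ)) (n := ⊤) hC.isClosed hCL
  have hθ : ContDiff ℝ ∞ θ := contMDiff_iff_contDiff.1 θ.contMDiff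
  refine ⟨fun p => θ p * f p, ⟨fun p _ => ?_, ?_⟩, fun p hp => ?_, ?_⟩
  · by_cases hp : p ∈ W
    · exact hθ.contDiffAt.mul (hf.contDiffAt (hW.mem_nhds hp))
    · have : (fun p => θ p * f p) =ᶠ[𝓝 p] fun _ => 0 := by
        filter_upwards [hL.isClosed.isOpen_compl.mem_nhds fun h => hp (hLW h)] with y hy
        rw [h0 y hy, zero_mul]
      exact contDiffAt_const.congr_of_eventuallyEq this
  · exact HasCompactSupport.intro hL fun p hp => by rw [h0 p hp, zero_mul]
  · filter_upwards [eventually_nhdsSet_iff_forall.1 h1 p hp] with y hy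
    rw [hy, one_mul]
  · rintro p (hp | hp)
    · simp [h0 p fun h => hp (hLW h)]
    · simp [hp]

/-! ### Calculus rules -/

/-- `g` is differentiable at `p` with derivative `c` along `ξ`. -/
def HasAlong (ξ : Space × ℝ → Space × ℝ) (g : Space × ℝ → ℝ) (p : Space × ℝ) (c : ℝ) : Prop :=
  DifferentiableAt ℝ g p ∧ along ξ g p = c

namespace HasAlong

variable {ξ : Space × ℝ → Space × ℝ} {g h : Space × ℝ → ℝ} {p : Space × ℝ} {c d : ℝ}

theorem add (hg : HasAlong ξ g p c) (hh : HasAlong ξ h p d) :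
    HasAlong ξ (fun y => g y + h y) p (c + d) :=
  ⟨hg.1.add hh.1, by rw [along_add hg.1 hh.1, hg.2, hh.2]⟩

theorem sub (hg : HasAlong ξ g p c) (hh : HasAlong ξ h p d) :
    HasAlong ξ (fun y => g y - h y) p (c - d) :=
  ⟨hg.1.sub hh.1, by rw [along_sub hg.1 hh.1, hg.2, hh.2]⟩

theorem mul (hg : HasAlong ξ g p c) (hh : HasAlong ξ h p d) :
    HasAlong ξ (fun y => g y * h y) p (c * h p + g p * d) :=
  ⟨hg.1.mul hh.1, by rw [along_mul hg.1 hh.1, hg.2, hh.2]⟩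

theorem const (a : ℝ) : HasAlong ξ (fun _ => a) p 0 :=
  ⟨differentiableAt_const a, along_const a⟩

theorem pow_two (hg : HasAlong ξ g p c) : HasAlong ξ (fun y => g y ^ 2) p (2 * g p * c) :=
  ⟨hg.1.pow 2, by rw [along_pow_two hg.1, hg.2]⟩

theorem comp {F : ℝ → ℝ} {F' : ℝ} (hF : HasDerivAt F F' (g p)) (hg : HasAlong ξ g p c) :
    HasAlong ξ (fun y => F (g y)) p (F' * c) :=
  ⟨hF.differentiableAt.comp p hg.1, by
    rw [along_comp hF.differentiableAt hg.1, hg.2, hF.deriv]⟩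

theorem exp (hg : HasAlong ξ g p c) :
    HasAlong ξ (fun y => Real.exp (g y)) p (Real.exp (g p) * c) :=
  comp (Real.hasDerivAt_exp _) hg

theorem of_contDiffAt (hg : ContDiffAt ℝ ∞ g p) : HasAlong ξ g p (along ξ g p) :=
  ⟨hg.differentiableAt (by simp), rfl⟩

theorem congr (hg : HasAlong ξ g p c) (hgh : h =ᶠ[𝓝 p] g) : HasAlong ξ h p c :=
  ⟨hg.1.congr_of_eventuallyEq hgh, by rw [(along_congr hgh).eq_of_nhds, hg.2]⟩

theorem eq (hg : HasAlong ξ g p c) (hcd : c = d) : HasAlong ξ g p d := hcd ▸ hg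

theorem dR_norm (hp : p.1 ≠ 0) : HasAlong radialField (fun y => ‖y.1‖) p ‖p.1‖ :=
  ⟨OffAxis.norm.diff hp, WaveUniqueness.dR_norm hp⟩

theorem dT_norm (hp : p.1 ≠ 0) : HasAlong timeField (fun y => ‖y.1‖) p 0 :=
  ⟨OffAxis.norm.diff hp, WaveUniqueness.dT_norm hp⟩

theorem dO_norm (i : Fin 3) (hp : p.1 ≠ 0) : HasAlong (rotField i) (fun y => ‖y.1‖) p 0 :=
  ⟨OffAxis.norm.diff hp, WaveUniqueness.dO_norm i hp⟩

theorem inv (hg : HasAlong ξ g p c) (h0 : g p ≠ 0) :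
    HasAlong ξ (fun y => (g y)⁻¹) p (-(g p ^ 2)⁻¹ * c) :=
  comp (hasDerivAt_inv h0) hg

theorem dR_snd : HasAlong radialField (fun y => y.2) p 0 :=
  ⟨differentiableAt_snd, along_snd _⟩

theorem dT_snd : HasAlong timeField (fun y => y.2) p 1 :=
  ⟨differentiableAt_snd, along_snd _⟩

theorem dO_snd (i : Fin 3) : HasAlong (rotField i) (fun y => y.2) p 0 :=
  ⟨differentiableAt_snd, along_snd _⟩

theorem dR_inv_norm (hp : p.1 ≠ 0) :
    HasAlong radialField (fun y => ‖y.1‖⁻¹) p (-‖p.1‖⁻¹) := by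
  have : ‖p.1‖ ≠ 0 := norm_ne_zero_iff.2 hp
  exact ((dR_norm hp).inv this).eq (by field_simp)

theorem dT_inv_norm (hp : p.1 ≠ 0) : HasAlong timeField (fun y => ‖y.1‖⁻¹) p 0 :=
  ((dT_norm hp).inv (norm_ne_zero_iff.2 hp)).eq (by simp)

theorem dO_inv_norm (i : Fin 3) (hp : p.1 ≠ 0) : HasAlong (rotField i) (fun y => ‖y.1‖⁻¹) p 0 :=
  ((dO_norm i hp).inv (norm_ne_zero_iff.2 hp)).eq (by simp)

end HasAlong

theorem divergence_eq {HR HT : Space × ℝ → ℝ} {HO : Fin 3 → Space × ℝ → ℝ} {p : Space × ℝ}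
    {a b v : ℝ} {c : Fin 3 → ℝ} (hR : HasAlong radialField HR p a) (hT : HasAlong timeField HT p b)
    (hO : ∀ i, HasAlong (rotField i) (HO i) p (c i)) (hv : a + 3 * HR p + b + ∑ i, c i = v) :
    dR HR p + 3 * HR p + dT HT p + ∑ i, dO i (HO i) p = v := by
  rw [hR.2, hT.2, ← hv]
  simp only [(hO _).2]

/-! ### The multiplier identity -/

section Multiplier

/-- Radial component of the multiplier current. -/
noncomputable def currentR (s σ κ : ℝ) (w : Space × ℝ → ℝ) (p : Space × ℝ) : ℝ :=
  ‖p.1‖⁻¹ * (‖p.1‖⁻¹ * (8 * dT w p ^ 2)) - ‖p.1‖⁻¹ * (‖p.1‖⁻¹ * (‖p.1‖⁻¹ * (8 * s * (dT w p * dR w p))))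
  + (s * (κ - 2 * p.2) * ‖p.1‖⁻¹ - 8) *
    (‖p.1‖⁻¹ * (‖p.1‖⁻¹ * (‖p.1‖⁻¹ * (‖p.1‖⁻¹ * (1 / 2 * (∑ i, dO i w p ^ 2 - dR w p ^ 2)))))) +
  (s * (κ - 2 * p.2) * ‖p.1‖⁻¹ - 8) *
    ((8 * σ ^ 2 * (s * (κ - 2 * p.2) * ‖p.1‖⁻¹ - 4) + 4 * σ * (‖p.1‖⁻¹ * ‖p.1‖⁻¹)) * w p ^ 2)

/-- Temporal component of the multiplier current. -/
noncomputable def currentT (s σ κ : ℝ) (w : Space × ℝ → ℝ) (p : Space × ℝ) : ℝ :=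
  ‖p.1‖⁻¹ * (‖p.1‖⁻¹ * (‖p.1‖⁻¹ * (((κ - 2 * p.2) * ‖p.1‖⁻¹ - 4 * s) * dR w p ^ 2 +
    4 * s * ∑ i, dO i w p ^ 2))) +
  (64 * σ ^ 2 * (κ - 2 * p.2 - 4 * s * ‖p.1‖) + 32 * σ * s * ‖p.1‖⁻¹) * w p ^ 2

/-- Angular components of the multiplier current. -/
noncomputable def currentO (s κ : ℝ) (w : Space × ℝ → ℝ) (i : Fin 3) (p : Space × ℝ) : ℝ :=
  ‖p.1‖⁻¹ * (‖p.1‖⁻¹ * (‖p.1‖⁻¹ * (-(8 * s) * (dT w p * dO i w p) -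
    (s * (κ - 2 * p.2) * ‖p.1‖⁻¹ - 8) * (‖p.1‖⁻¹ * (dR w p * dO i w p)))))

/-- The multiplier. -/
noncomputable def multiplier (s κ : ℝ) (w : Space × ℝ → ℝ) (p : Space × ℝ) : ℝ :=
  8 * s * ‖p.1‖ * dT w p + (s * (κ - 2 * p.2) - 8 * ‖p.1‖) * (‖p.1‖⁻¹ * dR w p)

variable {s σ κ : ℝ} {w : Space × ℝ → ℝ} {p : Space × ℝ}

set_option maxHeartbeats 1600000 in
theorem multiplier_identity (hs : s = 1 ∨ s = -1) (hw : ContDiffAt ℝ ∞ w p) (hp : p.1 ≠ 0) :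
    dR (currentR s σ κ w) p + 3 * currentR s σ κ w p + dT (currentT s σ κ w) p +
      ∑ i, dO i (currentO s κ w i) p =
    (‖p.1‖ ^ 2)⁻¹ * ((charOp s w p / ‖p.1‖ ^ 2 +
        σ ^ 2 * (16 * s * ‖p.1‖ * (κ - 2 * p.2) - 64 * ‖p.1‖ ^ 2) * w p + 8 * σ * w p) *
          multiplier s κ w p
      + 2 * (2 * s * dT w p - dR w p / ‖p.1‖) ^ 2
      + (4 * ‖p.1‖ - s * (κ - 2 * p.2)) / ‖p.1‖ ^ 3 * ∑ i, dO i w p ^ 2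
      + (8 * σ ^ 2 * (4 * ‖p.1‖ - s * (κ - 2 * p.2)) * (20 * ‖p.1‖ - s * (κ - 2 * p.2)) - 32 * σ)
          * w p ^ 2) := by
  have hr : ‖p.1‖ ≠ 0 := norm_ne_zero_iff.2 hp
  have a0 {ξ} : HasAlong ξ w p (along ξ w p) := .of_contDiffAt hw
  have aT {ξ} : HasAlong ξ (dT w) p (along ξ (dT w) p) := .of_contDiffAt (contDiffAt_dT hw)
  have aR {ξ} : HasAlong ξ (dR w) p (along ξ (dR w) p) := .of_contDiffAt (contDiffAt_dR hw)
  have aO {ξ} (i : Fin 3) : HasAlong ξ (dO i w) p (along ξ (dO i w) p) :=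
    .of_contDiffAt (contDiffAt_dO i hw)
  apply divergence_eq (HR := currentR s σ κ w) (HT := currentT s σ κ w) (HO := currentO s κ w)
  case hR =>
    unfold currentR
    repeat' first
      | exact a0 | exact aT | exact aR | exact aO _ | exact .const _
      | exact .dR_inv_norm hp | exact .dR_norm hp | exact .dR_snd
      | apply HasAlong.sub | apply HasAlong.add | apply HasAlong.pow_two | apply HasAlong.mul
  case hT =>
    unfold currentT
    repeat' first
      | exact a0 | exact aT | exact aR | exact aO _ | exact .const _
      | exact .dT_inv_norm hp | exact .dT_norm hp | exact .dT_snd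
      | apply HasAlong.sub | apply HasAlong.add | apply HasAlong.pow_two | apply HasAlong.mul
  case hO =>
    intro i
    unfold currentO
    repeat' first
      | exact a0 | exact aT | exact aR | exact aO _ | exact .const _
      | exact .dO_inv_norm i hp | exact .dO_norm i hp | exact .dO_snd i
      | apply HasAlong.sub | apply HasAlong.add | apply HasAlong.pow_two | apply HasAlong.mul
  case hv =>
    unfold currentR multiplier charOp
    simp only [Fin.sum_univ_three, Fin.isValue, Fin.zero_eta, Fin.mk_one, Fin.reduceFinMk,
      dT_dR hw, dT_dO _ hw, dR_dO _ hw]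
    generalize dR (dR w) p = wRR, dR (dT w) p = wRT, dT (dT w) p = wTT,
      dO 0 (dR w) p = w0R, dO 1 (dR w) p = w1R, dO 2 (dR w) p = w2R,
      dO 0 (dT w) p = w0T, dO 1 (dT w) p = w1T, dO 2 (dT w) p = w2T,
      dO 0 (dO 0 w) p = w00, dO 1 (dO 1 w) p = w11, dO 2 (dO 2 w) p = w22,
      dR w p = wR, dT w p = wT, dO 0 w p = w0, dO 1 w p = w1, dO 2 w p = w2, w p = w
    generalize ‖p.1‖ = r at *
    generalize p.2 = τ
    rcases hs with rfl | rfl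
    · field_simp
      ring
    · field_simp
      ring

end Multiplier

/-! ### The Carleman estimate -/

section Carleman

variable {s σ κ : ℝ} {g w : Space × ℝ → ℝ} {p : Space × ℝ}

theorem along_eq_zero {ξ : Space × ℝ → Space × ℝ} (h : w =ᶠ[𝓝 p] 0) : along ξ w p = 0 := by
  rw [(along_congr h).eq_of_nhds]
  exact along_const 0

theorem charOp_eq_zero (h : w =ᶠ[𝓝 p] 0) : charOp s w p = 0 := by
  have h1 (ξ : Space × ℝ → Space × ℝ) : along ξ w =ᶠ[𝓝 p] 0 := by
    filter_upwards [h.eventually_nhds] with y hy using along_eq_zero hy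
  simp [charOp, along_eq_zero (h1 _), along_eq_zero h]

theorem currentR_eq_zero (h : w =ᶠ[𝓝 p] 0) : currentR s σ κ w p = 0 := by
  simp [currentR, along_eq_zero h, h.eq_of_nhds]

theorem currentT_eq_zero (h : w =ᶠ[𝓝 p] 0) : currentT s σ κ w p = 0 := by
  simp [currentT, along_eq_zero h, h.eq_of_nhds]

theorem currentO_eq_zero (i : Fin 3) (h : w =ᶠ[𝓝 p] 0) : currentO s κ w i p = 0 := by
  simp [currentO, along_eq_zero h]

theorem OffAxis.sum {F : Fin 3 → Space × ℝ → ℝ} (h : ∀ i, OffAxis (F i)) :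
    OffAxis fun p => ∑ i, F i p := by
  simp only [Fin.sum_univ_three]
  exact ((h 0).add (h 1)).add (h 2)

theorem TestFun.of_vanish {H : Space × ℝ → ℝ} (hw : TestFun w) (hH : OffAxis H)
    (h : ∀ p, w =ᶠ[𝓝 p] 0 → H p = 0) : TestFun H := by
  refine ⟨hH, hw.supp.mono' fun p hp => ?_⟩
  by_contra hcon
  exact hp (h p (notMem_tsupport_iff_eventuallyEq.1 hcon))

theorem testFun_currentR (hw : TestFun w) : TestFun (currentR s σ κ w) := by
  refine hw.of_vanish ?_ fun p hp => currentR_eq_zero hp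
  have hR := hw.dR.smooth
  have hT := hw.dT.smooth
  have hO i := (hw.dO i).smooth
  have h0 := hw.smooth
  unfold currentR
  repeat' first
    | exact hR | exact hT | exact hO _ | exact h0 | exact .const _ | exact .inv_norm | exact .norm
    | exact .snd | (apply OffAxis.sum; intro) | apply OffAxis.sub | apply OffAxis.add
    | apply OffAxis.pow | apply OffAxis.mul

theorem testFun_currentT (hw : TestFun w) : TestFun (currentT s σ κ w) := by
  refine hw.of_vanish ?_ fun p hp => currentT_eq_zero hp
  have hR := hw.dR.smooth
  have hT := hw.dT.smooth
  have hO i := (hw.dO i).smooth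
  have h0 := hw.smooth
  unfold currentT
  repeat' first
    | exact hR | exact hT | exact hO _ | exact h0 | exact .const _ | exact .inv_norm | exact .norm
    | exact .snd | (apply OffAxis.sum; intro) | apply OffAxis.sub | apply OffAxis.add
    | apply OffAxis.pow | apply OffAxis.mul

theorem testFun_currentO (hw : TestFun w) (i : Fin 3) : TestFun (currentO s κ w i) := by
  refine hw.of_vanish ?_ fun p hp => currentO_eq_zero i hp
  have hR := hw.dR.smooth
  have hT := hw.dT.smooth
  have hO i := (hw.dO i).smooth
  have h0 := hw.smooth
  unfold currentO
  repeat' first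
    | exact hR | exact hT | exact hO _ | exact h0 | exact .const _ | exact .inv_norm | exact .norm
    | exact .snd | apply OffAxis.sub | apply OffAxis.add
    | apply OffAxis.pow | apply OffAxis.mul

/-- The Carleman weight. -/
noncomputable def weight (σ κ : ℝ) (p : Space × ℝ) : ℝ :=
  Real.exp (σ * (4 * ‖p.1‖ ^ 2 - p.2 ^ 2 + κ * p.2))

theorem offAxis_weight : OffAxis (weight σ κ) :=
  .comp Real.contDiff_exp (.mul (.const _) (.add (.sub (.mul (.const _) (.pow .norm _))
    (.pow .snd _)) (.mul (.const _) .snd)))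

theorem weight_pos : 0 < weight σ κ p := Real.exp_pos _

theorem HasAlong.dR_weight (hp : p.1 ≠ 0) :
    HasAlong radialField (weight σ κ) p (weight σ κ p * (8 * σ * ‖p.1‖ ^ 2)) := by
  refine HasAlong.eq (HasAlong.exp (.mul (.const _) (.add (.sub (.mul (.const _)
    (.pow_two (.dR_norm hp))) (.pow_two .dR_snd)) (.mul (.const _) .dR_snd)))) ?_
  simp only [weight]
  ring

theorem HasAlong.dT_weight (hp : p.1 ≠ 0) :
    HasAlong timeField (weight σ κ) p (weight σ κ p * (σ * (κ - 2 * p.2))) := by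
  refine HasAlong.eq (HasAlong.exp (.mul (.const _) (.add (.sub (.mul (.const _)
    (.pow_two (.dT_norm hp))) (.pow_two .dT_snd)) (.mul (.const _) .dT_snd)))) ?_
  simp only [weight]
  ring

theorem HasAlong.dO_weight (i : Fin 3) (hp : p.1 ≠ 0) :
    HasAlong (rotField i) (weight σ κ) p 0 := by
  refine HasAlong.eq (HasAlong.exp (.mul (.const _) (.add (.sub (.mul (.const _)
    (.pow_two (.dO_norm i hp))) (.pow_two (.dO_snd i))) (.mul (.const _) (.dO_snd i))))) ?_
  ring

theorem dR_conj (hg : ContDiffAt ℝ ∞ g p) (hp : p.1 ≠ 0) :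
    dR (fun y => weight σ κ y * g y) p =
      weight σ κ p * (8 * σ * ‖p.1‖ ^ 2 * g p + dR g p) := by
  rw [((HasAlong.dR_weight hp).mul (.of_contDiffAt hg)).2]
  ring

theorem dT_conj (hg : ContDiffAt ℝ ∞ g p) (hp : p.1 ≠ 0) :
    dT (fun y => weight σ κ y * g y) p =
      weight σ κ p * (σ * (κ - 2 * p.2) * g p + dT g p) := by
  rw [((HasAlong.dT_weight hp).mul (.of_contDiffAt hg)).2]
  ring

theorem dO_conj (i : Fin 3) (hg : ContDiffAt ℝ ∞ g p) (hp : p.1 ≠ 0) :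
    dO i (fun y => weight σ κ y * g y) p = weight σ κ p * dO i g p := by
  rw [((HasAlong.dO_weight i hp).mul (.of_contDiffAt hg)).2]
  ring

/-- Conjugation of the characteristic operator with the Carleman weight. -/
theorem charOp_conj (hs : s = 1 ∨ s = -1) (hgs : OffAxis g) (hp : p.1 ≠ 0) :
    charOp s (fun y => weight σ κ y * g y) p / ‖p.1‖ ^ 2 +
        σ ^ 2 * (16 * s * ‖p.1‖ * (κ - 2 * p.2) - 64 * ‖p.1‖ ^ 2) * (weight σ κ p * g p) +
        8 * σ * (weight σ κ p * g p) =
      weight σ κ p * (charOp s g p / ‖p.1‖ ^ 2) +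
        2 * σ * multiplier s κ (fun y => weight σ κ y * g y) p := by
  have hr : ‖p.1‖ ≠ 0 := norm_ne_zero_iff.2 hp
  have hg := hgs p hp
  have he : ∀ᶠ y : Space × ℝ in 𝓝 p, y.1 ≠ 0 := continuous_fst.continuousAt.eventually_ne hp
  have a0 {ξ} : HasAlong ξ g p (along ξ g p) := .of_contDiffAt hg
  have aT {ξ} : HasAlong ξ (dT g) p (along ξ (dT g) p) := .of_contDiffAt (contDiffAt_dT hg)
  have aR {ξ} : HasAlong ξ (dR g) p (along ξ (dR g) p) := .of_contDiffAt (contDiffAt_dR hg)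
  have aO {ξ} (i : Fin 3) : HasAlong ξ (dO i g) p (along ξ (dO i g) p) :=
    .of_contDiffAt (contDiffAt_dO i hg)
  have h1 : HasAlong radialField (dT fun y => weight σ κ y * g y) p _ :=
    HasAlong.congr ((HasAlong.dR_weight hp).mul (((HasAlong.const σ).mul ((HasAlong.const κ).sub
      ((HasAlong.const 2).mul .dR_snd))).mul a0 |>.add aT))
      (he.mono fun y hy => dT_conj (hgs y hy) hy)
  have h2 : HasAlong radialField (dR fun y => weight σ κ y * g y) p _ :=
    HasAlong.congr ((HasAlong.dR_weight hp).mul (((HasAlong.const (8 * σ)).mul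
      (HasAlong.pow_two (.dR_norm hp))).mul a0 |>.add aR))
      (he.mono fun y hy => dR_conj (hgs y hy) hy)
  have h3 (i : Fin 3) : HasAlong (rotField i) (dO i fun y => weight σ κ y * g y) p _ :=
    HasAlong.congr ((HasAlong.dO_weight i hp).mul (aO i))
      (he.mono fun y hy => dO_conj i (hgs y hy) hy)
  unfold multiplier charOp
  rw [h1.2, h2.2, dR_conj hg hp, dT_conj hg hp]
  simp only [(h3 _).2, Fin.sum_univ_three]
  rcases hs with rfl | rfl
  · field_simp
    ring
  · field_simp
    ring

/-- Pointwise lower bound for the divergence of the multiplier current. -/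
theorem divergence_lower_bound {M N d : ℝ} (hs : s = 1 ∨ s = -1) (hσ : 0 < σ)
    (hgs : OffAxis g) (hp : p.1 ≠ 0) (hd : 0 ≤ d)
    (h1 : |charOp s g p| ≤ ‖p.1‖ ^ 2 * (M * |g p| + N))
    (h2 : g =ᶠ[𝓝 p] 0 ∨ d ≤ 4 * ‖p.1‖ - s * (κ - 2 * p.2))
    (h3 : M ^ 2 / (4 * σ) ≤ 8 * σ ^ 2 * d ^ 2 - 32 * σ) :
    -(1 / (4 * σ) * ((‖p.1‖ ^ 2)⁻¹ * (weight σ κ p ^ 2 * N ^ 2))) ≤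
      dR (currentR s σ κ fun y => weight σ κ y * g y) p +
        3 * currentR s σ κ (fun y => weight σ κ y * g y) p +
        dT (currentT s σ κ fun y => weight σ κ y * g y) p +
        ∑ i, dO i (currentO s κ (fun y => weight σ κ y * g y) i) p := by
  have hr : 0 < ‖p.1‖ := norm_pos_iff.2 hp
  rw [multiplier_identity hs ((offAxis_weight p hp).mul (hgs p hp)) hp, charOp_conj hs hgs hp]
  have hw := weight_pos (σ := σ) (κ := κ) (p := p)
  rcases h2 with h0 | h2
  · have h0' : (fun y => weight σ κ y * g y) =ᶠ[𝓝 p] 0 := by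
      filter_upwards [h0] with y hy
      simp [hy]
    simp only [multiplier, charOp_eq_zero h0, along_eq_zero h0', h0.eq_of_nhds]
    simp
    positivity
  · rw [mul_left_comm, ← mul_neg]
    refine mul_le_mul_of_nonneg_left ?_ (by positivity)
    have hO : 0 ≤ ∑ i, dO i (fun y => weight σ κ y * g y) p ^ 2 :=
      Finset.sum_nonneg fun i _ => sq_nonneg _
    have hO' : 0 ≤ (4 * ‖p.1‖ - s * (κ - 2 * p.2)) / ‖p.1‖ ^ 3 *
        ∑ i, dO i (fun y => weight σ κ y * g y) p ^ 2 :=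
      mul_nonneg (div_nonneg (hd.trans h2) (by positivity)) hO
    set X := multiplier s κ (fun y => weight σ κ y * g y) p
    set e := weight σ κ p
    have hR : (charOp s g p / ‖p.1‖ ^ 2) ^ 2 ≤ 2 * M ^ 2 * g p ^ 2 + 2 * N ^ 2 := by
      have : |charOp s g p / ‖p.1‖ ^ 2| ≤ M * |g p| + N := by
        rw [abs_div, abs_of_pos (show 0 < ‖p.1‖ ^ 2 by positivity), div_le_iff₀ (by positivity)]
        linarith
      have h5 := sq_le_sq' (by linarith [abs_nonneg (charOp s g p / ‖p.1‖ ^ 2)]) this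
      rw [sq_abs] at h5
      nlinarith [sq_nonneg (M * |g p| - N), sq_abs (g p)]
    have hR2 : (e * (charOp s g p / ‖p.1‖ ^ 2)) ^ 2 / (8 * σ) ≤
        M ^ 2 / (4 * σ) * (e * g p) ^ 2 + 1 / (4 * σ) * (e ^ 2 * N ^ 2) := by
      have := mul_le_mul_of_nonneg_left hR (show 0 ≤ e ^ 2 / (8 * σ) by positivity)
      calc _ = e ^ 2 / (8 * σ) * (charOp s g p / ‖p.1‖ ^ 2) ^ 2 := by ring
        _ ≤ _ := this
        _ = _ := by ring
    set Y := e * (charOp s g p / ‖p.1‖ ^ 2)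
    have hXY : -(Y ^ 2 / (8 * σ)) ≤ (Y + 2 * σ * X) * X := by
      have : (Y + 2 * σ * X) * X + Y ^ 2 / (8 * σ) = (Y + 4 * σ * X) ^ 2 / (8 * σ) := by
        field_simp
        ring
      have : 0 ≤ (Y + 4 * σ * X) ^ 2 / (8 * σ) := by positivity
      linarith
    have hd2 : d ^ 2 ≤ (4 * ‖p.1‖ - s * (κ - 2 * p.2)) * (20 * ‖p.1‖ - s * (κ - 2 * p.2)) := by
      nlinarith
    have hc : M ^ 2 / (4 * σ) * (e * g p) ^ 2 ≤ (8 * σ ^ 2 * (4 * ‖p.1‖ - s * (κ - 2 * p.2)) *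
        (20 * ‖p.1‖ - s * (κ - 2 * p.2)) - 32 * σ) * (e * g p) ^ 2 := by
      refine mul_le_mul_of_nonneg_right (h3.trans ?_) (sq_nonneg _)
      have := mul_le_mul_of_nonneg_left hd2 (show 0 ≤ 8 * σ ^ 2 by positivity)
      nlinarith
    have hsq : 0 ≤ 2 * (2 * s * dT (fun y => weight σ κ y * g y) p -
        dR (fun y => weight σ κ y * g y) p / ‖p.1‖) ^ 2 := by positivity
    linarith

/-- The Carleman estimate, as a bound for the flux of the multiplier current through `τ = a`. -/
theorem carleman {M d ρ a b : ℝ} {N : Space × ℝ → ℝ} (hs : s = 1 ∨ s = -1) (hσ : 0 < σ)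
    (hg : TestFun g) (hρ : 0 < ρ) (hab : a ≤ b) (hd : 0 ≤ d)
    (hN : IntegrableOn (fun p => (‖p.1‖ ^ 2)⁻¹ * (weight σ κ p ^ 2 * N p ^ 2))
      (ext ρ ×ˢ Ioc a b))
    (h1 : ∀ p ∈ ext ρ ×ˢ Ioc a b, |charOp s g p| ≤ ‖p.1‖ ^ 2 * (M * |g p| + N p))
    (h2 : ∀ p ∈ ext ρ ×ˢ Ioc a b, g =ᶠ[𝓝 p] 0 ∨ d ≤ 4 * ‖p.1‖ - s * (κ - 2 * p.2))
    (h3 : M ^ 2 / (4 * σ) ≤ 8 * σ ^ 2 * d ^ 2 - 32 * σ)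
    (h4 : ∀ p : Space × ℝ, ‖p.1‖ = ρ → p.2 ∈ Ioc a b → g =ᶠ[𝓝 p] 0)
    (h5 : ∀ x ∈ ext ρ, g =ᶠ[𝓝 (x, b)] 0) :
    ∫ x in ext ρ, currentT s σ κ (fun y => weight σ κ y * g y) (x, a) ≤
      1 / (4 * σ) * ∫ p in ext ρ ×ˢ Ioc a b, (‖p.1‖ ^ 2)⁻¹ * (weight σ κ p ^ 2 * N p ^ 2) := by
  set w : Space × ℝ → ℝ := fun y => weight σ κ y * g y with hwdef
  have hw : TestFun w := .weight offAxis_weight hg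
  have hw0 {p : Space × ℝ} (h : g =ᶠ[𝓝 p] 0) : w =ᶠ[𝓝 p] 0 := by
    filter_upwards [h] with y hy
    simp [hwdef, hy]
  have hR := testFun_currentR (s := s) (σ := σ) (κ := κ) hw
  have hT := testFun_currentT (s := s) (σ := σ) (κ := κ) hw
  have hO := testFun_currentO (s := s) (κ := κ) hw
  have hdiv := integral_divergence hR hT hO hρ hab fun p hp hp2 => currentR_eq_zero (hw0 (h4 p hp hp2))
  have hzero : ∫ x in ext ρ, currentT s σ κ w (x, b) = 0 := by
    rw [setIntegral_congr_fun (g := fun _ => (0 : ℝ)) (measurableSet_ext ρ), integral_zero]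
    exact fun x hx => currentT_eq_zero (hw0 (h5 x hx))
  rw [hzero, zero_sub] at hdiv
  have hint : IntegrableOn (fun p => dR (currentR s σ κ w) p + 3 * currentR s σ κ w p +
      dT (currentT s σ κ w) p + ∑ i, dO i (currentO s κ w i) p) (ext ρ ×ˢ Ioc a b) :=
    TestFun.integrableOn (((hR.dR.add (.weight (.const 3) hR)).add hT.dT).add
      (.sum _ fun i => (hO i).dO i)) hρ
  have hle := setIntegral_mono_on (hN.const_mul (1 / (4 * σ))).neg hint
    ((measurableSet_ext ρ).prod measurableSet_Ioc) fun p hp => by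
      have hp0 : p.1 ≠ 0 := norm_pos_iff.1 (hρ.trans hp.1)
      exact divergence_lower_bound hs hσ hg.smooth hp0 hd (h1 p hp) (h2 p hp) h3
  rw [hdiv] at hle
  simp only [Pi.neg_apply, integral_neg, integral_const_mul] at hle
  linarith

end Carleman

/-! ### Characteristic coordinates -/

section Coordinates

variable {s : ℝ} {u : Space × ℝ → ℝ} {p : Space × ℝ}

/-- The change of variables `t = τ + s|x|`. -/
noncomputable def shear (s : ℝ) (p : Space × ℝ) : Space × ℝ := (p.1, p.2 + s * ‖p.1‖)

theorem contDiffAt_shear (hp : p.1 ≠ 0) : ContDiffAt ℝ ∞ (shear s) p :=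
  contDiffAt_fst.prodMk (contDiffAt_snd.add (contDiffAt_const.mul (contDiffAt_norm_fst hp)))

theorem fderiv_shear (hp : p.1 ≠ 0) (ξ : Space × ℝ → Space × ℝ) :
    fderiv ℝ (shear s) p (ξ p) =
      ((ξ p).1, (ξ p).2 + s * along ξ (fun y : Space × ℝ => ‖y.1‖) p) := by
  have h1 : HasFDerivAt (fun y : Space × ℝ => ‖y.1‖) _ p :=
    ((contDiffAt_norm_fst hp).differentiableAt (by simp)).hasFDerivAt
  have h2 : HasFDerivAt (shear s) _ p :=
    hasFDerivAt_fst.prodMk (hasFDerivAt_snd.add (h1.const_mul s))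
  rw [h2.fderiv]
  simp [along]

theorem along_shear (hu : ContDiffAt ℝ ∞ u (shear s p)) (hp : p.1 ≠ 0)
    (ξ : Space × ℝ → Space × ℝ) :
    HasAlong ξ (fun y => u (shear s y)) p
      (fderiv ℝ u (shear s p) ((ξ p).1, (ξ p).2 + s * along ξ (fun y : Space × ℝ => ‖y.1‖) p)) := by
  have h1 : DifferentiableAt ℝ u (shear s p) := hu.differentiableAt (by simp)
  have h2 : DifferentiableAt ℝ (shear s) p := (contDiffAt_shear hp).differentiableAt (by simp)
  have h3 := h1.hasFDerivAt.comp p h2.hasFDerivAt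
  refine ⟨h3.differentiableAt, ?_⟩
  change fderiv ℝ (u ∘ shear s) p (ξ p) = _
  rw [h3.fderiv, ContinuousLinearMap.comp_apply, fderiv_shear hp]

theorem dT_shear (hu : ContDiffAt ℝ ∞ u (shear s p)) (hp : p.1 ≠ 0) :
    HasAlong timeField (fun y => u (shear s y)) p (dT u (shear s p)) :=
  (along_shear hu hp _).eq (by rw [dT_norm hp]; simp [timeField, along])

theorem dO_shear (i : Fin 3) (hu : ContDiffAt ℝ ∞ u (shear s p)) (hp : p.1 ≠ 0) :
    HasAlong (rotField i) (fun y => u (shear s y)) p (dO i u (shear s p)) :=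
  (along_shear hu hp _).eq (by rw [dO_norm i hp]; simp [rotField, along, shear])

theorem dR_shear (hu : ContDiffAt ℝ ∞ u (shear s p)) (hp : p.1 ≠ 0) :
    HasAlong radialField (fun y => u (shear s y)) p
      (dR u (shear s p) + s * ‖p.1‖ * dT u (shear s p)) := by
  refine (along_shear hu hp _).eq ?_
  rw [dR_norm hp]
  have : ((radialField p).1, (radialField p).2 + s * ‖p.1‖) =
      radialField (shear s p) + (s * ‖p.1‖) • timeField (shear s p) := by
    simp [radialField, timeField, shear]
  rw [this, map_add, map_smul]
  rfl

theorem dir2_eq (hu : ContDiffAt ℝ ∞ u p) (v : Space × ℝ) :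
    dir2 u p v = fderiv ℝ (fderiv ℝ u) p v v := by
  have h1 : ContDiffAt ℝ ∞ (fderiv ℝ u) p := hu.fderiv_right (by simp)
  have h2 : DifferentiableAt ℝ (fderiv ℝ u) p := h1.differentiableAt (by simp)
  have hl (a : ℝ) : HasDerivAt (fun a : ℝ => p + a • v) v a := by
    simpa using ((hasDerivAt_id a).smul_const v).const_add p
  have hc : Tendsto (fun a : ℝ => p + a • v) (𝓝 0) (𝓝 p) := by
    simpa using (hl 0).continuousAt.tendsto
  have he : ∀ᶠ y in 𝓝 p, DifferentiableAt ℝ u y := by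
    have h3 : ContDiffAt ℝ 1 u p := hu.of_le (by exact_mod_cast le_top)
    filter_upwards [h3.eventually (by simp)] with y hy using hy.differentiableAt (by simp)
  have hd : deriv (fun a : ℝ => u (p + a • v)) =ᶠ[𝓝 0] fun a => fderiv ℝ u (p + a • v) v := by
    filter_upwards [hc.eventually he] with a ha
    exact (ha.hasFDerivAt.comp_hasDerivAt a (hl a)).deriv
  have h2' : HasFDerivAt (fderiv ℝ u) (fderiv ℝ (fderiv ℝ u) p) (p + (0 : ℝ) • v) := by
    simpa using h2.hasFDerivAt
  have h4 : HasDerivAt (fun a : ℝ => fderiv ℝ u (p + a • v))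
      (fderiv ℝ (fderiv ℝ u) p v) 0 := h2'.comp_hasDerivAt (0 : ℝ) (hl 0)
  have h5 : HasDerivAt (fun a : ℝ => fderiv ℝ u (p + a • v) v)
      (fderiv ℝ (fderiv ℝ u) p v v) 0 := by
    simpa using h4.clm_apply (hasDerivAt_const (0 : ℝ) v)
  rw [dir2, iteratedDeriv_succ, iteratedDeriv_one, hd.deriv_eq, h5.deriv]

theorem space_eq_sum (x : Space) : x = ∑ i, x i • EuclideanSpace.single i (1 : ℝ) := by
  ext k; simp [Finset.sum_apply, Pi.single_apply]

theorem sum_rot_rot (x : Space) : ∑ i, rot i (rot i x) = -(2 : ℝ) • x := by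
  ext k
  fin_cases k <;> simp [Fin.sum_univ_three, rot_apply] <;> ring

theorem sum_bilin_rot (B : Space →L[ℝ] Space →L[ℝ] ℝ) (x : Space) :
    ∑ i, B (rot i x) (rot i x) + B x x =
      ‖x‖ ^ 2 * ∑ i, B (EuclideanSpace.single i 1) (EuclideanSpace.single i 1) := by
  have hx : ‖x‖ ^ 2 = x 0 ^ 2 + x 1 ^ 2 + x 2 ^ 2 := by
    rw [EuclideanSpace.norm_sq_eq]; simp [Fin.sum_univ_three]
  have hB : B x x = B (∑ i, x i • EuclideanSpace.single i (1 : ℝ))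
      (∑ i, x i • EuclideanSpace.single i (1 : ℝ)) := by rw [← space_eq_sum]
  rw [hx, hB]
  simp only [rot_apply, Fin.sum_univ_three, map_add, map_sub, map_smul, FunLike.coe_add,
    FunLike.coe_sub, FunLike.coe_smul, Pi.add_apply, Pi.sub_apply, Pi.smul_apply, smul_eq_mul]
  simp
  ring

theorem waveOp3_eq (hu : ContDiffAt ℝ ∞ u p) :
    ‖p.1‖ ^ 2 * waveOp3 u p = ‖p.1‖ ^ 2 * dT (dT u) p -
      (dR (dR u) p + dR u p + ∑ i, dO i (dO i u) p) := by
  have hRd := contDiff_radialField.differentiable (by simp) p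
  have hTd := contDiff_timeField.differentiable (by simp) p
  have hOd i := (contDiff_rotField i).differentiable (by simp) p
  simp only [waveOp3, dir2_eq hu, along_along hRd hu, along_along hTd hu, along_along (hOd _) hu,
    fderiv_radialField, fderiv_timeField, fderiv_rotField, map_zero, Finset.sum_add_distrib]
  set B : Space →L[ℝ] Space →L[ℝ] ℝ :=
    (fderiv ℝ (fderiv ℝ u) p).bilinearComp (ContinuousLinearMap.inl ℝ Space ℝ)
      (ContinuousLinearMap.inl ℝ Space ℝ) with hB
  have hBa (x y : Space) : fderiv ℝ (fderiv ℝ u) p (x, 0) (y, 0) = B x y := by simp [hB]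
  have h1 := sum_bilin_rot B p.1
  have h2 : ∑ i, fderiv ℝ u p (rot i (rot i p.1), 0) = -2 * fderiv ℝ u p (p.1, 0) := by
    rw [← map_sum]
    have : ∑ i, ((rot i (rot i p.1), 0) : Space × ℝ) = -(2 : ℝ) • (p.1, (0 : ℝ)) := by
      ext k
      · simp only [Prod.fst_sum, sum_rot_rot]; rfl
      · simp [Prod.snd_sum]
    rw [this, map_smul]; rfl
  simp only [radialField, rotField, timeField, hBa, along, h2]
  linarith

/-- The wave operator in characteristic coordinates. -/
theorem charOp_shear (hs : s = 1 ∨ s = -1) (hu : ∀ᶠ y in 𝓝 (shear s p), ContDiffAt ℝ ∞ u y)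
    (hp : p.1 ≠ 0) :
    charOp s (fun y => ‖y.1‖ * u (shear s y)) p = ‖p.1‖ ^ 3 * waveOp3 u (shear s p) := by
  have hu0 : ContDiffAt ℝ ∞ u (shear s p) := hu.self_of_nhds
  have he : ∀ᶠ y in 𝓝 p, y.1 ≠ 0 ∧ ContDiffAt ℝ ∞ u (shear s y) :=
    (continuous_fst.continuousAt.eventually_ne hp).and
      ((contDiffAt_shear hp).continuousAt.eventually hu)
  have eT : dT (fun y => ‖y.1‖ * u (shear s y)) =ᶠ[𝓝 p] fun y => ‖y.1‖ * dT u (shear s y) := by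
    filter_upwards [he] with y hy
    rw [((HasAlong.dT_norm hy.1).mul (dT_shear hy.2 hy.1)).2]; ring
  have eO i : dO i (fun y => ‖y.1‖ * u (shear s y)) =ᶠ[𝓝 p]
      fun y => ‖y.1‖ * dO i u (shear s y) := by
    filter_upwards [he] with y hy
    rw [((HasAlong.dO_norm i hy.1).mul (dO_shear i hy.2 hy.1)).2]; ring
  have eR : dR (fun y => ‖y.1‖ * u (shear s y)) =ᶠ[𝓝 p] fun y => ‖y.1‖ * u (shear s y) +
      ‖y.1‖ * (dR u (shear s y) + s * ‖y.1‖ * dT u (shear s y)) := by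
    filter_upwards [he] with y hy
    rw [((HasAlong.dR_norm hy.1).mul (dR_shear hy.2 hy.1)).2]
  have hRT : dR (dT fun y => ‖y.1‖ * u (shear s y)) p = _ :=
    (((HasAlong.dR_norm hp).mul (dR_shear (contDiffAt_dT hu0) hp)).congr eT).2
  have hOO i : dO i (dO i fun y => ‖y.1‖ * u (shear s y)) p = _ :=
    (((HasAlong.dO_norm i hp).mul (dO_shear i (contDiffAt_dO i hu0) hp)).congr (eO i)).2
  have hRR : dR (dR fun y => ‖y.1‖ * u (shear s y)) p = _ :=
    ((((HasAlong.dR_norm hp).mul (dR_shear hu0 hp)).add ((HasAlong.dR_norm hp).mul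
      ((dR_shear (contDiffAt_dR hu0) hp).add (((HasAlong.const s).mul (.dR_norm hp)).mul
        (dR_shear (contDiffAt_dT hu0) hp))))).congr eR).2
  have hW : ‖p.1‖ ^ 3 * waveOp3 u (shear s p) = ‖p.1‖ * (‖p.1‖ ^ 2 * waveOp3 u (shear s p)) := by
    ring
  have hWp := waveOp3_eq hu0
  simp only [show (shear s p).1 = p.1 from rfl] at hWp
  rw [hW, hWp, charOp, hRT, hRR, eR.eq_of_nhds]
  simp only [hOO, Fin.sum_univ_three, dT_dR hu0]
  rcases hs with rfl | rfl
  · ring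
  · ring

end Coordinates

/-! ### Regularity up to the characteristic boundary -/

section Boundary

/-- The common domain `0 ≤ τ < 2|x|` of the solutions in characteristic coordinates. -/
def dom : Set (Space × ℝ) := {p | 0 ≤ p.2 ∧ p.2 < 2 * ‖p.1‖}

/-- The interior of `dom`. -/
def domInt : Set (Space × ℝ) := {p | 0 < p.2 ∧ p.2 < 2 * ‖p.1‖}

variable {F : Space × ℝ → ℝ} {ξ : Space × ℝ → Space × ℝ} {p : Space × ℝ} {x : Space}

theorem isOpen_domInt : IsOpen domInt :=
  (isOpen_lt continuous_const continuous_snd).inter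
    (isOpen_lt continuous_snd (continuous_const.mul continuous_fst.norm))

theorem domInt_subset_dom : domInt ⊆ dom := fun _ hp => ⟨hp.1.le, hp.2⟩

theorem fst_ne_zero_of_mem_dom (hp : p ∈ dom) : p.1 ≠ 0 := by
  have := hp.1.trans_lt hp.2
  exact norm_pos_iff.1 (by linarith)

theorem mk_zero_mem_dom (hx : x ≠ 0) : (x, (0 : ℝ)) ∈ dom :=
  ⟨le_rfl, by simpa using hx⟩

theorem uniqueDiffOn_dom : UniqueDiffOn ℝ dom := by
  have h1 : UniqueDiffOn ℝ ((univ : Set Space) ×ˢ Ici (0 : ℝ)) :=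
    uniqueDiffOn_univ.prod (uniqueDiffOn_Ici 0)
  have h2 : IsOpen {p : Space × ℝ | p.2 < 2 * ‖p.1‖} :=
    isOpen_lt continuous_snd (continuous_const.mul continuous_fst.norm)
  have h3 : dom = (univ ×ˢ Ici (0 : ℝ)) ∩ {p : Space × ℝ | p.2 < 2 * ‖p.1‖} := by
    ext p
    simp [dom]
  rw [h3]
  exact h1.inter h2

/-- Differentiation along a vector field, up to the boundary of `dom`. -/
noncomputable def alongW (ξ : Space × ℝ → Space × ℝ) (F : Space × ℝ → ℝ) (p : Space × ℝ) : ℝ :=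
  fderivWithin ℝ F dom p (ξ p)

theorem continuousOn_alongW (hξ : Continuous ξ) (hF : ContDiffOn ℝ ∞ F dom) :
    ContinuousOn (alongW ξ F) dom :=
  (hF.continuousOn_fderivWithin uniqueDiffOn_dom (by simp)).clm_apply hξ.continuousOn

theorem contDiffAt_of_mem_domInt (hF : ContDiffOn ℝ ∞ F dom) (hp : p ∈ domInt) :
    ContDiffAt ℝ ∞ F p :=
  hF.contDiffAt (mem_of_superset (isOpen_domInt.mem_nhds hp) domInt_subset_dom)

theorem alongW_eq (hp : p ∈ domInt) : alongW ξ F p = along ξ F p := by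
  rw [alongW, along, fderivWithin_of_mem_nhds
    (mem_of_superset (isOpen_domInt.mem_nhds hp) domInt_subset_dom)]

theorem hasFDerivAt_trace (hF : ContDiffOn ℝ ∞ F dom) (hx : x ≠ 0) :
    HasFDerivAt (fun y => F (y, 0))
      ((fderivWithin ℝ F dom (x, 0)).comp (ContinuousLinearMap.inl ℝ Space ℝ)) x := by
  have h1 : HasFDerivWithinAt F (fderivWithin ℝ F dom (x, 0)) dom (x, 0) :=
    (hF.differentiableOn (by simp) _ (mk_zero_mem_dom hx)).hasFDerivWithinAt
  have h2 : HasFDerivAt (fun y : Space => (y, (0 : ℝ))) (ContinuousLinearMap.inl ℝ Space ℝ) x :=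
    (ContinuousLinearMap.inl ℝ Space ℝ).hasFDerivAt
  have h3 := h1.comp x (h2.hasFDerivWithinAt (s := {y | y ≠ 0})) fun y hy => mk_zero_mem_dom hy
  exact h3.hasFDerivAt (isOpen_ne.mem_nhds hx)

theorem alongW_trace (hF : ContDiffOn ℝ ∞ F dom) (hx : x ≠ 0) (hξ : (ξ (x, 0)).2 = 0) :
    alongW ξ F (x, 0) = fderiv ℝ (fun y => F (y, 0)) x (ξ (x, 0)).1 := by
  rw [(hasFDerivAt_trace hF hx).fderiv, alongW]
  simp only [ContinuousLinearMap.comp_apply, ContinuousLinearMap.inl_apply]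
  congr 1
  exact Prod.ext rfl hξ

/-- Continuity of slice integrals of functions continuous up to `τ = 0`. -/
theorem tendsto_slice_integral {Q : Space × ℝ → ℝ} {A A' : Set Space} {b : ℝ} (hA : IsCompact A)
    (hA' : MeasurableSet A') (hAA' : A' ⊆ A) (hb : 0 < b) (hQ : ContinuousOn Q (A ×ˢ Icc 0 b)) :
    Tendsto (fun δ => ∫ x in A', Q (x, δ)) (𝓝[>] 0) (𝓝 (∫ x in A', Q (x, 0))) := by
  obtain ⟨B, hB⟩ := (hA.prod isCompact_Icc).exists_bound_of_continuousOn hQ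
  have hδ : ∀ᶠ δ : ℝ in 𝓝[>] 0, δ ∈ Icc 0 b := by
    filter_upwards [Ioo_mem_nhdsGT hb] with δ hδ using ⟨hδ.1.le, hδ.2.le⟩
  have hfin : volume A' < ⊤ := (measure_mono hAA').trans_lt hA.measure_lt_top
  apply tendsto_integral_filter_of_dominated_convergence (fun _ => B)
  · filter_upwards [hδ] with δ hδ
    refine ContinuousOn.aestronglyMeasurable ?_ hA'
    exact hQ.comp (by fun_prop) fun x hx => ⟨hAA' hx, hδ⟩
  · filter_upwards [hδ] with δ hδ
    filter_upwards [ae_restrict_mem hA'] with x hx using hB _ ⟨hAA' hx, hδ⟩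
  · exact integrableOn_const hfin.ne
  · filter_upwards [ae_restrict_mem hA'] with x hx
    have h1 := hQ (x, 0) ⟨hAA' hx, le_rfl, hb.le⟩
    refine h1.tendsto.comp (tendsto_nhdsWithin_iff.2 ⟨?_, ?_⟩)
    · exact ((by fun_prop : Continuous fun δ : ℝ => (x, δ)).tendsto 0).mono_left
        nhdsWithin_le_nhds
    · filter_upwards [hδ] with δ hδ using ⟨hAA' hx, hδ⟩

end Boundary

/-! ### Energy estimate in the exterior of the unit ball -/

section Energy

variable {s : ℝ} {F : ℝ → ℝ} {g : Space × ℝ → ℝ} {p : Space × ℝ}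

/-- The cutoff `F(4 - 2 * r - τ)`. -/
noncomputable def coneCutoff (F : ℝ → ℝ) (p : Space × ℝ) : ℝ := F (4 - 2 * ‖p.1‖ - p.2)

/-- Energy density. -/
noncomputable def energyT (F : ℝ → ℝ) (g : Space × ℝ → ℝ) (p : Space × ℝ) : ℝ :=
  ‖p.1‖⁻¹ * (‖p.1‖⁻¹ * (‖p.1‖⁻¹ * (‖p.1‖⁻¹ *
    (1 / 2 * (coneCutoff F p * (dR g p ^ 2 + ∑ i, dO i g p ^ 2))))))

/-- Radial component of the energy current. -/
noncomputable def energyR (s : ℝ) (F : ℝ → ℝ) (g : Space × ℝ → ℝ) (p : Space × ℝ) : ℝ :=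
  ‖p.1‖⁻¹ * (‖p.1‖⁻¹ * (‖p.1‖⁻¹ *
    (coneCutoff F p * (s * dT g p ^ 2 - ‖p.1‖⁻¹ * (dR g p * dT g p)))))

/-- Angular components of the energy current. -/
noncomputable def energyO (F : ℝ → ℝ) (g : Space × ℝ → ℝ) (i : Fin 3) (p : Space × ℝ) : ℝ :=
  ‖p.1‖⁻¹ * (‖p.1‖⁻¹ * (‖p.1‖⁻¹ * (‖p.1‖⁻¹ *
    ((-1) * (coneCutoff F p * (dT g p * dO i g p))))))

theorem offAxis_coneCutoff (hF : ContDiff ℝ ∞ F) : OffAxis (coneCutoff F) :=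
  .comp hF (.sub (.sub (.const _) (.mul (.const _) .norm)) .snd)

theorem HasAlong.dR_coneCutoff (hF : ContDiff ℝ ∞ F) (hp : p.1 ≠ 0) :
    HasAlong radialField (coneCutoff F) p (deriv F (4 - 2 * ‖p.1‖ - p.2) * (-(2 * ‖p.1‖))) :=
  HasAlong.eq (.comp (hF.differentiable (by simp) _).hasDerivAt
    (.sub (.sub (.const _) (.mul (.const _) (.dR_norm hp))) .dR_snd)) (by ring)

theorem HasAlong.dT_coneCutoff (hF : ContDiff ℝ ∞ F) (hp : p.1 ≠ 0) :
    HasAlong timeField (coneCutoff F) p (-deriv F (4 - 2 * ‖p.1‖ - p.2)) :=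
  HasAlong.eq (.comp (hF.differentiable (by simp) _).hasDerivAt
    (.sub (.sub (.const _) (.mul (.const _) (.dT_norm hp))) .dT_snd)) (by ring)

theorem HasAlong.dO_coneCutoff (i : Fin 3) (hF : ContDiff ℝ ∞ F) (hp : p.1 ≠ 0) :
    HasAlong (rotField i) (coneCutoff F) p 0 :=
  HasAlong.eq (.comp (hF.differentiable (by simp) _).hasDerivAt
    (.sub (.sub (.const _) (.mul (.const _) (.dO_norm i hp))) (.dO_snd i))) (by ring)

set_option maxHeartbeats 1600000 in
theorem energy_identity (hF : ContDiff ℝ ∞ F) (hg : ContDiffAt ℝ ∞ g p) (hp : p.1 ≠ 0) :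
    dR (energyR s F g) p + 3 * energyR s F g p + dT (energyT F g) p +
      ∑ i, dO i (energyO F g i) p =
    (‖p.1‖ ^ 2)⁻¹ * (coneCutoff F p * charOp s g p * dT g p / ‖p.1‖ ^ 2 -
      deriv F (4 - 2 * ‖p.1‖ - p.2) * (1 / 2 * (dR g p / ‖p.1‖) ^ 2 +
        1 / 2 * (∑ i, dO i g p ^ 2) / ‖p.1‖ ^ 2 + 2 * s * dT g p ^ 2 -
          2 * (dR g p / ‖p.1‖) * dT g p)) := by
  have hr : ‖p.1‖ ≠ 0 := norm_ne_zero_iff.2 hp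
  have aT {ξ} : HasAlong ξ (dT g) p (along ξ (dT g) p) := .of_contDiffAt (contDiffAt_dT hg)
  have aR {ξ} : HasAlong ξ (dR g) p (along ξ (dR g) p) := .of_contDiffAt (contDiffAt_dR hg)
  have aO {ξ} (i : Fin 3) : HasAlong ξ (dO i g) p (along ξ (dO i g) p) :=
    .of_contDiffAt (contDiffAt_dO i hg)
  apply divergence_eq (HR := energyR s F g) (HT := energyT F g) (HO := energyO F g)
  case hR =>
    unfold energyR
    repeat' first
      | exact aT | exact aR | exact aO _ | exact .const _ | exact .dR_coneCutoff hF hp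
      | exact .dR_inv_norm hp
      | apply HasAlong.sub | apply HasAlong.add | apply HasAlong.pow_two | apply HasAlong.mul
  case hT =>
    unfold energyT
    repeat' first
      | exact aT | exact aR | exact aO _ | exact .const _ | exact .dT_coneCutoff hF hp
      | exact .dT_inv_norm hp
      | apply HasAlong.sub | apply HasAlong.add | apply HasAlong.pow_two | apply HasAlong.mul
  case hO =>
    intro i
    unfold energyO
    repeat' first
      | exact aT | exact aR | exact aO _ | exact .const _ | exact .dO_coneCutoff i hF hp
      | exact .dO_inv_norm i hp
      | apply HasAlong.sub | apply HasAlong.add | apply HasAlong.pow_two | apply HasAlong.mul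
  case hv =>
    unfold energyR charOp
    simp only [Fin.sum_univ_three, Fin.isValue, Fin.zero_eta, Fin.mk_one, Fin.reduceFinMk,
      dT_dR hg, dT_dO _ hg]
    generalize dR (dR g) p = wRR, dR (dT g) p = wRT, dT (dT g) p = wTT,
      dO 0 (dT g) p = w0T, dO 1 (dT g) p = w1T, dO 2 (dT g) p = w2T,
      dO 0 (dO 0 g) p = w00, dO 1 (dO 1 g) p = w11, dO 2 (dO 2 g) p = w22,
      dR g p = wR, dT g p = wT, dO 0 g p = w0, dO 1 g p = w1, dO 2 g p = w2,
      deriv F (4 - 2 * ‖p.1‖ - p.2) = F', coneCutoff F p = ζ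
    generalize ‖p.1‖ = r at *
    field_simp
    ring

theorem testFun_energyT (hF : ContDiff ℝ ∞ F) (hg : TestFun g) : TestFun (energyT F g) :=
  .weight .inv_norm (.weight .inv_norm (.weight .inv_norm (.weight .inv_norm (.weight (.const _)
    (.weight (offAxis_coneCutoff hF) (.add hg.dR.sq (.sum _ fun i => (hg.dO i).sq)))))))

theorem testFun_energyO (hF : ContDiff ℝ ∞ F) (hg : TestFun g) (i : Fin 3) :
    TestFun (energyO F g i) :=
  .weight .inv_norm (.weight .inv_norm (.weight .inv_norm (.weight .inv_norm (.weight (.const _)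
    (.weight (offAxis_coneCutoff hF) (.mul hg.dT (hg.dO i)))))))

theorem testFun_energyR (hF : ContDiff ℝ ∞ F) (hg : TestFun g) : TestFun (energyR s F g) := by
  refine hg.of_vanish ?_ fun p hp => by simp [energyR, along_eq_zero hp]
  exact .mul .inv_norm (.mul .inv_norm (.mul .inv_norm (.mul (offAxis_coneCutoff hF)
    (.sub (.mul (.const _) (.pow hg.dT.smooth _))
      (.mul .inv_norm (.mul hg.dR.smooth hg.dT.smooth))))))

/-- Monotonicity of the exterior energy. -/
theorem energy_le {a b : ℝ} (hF : ContDiff ℝ ∞ F) (hF' : ∀ y, 0 ≤ deriv F y)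
    (hs : s = 1 ∨ ∀ y, deriv F y = 0) (hg : TestFun g) (hab : a ≤ b)
    (hchar : ∀ p ∈ ext 1 ×ˢ Ioc a b, coneCutoff F p * charOp s g p = 0)
    (hlat : ∀ p : Space × ℝ, ‖p.1‖ = 1 → p.2 ∈ Ioc a b → dT g p = 0) :
    ∫ x in ext 1, energyT F g (x, b) ≤ ∫ x in ext 1, energyT F g (x, a) := by
  have h1 := integral_divergence (testFun_energyR (s := s) hF hg) (testFun_energyT hF hg)
    (testFun_energyO hF hg) one_pos hab fun p hp hp2 => by simp [energyR, hlat p hp hp2]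
  have h2 : ∫ p in ext 1 ×ˢ Ioc a b, (dR (energyR s F g) p + 3 * energyR s F g p +
      dT (energyT F g) p + ∑ i, dO i (energyO F g i) p) ≤ 0 := by
    refine setIntegral_nonpos ((measurableSet_ext 1).prod measurableSet_Ioc) fun p hp => ?_
    have hp0 : p.1 ≠ 0 := norm_pos_iff.1 (one_pos.trans hp.1)
    rw [energy_identity hF (hg.smooth p hp0) hp0, hchar p hp]
    refine mul_nonpos_of_nonneg_of_nonpos (by positivity) ?_
    rw [zero_mul, zero_div, zero_sub, neg_nonpos]
    rcases hs with rfl | hs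
    · have : 0 ≤ ∑ i, dO i g p ^ 2 := Finset.sum_nonneg fun i _ => sq_nonneg _
      have h3 : 0 ≤ 1 / 2 * (∑ i, dO i g p ^ 2) / ‖p.1‖ ^ 2 := by positivity
      refine mul_nonneg (hF' _) ?_
      nlinarith [sq_nonneg (dR g p / ‖p.1‖ - 2 * dT g p)]
    · simp [hs]
  linarith

end Energy

/-! ### Uniqueness in the exterior of the unit ball -/

section Exterior

variable {s : ℝ} {F : ℝ → ℝ} {f g : Space × ℝ → ℝ} {p : Space × ℝ}

/-- The energy density, up to the boundary of `dom`. -/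
noncomputable def energyW (F : ℝ → ℝ) (g : Space × ℝ → ℝ) (p : Space × ℝ) : ℝ :=
  ‖p.1‖⁻¹ * (‖p.1‖⁻¹ * (‖p.1‖⁻¹ * (‖p.1‖⁻¹ * (1 / 2 * (coneCutoff F p *
    (alongW radialField g p ^ 2 + ∑ i, alongW (rotField i) g p ^ 2))))))

theorem energyT_congr (h : g =ᶠ[𝓝 p] f) : energyT F g p = energyT F f p := by
  simp only [energyT, (along_congr h).eq_of_nhds]

theorem energyW_eq (hp : p ∈ domInt) : energyW F f p = energyT F f p := by
  simp only [energyW, energyT, alongW_eq hp]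

theorem continuousOn_energyW (hF : ContDiff ℝ ∞ F) (hf : ContDiffOn ℝ ∞ f dom) :
    ContinuousOn (energyW F f) dom := by
  have hn : ContinuousOn (fun p : Space × ℝ => ‖p.1‖⁻¹) dom :=
    continuous_fst.norm.continuousOn.inv₀ fun p hp => norm_ne_zero_iff.2 (fst_ne_zero_of_mem_dom hp)
  have hc : ContinuousOn (coneCutoff F) dom := by
    have := hF.continuous
    unfold coneCutoff
    fun_prop
  have hR := continuousOn_alongW contDiff_radialField.continuous hf
  have hO i := continuousOn_alongW (contDiff_rotField i).continuous hf
  exact hn.mul (hn.mul (hn.mul (hn.mul (continuousOn_const.mul (hc.mul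
    ((hR.pow 2).add (continuousOn_finsetSum _ fun i _ => (hO i).pow 2)))))))

theorem energyW_nonneg (hF : ∀ y, 0 ≤ F y) : 0 ≤ energyW F f p := by
  have : 0 ≤ coneCutoff F p := hF _
  unfold energyW
  positivity

/-- The shell `1 < |x| ≤ 3`. -/
def shell : Set Space := {x | 1 < ‖x‖ ∧ ‖x‖ ≤ 3}

theorem measurableSet_shell : MeasurableSet shell :=
  (measurableSet_lt measurable_const measurable_norm).inter
    (measurableSet_le measurable_norm measurable_const)

theorem energyW_le {a b : ℝ} (hF : ContDiff ℝ ∞ F) (hF' : ∀ y, 0 ≤ deriv F y)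
    (hs : s = 1 ∨ ∀ y, deriv F y = 0) (hf : ContDiffOn ℝ ∞ f dom)
    (hpde : ∀ p ∈ domInt, 1 < ‖p.1‖ → charOp s f p = 0)
    (h1 : ∀ x τ, ‖x‖ = 1 → 0 ≤ τ → τ < 2 → f (x, τ) = 0)
    (hfar : (∀ p : Space × ℝ, 3 < ‖p.1‖ → 0 < p.2 → p.2 < 2 → coneCutoff F p = 0) ∨
      ∀ p : Space × ℝ, 3 < ‖p.1‖ → 0 < p.2 → p.2 < 2 → f p = 0)
    (ha : 0 < a) (hab : a ≤ b) (hb : b < 2) :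
    ∫ x in shell, energyW F f (x, b) ≤ ∫ x in shell, energyW F f (x, a) := by
  set C : Set (Space × ℝ) := (Metric.closedBall 0 3 ∩ {x | 1 ≤ ‖x‖}) ×ˢ Icc a b with hC
  have hCc : IsCompact C := ((isCompact_closedBall 0 3).inter_right
    (isClosed_le continuous_const continuous_norm)).prod isCompact_Icc
  have hmem {p : Space × ℝ} (h1 : 1 ≤ ‖p.1‖) (h3 : ‖p.1‖ ≤ 3) (h2 : p.2 ∈ Icc a b) : p ∈ C :=
    ⟨⟨by simpa using h3, h1⟩, h2⟩
  have hdom {p : Space × ℝ} (h1 : 1 ≤ ‖p.1‖) (h2 : p.2 ∈ Icc a b) : p ∈ domInt :=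
    ⟨ha.trans_le h2.1, by linarith [h2.2]⟩
  obtain ⟨g, hg, hgC, hg0⟩ := exists_localization isOpen_domInt hCc
    (fun p hp => hdom hp.1.2 hp.2) (hf.mono domInt_subset_dom)
  have hfar' {p : Space × ℝ} (hp3 : 3 < ‖p.1‖) (hp : p.2 ∈ Icc a b) :
      coneCutoff F p = 0 ∨ g =ᶠ[𝓝 p] 0 := by
    have hp0 : 0 < p.2 := ha.trans_le hp.1
    have hp2 : p.2 < 2 := hp.2.trans_lt hb
    refine hfar.imp (fun h => h p hp3 hp0 hp2) fun h => ?_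
    filter_upwards [continuous_fst.norm.continuousAt.eventually_const_lt hp3,
      continuous_snd.continuousAt.eventually_const_lt hp0,
      continuous_snd.continuousAt.eventually_lt_const hp2] with y hy3 hy0 hy2
    exact hg0 y (Or.inr (h y hy3 hy0 hy2))
  have hslice {τ : ℝ} (hτ : τ ∈ Icc a b) :
      ∫ x in ext 1, energyT F g (x, τ) = ∫ x in shell, energyW F f (x, τ) := by
    rw [setIntegral_eq_of_subset_of_forall_sdiff_eq_zero (s := shell) (measurableSet_ext 1)
      (show shell ⊆ ext 1 from fun x hx => hx.1)]
    · refine setIntegral_congr_fun measurableSet_shell fun x hx => ?_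
      rw [energyT_congr (hgC (x, τ) (hmem (p := (x, τ)) hx.1.le hx.2 hτ)),
        energyW_eq (hdom (p := (x, τ)) hx.1.le hτ)]
    · rintro x ⟨hx1, hx3⟩
      have hx3 : 3 < ‖x‖ := by
        by_contra hcon
        exact hx3 ⟨hx1, not_lt.1 hcon⟩
      rcases hfar' (p := (x, τ)) hx3 hτ with h | h
      · simp [energyT, h]
      · simp [energyT, along_eq_zero h]
  rw [← hslice ⟨hab, le_rfl⟩, ← hslice ⟨le_rfl, hab⟩]
  refine energy_le hF hF' hs hg hab (fun p hp => ?_) fun p hp1 hp => ?_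
  · have hp2 : p.2 ∈ Icc a b := Ioc_subset_Icc_self hp.2
    have hp1 : 1 < ‖p.1‖ := hp.1
    rcases le_or_gt ‖p.1‖ 3 with h3 | h3
    · rw [charOp_congr (hgC p (hmem hp1.le h3 hp2)), hpde p (hdom hp1.le hp2) hp1, mul_zero]
    · rcases hfar' h3 hp2 with h | h
      · rw [h, zero_mul]
      · rw [charOp_eq_zero h, mul_zero]
  · have hp2 : p.2 ∈ Icc a b := Ioc_subset_Icc_self hp
    have hpd := hdom hp1.ge hp2
    rw [(along_congr (hgC p (hmem hp1.ge (by linarith) hp2))).eq_of_nhds]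
    have hd : HasFDerivAt f (fderiv ℝ f p) (p.1, p.2) :=
      ((contDiffAt_of_mem_domInt hf hpd).differentiableAt (by simp)).hasFDerivAt
    have hl : HasDerivAt (fun τ : ℝ => (p.1, τ)) ((0 : Space), (1 : ℝ)) p.2 :=
      (hasDerivAt_const p.2 p.1).prodMk (hasDerivAt_id p.2)
    have h3 := hd.comp_hasDerivAt p.2 hl
    have h4 : (f ∘ fun τ : ℝ => (p.1, τ)) =ᶠ[𝓝 p.2] fun _ => 0 := by
      filter_upwards [Ioo_mem_nhds (show (0 : ℝ) < p.2 from hpd.1)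
        (show p.2 < 2 by linarith [hp2.2])] with τ hτ
      exact h1 p.1 τ hp1 hτ.1.le hτ.2
    exact h3.unique ((hasDerivAt_const p.2 (0 : ℝ)).congr_of_eventuallyEq h4)

theorem dR_eq_zero_exterior {b : ℝ} (hF : ContDiff ℝ ∞ F) (hF0 : ∀ y, 0 ≤ F y)
    (hF' : ∀ y, 0 ≤ deriv F y)
    (hs : s = 1 ∨ ∀ y, deriv F y = 0) (hf : ContDiffOn ℝ ∞ f dom)
    (hpde : ∀ p ∈ domInt, 1 < ‖p.1‖ → charOp s f p = 0)
    (h0 : ∀ x, 1 ≤ ‖x‖ → f (x, 0) = 0)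
    (h1 : ∀ x τ, ‖x‖ = 1 → 0 ≤ τ → τ < 2 → f (x, τ) = 0)
    (hfar : (∀ p : Space × ℝ, 3 < ‖p.1‖ → 0 < p.2 → p.2 < 2 → coneCutoff F p = 0) ∨
      ∀ p : Space × ℝ, 3 < ‖p.1‖ → 0 < p.2 → p.2 < 2 → f p = 0)
    (hb0 : 0 < b) (hb : b < 2) {x : Space} (hx1 : 1 < ‖x‖) (hx3 : ‖x‖ < 3)
    (hx : 0 < coneCutoff F (x, b)) : dR f (x, b) = 0 := by
  have hsub : (Metric.closedBall (0 : Space) 3 ∩ {x | 1 ≤ ‖x‖}) ×ˢ Icc 0 b ⊆ dom := by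
    rintro p ⟨⟨-, hp⟩, hp2⟩
    have hp : 1 ≤ ‖p.1‖ := hp
    exact ⟨hp2.1, by linarith [hp2.2]⟩
  have hcont := continuousOn_energyW hF hf
  have hsh : shell ⊆ Metric.closedBall (0 : Space) 3 ∩ {x | 1 ≤ ‖x‖} := fun x hx =>
    ⟨by simpa using hx.2, hx.1.le⟩
  have hcomp : IsCompact (Metric.closedBall (0 : Space) 3 ∩ {x | 1 ≤ ‖x‖}) :=
    (isCompact_closedBall 0 3).inter_right (isClosed_le continuous_const continuous_norm)
  have hlim := tendsto_slice_integral hcomp measurableSet_shell hsh hb0 (hcont.mono hsub)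
  have hzero : ∫ x in shell, energyW F f (x, 0) = 0 := by
    rw [setIntegral_congr_fun (g := fun _ => (0 : ℝ)) measurableSet_shell, integral_zero]
    intro y hy
    have hy0 : y ≠ 0 := norm_pos_iff.1 (one_pos.trans hy.1)
    have hd : fderiv ℝ (fun z => f (z, 0)) y = 0 := by
      have : (fun z => f (z, 0)) =ᶠ[𝓝 y] fun _ => 0 := by
        filter_upwards [continuous_norm.continuousAt.eventually_const_lt hy.1] with z hz
          using h0 z hz.le
      rw [this.fderiv_eq]
      simp
    simp only [energyW]
    rw [alongW_trace hf hy0 rfl]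
    simp only [alongW_trace (ξ := rotField _) hf hy0 rfl, hd]
    simp
  have hle : ∫ x in shell, energyW F f (x, b) ≤ 0 := by
    rw [← hzero]
    refine ge_of_tendsto hlim ?_
    filter_upwards [Ioo_mem_nhdsGT hb0] with a ha
    exact energyW_le hF hF' hs hf hpde h1 hfar ha.1 ha.2.le hb
  have hcb : ContinuousOn (fun x => energyW F f (x, b))
      (Metric.closedBall (0 : Space) 3 ∩ {x | 1 ≤ ‖x‖}) :=
    (hcont.mono hsub).comp (by fun_prop) fun x hx => ⟨hx, hb0.le, le_rfl⟩
  have hint : IntegrableOn (fun x => energyW F f (x, b)) shell :=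
    (hcb.integrableOn_compact hcomp).mono_set hsh
  have hnn : 0 ≤ᵐ[volume.restrict shell] fun x => energyW F f (x, b) :=
    Eventually.of_forall fun x => energyW_nonneg hF0
  have hae := (setIntegral_eq_zero_iff_of_nonneg_ae hnn hint).1
    (le_antisymm hle (integral_nonneg_of_ae hnn))
  set U : Set Space := {x | 1 < ‖x‖ ∧ ‖x‖ < 3}
  have hU : IsOpen U := (isOpen_lt continuous_const continuous_norm).inter
    (isOpen_lt continuous_norm continuous_const)
  have hUs : U ⊆ shell := fun x hx => ⟨hx.1, hx.2.le⟩
  have heq := Measure.eqOn_open_of_ae_eq (ae_restrict_of_ae_restrict_of_subset hUs hae) hU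
    (hcb.mono (hUs.trans hsh)) continuousOn_const
  have hx0 : energyW F f (x, b) = 0 := heq ⟨hx1, hx3⟩
  rw [energyW_eq ⟨hb0, by simpa using by linarith⟩] at hx0
  have hr : 0 < ‖x‖ := one_pos.trans hx1
  have hO : 0 ≤ ∑ i, dO i f (x, b) ^ 2 := Finset.sum_nonneg fun i _ => sq_nonneg _
  simp only [energyT, mul_eq_zero, inv_eq_zero, hr.ne', hx.ne', false_or] at hx0
  norm_num at hx0
  have : dR f (x, b) ^ 2 = 0 := by nlinarith [sq_nonneg (dR f (x, b))]
  exact pow_eq_zero_iff (by norm_num) |>.1 this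

/-- Vanishing in the exterior of the unit ball, for data vanishing on the unit sphere and on the
characteristic boundary. -/
theorem exterior_vanish (hs : s = 1 ∨ s = -1) (hf : ContDiffOn ℝ ∞ f dom)
    (hpde : ∀ p ∈ domInt, 1 < ‖p.1‖ → charOp s f p = 0)
    (h0 : ∀ x, 1 ≤ ‖x‖ → f (x, 0) = 0)
    (h1 : ∀ x τ, ‖x‖ = 1 → 0 ≤ τ → τ < 2 → f (x, τ) = 0)
    (hic : s = -1 → ∀ p ∈ domInt, p.2 < ‖p.1‖ - 1 → f p = 0)
    (hp1 : 1 ≤ ‖p.1‖) (hp0 : 0 < p.2) (hp2 : p.2 < 4 - 2 * ‖p.1‖) : f p = 0 := by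
  have hR : ∀ x : Space, 1 < ‖x‖ → p.2 < 4 - 2 * ‖x‖ → dR f (x, p.2) = 0 := by
    intro x hx1 hx
    rcases hs with rfl | rfl
    · refine dR_eq_zero_exterior (F := Real.smoothTransition) Real.smoothTransition.contDiff
        Real.smoothTransition.nonneg (fun y => ?_) (Or.inl rfl) hf hpde h0 h1
        (Or.inl fun p hp _ _ => Real.smoothTransition.zero_of_nonpos (by linarith)) hp0
        (by linarith) hx1 (by linarith) (Real.smoothTransition.pos_of_pos (by
          change 0 < 4 - 2 * ‖x‖ - p.2
          linarith))
      exact Real.smoothTransition.monotone.deriv_nonneg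
    · refine dR_eq_zero_exterior (F := fun _ => 1) contDiff_const (fun _ => zero_le_one)
        (fun y => by simp) (Or.inr fun y => by simp) hf hpde h0 h1
        (Or.inr fun p hp hp0 hp2 => hic rfl p ⟨hp0, by linarith⟩ (by linarith)) hp0
        (by linarith) hx1 (by linarith) ?_
      exact one_pos
  rcases hp1.eq_or_lt with hp1 | hp1
  · exact h1 p.1 p.2 hp1.symm hp0.le (by linarith)
  have hr : 0 < ‖p.1‖ := one_pos.trans hp1
  have hinv : ‖p.1‖⁻¹ < 1 := inv_lt_one_of_one_lt₀ hp1
  have hmem {c : ℝ} (hc : c ∈ Icc ‖p.1‖⁻¹ 1) : (c • p.1, p.2) ∈ domInt ∧ 1 ≤ ‖c • p.1‖ ∧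
      ‖c • p.1‖ ≤ ‖p.1‖ := by
    have hc0 : 0 < c := (inv_pos.2 hr).trans_le hc.1
    have h2 : ‖c • p.1‖ = c * ‖p.1‖ := by rw [norm_smul, Real.norm_of_nonneg hc0.le]
    have h3 : 1 ≤ c * ‖p.1‖ := by
      have := mul_le_mul_of_nonneg_right hc.1 hr.le
      rwa [inv_mul_cancel₀ hr.ne'] at this
    have h4 : c * ‖p.1‖ ≤ ‖p.1‖ := by nlinarith [hc.2]
    refine ⟨⟨hp0, ?_⟩, h2 ▸ h3, h2 ▸ h4⟩
    simp only [h2]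
    linarith
  have hder (c : ℝ) (hc : c ∈ Icc ‖p.1‖⁻¹ 1) :
      HasDerivAt (fun c : ℝ => f (c • p.1, p.2)) (fderiv ℝ f (c • p.1, p.2) (p.1, 0)) c := by
    have hd : HasFDerivAt f _ (c • p.1, p.2) :=
      ((contDiffAt_of_mem_domInt hf (hmem hc).1).differentiableAt (by simp)).hasFDerivAt
    have hl : HasDerivAt (fun c : ℝ => (c • p.1, p.2)) (p.1, (0 : ℝ)) c := by
      simpa using ((hasDerivAt_id c).smul_const p.1).prodMk (hasDerivAt_const c p.2)
    exact hd.comp_hasDerivAt c hl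
  obtain ⟨c, hc, hcs⟩ := exists_hasDerivAt_eq_slope (fun c : ℝ => f (c • p.1, p.2)) _ hinv
    (fun c hc => (hder c hc).continuousAt.continuousWithinAt)
    fun c hc => hder c (Ioo_subset_Icc_self hc)
  have hc0 : 0 < c := (inv_pos.2 hr).trans hc.1
  have hcn : 1 < ‖c • p.1‖ := by
    rw [norm_smul, Real.norm_of_nonneg hc0.le]
    have := mul_lt_mul_of_pos_right hc.1 hr
    rwa [inv_mul_cancel₀ hr.ne'] at this
  have hz := hR (c • p.1) hcn (by linarith [(hmem (Ioo_subset_Icc_self hc)).2.2])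
  have hz' : fderiv ℝ f (c • p.1, p.2) (p.1, 0) = 0 := by
    have h5 : radialField (c • p.1, p.2) = c • (p.1, (0 : ℝ)) := by simp [radialField]
    rw [along, h5, map_smul, smul_eq_mul] at hz
    exact (mul_eq_zero.1 hz).resolve_left hc0.ne'
  rw [hz', eq_comm, div_eq_zero_iff] at hcs
  have hend : f (‖p.1‖⁻¹ • p.1, p.2) = 0 := by
    refine h1 _ _ ?_ hp0.le (by linarith)
    rw [norm_smul, norm_inv, norm_norm, inv_mul_cancel₀ hr.ne']
  rcases hcs with h | h
  · simpa [hend] using h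
  · linarith

end Exterior

/-! ### The Carleman estimate up to the characteristic boundary -/

section Flux

variable {s σ κ ε : ℝ} {f w F : Space × ℝ → ℝ} {p : Space × ℝ}

/-- The temporal component of the multiplier current, up to the boundary of `dom`. -/
noncomputable def currentTW (s σ κ : ℝ) (w : Space × ℝ → ℝ) (p : Space × ℝ) : ℝ :=
  ‖p.1‖⁻¹ * (‖p.1‖⁻¹ * (‖p.1‖⁻¹ * (((κ - 2 * p.2) * ‖p.1‖⁻¹ - 4 * s) * alongW radialField w p ^ 2 +
    4 * s * ∑ i, alongW (rotField i) w p ^ 2))) +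
  (64 * σ ^ 2 * (κ - 2 * p.2 - 4 * s * ‖p.1‖) + 32 * σ * s * ‖p.1‖⁻¹) * w p ^ 2

theorem currentTW_eq (hp : p ∈ domInt) : currentTW s σ κ w p = currentT s σ κ w p := by
  simp only [currentTW, currentT, alongW_eq hp]

theorem currentT_congr (h : w =ᶠ[𝓝 p] f) : currentT s σ κ w p = currentT s σ κ f p := by
  simp only [currentT, (along_congr h).eq_of_nhds, h.eq_of_nhds]

theorem continuousOn_inv_norm_dom : ContinuousOn (fun p : Space × ℝ => ‖p.1‖⁻¹) dom :=
  continuous_fst.norm.continuousOn.inv₀ fun _ hp => norm_ne_zero_iff.2 (fst_ne_zero_of_mem_dom hp)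

theorem continuousOn_currentTW (hw : ContDiffOn ℝ ∞ w dom) :
    ContinuousOn (currentTW s σ κ w) dom := by
  have hn := continuousOn_inv_norm_dom
  have hR := continuousOn_alongW contDiff_radialField.continuous hw
  have hO i := continuousOn_alongW (contDiff_rotField i).continuous hw
  have h0 := hw.continuousOn
  unfold currentTW
  fun_prop

theorem OffAxis.contDiffOn_dom {k : Space × ℝ → ℝ} (hk : OffAxis k) : ContDiffOn ℝ ∞ k dom :=
  fun p hp => (hk p (fst_ne_zero_of_mem_dom hp)).contDiffWithinAt

/-- The annulus `ε/2 ≤ |x| ≤ 1`. -/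
def annulus (ε : ℝ) : Set Space := {x | ε / 2 ≤ ‖x‖ ∧ ‖x‖ ≤ 1}

theorem isCompact_annulus : IsCompact (annulus ε) := by
  have : annulus ε = Metric.closedBall 0 1 ∩ {x | ε / 2 ≤ ‖x‖} := by
    ext x
    simp [annulus, and_comm]
  rw [this]
  exact (isCompact_closedBall 0 1).inter_right (isClosed_le continuous_const continuous_norm)

/-- The part of the domain on which the estimate is applied. -/
def core (ε : ℝ) : Set (Space × ℝ) :=
  {p | ‖p.1‖ ≤ 1 ∧ 0 ≤ p.2 ∧ ε ^ 2 ≤ 4 * ‖p.1‖ ^ 2 - p.2 ^ 2}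

theorem core_subset_dom (hε : 0 < ε) : core ε ⊆ dom := fun p hp =>
  ⟨hp.2.1, by
    have h := hp.2.2
    have : 0 < ε ^ 2 := by positivity
    exact lt_of_pow_lt_pow_left₀ 2 (by positivity) (by nlinarith)⟩

theorem core_annulus (hp : p ∈ core ε) : p.1 ∈ annulus ε := by
  refine ⟨?_, hp.1⟩
  have := hp.2.2
  exact le_of_sq_le_sq (by nlinarith [sq_nonneg p.2]) (norm_nonneg _)

theorem core_snd_lt (hε : 0 < ε) (hp : p ∈ core ε) : p.2 < 2 := by
  have h1 := (core_subset_dom hε hp).2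
  have h2 := hp.1
  linarith

theorem core_gap (hε : 0 < ε) (hp : p ∈ core ε) : ε ^ 2 / 4 ≤ 2 * ‖p.1‖ - p.2 := by
  have h1 := (core_subset_dom hε hp).2
  have h2 := hp.1
  have h3 := hp.2.2
  have h4 := hp.2.1
  nlinarith

theorem isClosed_core : IsClosed (core ε) :=
  (isClosed_le continuous_fst.norm continuous_const).inter
    ((isClosed_le continuous_const continuous_snd).inter
      (isClosed_le continuous_const (by fun_prop : Continuous fun p : Space × ℝ =>
        4 * ‖p.1‖ ^ 2 - p.2 ^ 2)))

theorem isCompact_core (hε : 0 < ε) : IsCompact (core ε) :=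
  (isCompact_annulus.prod (isCompact_Icc (a := (0 : ℝ)) (b := 2))).of_isClosed_subset isClosed_core
    fun _ hp => ⟨core_annulus hp, hp.2.1, (core_snd_lt hε hp).le⟩

theorem flux_slice_le {M δ : ℝ} {N : Space × ℝ → ℝ} (hs : s = 1 ∨ s = -1) (hσ : 0 < σ)
    (hκ : κ ≤ ε) (hκ0 : 0 ≤ κ) (hε : 0 < ε) (hε1 : ε ≤ 1) (hF : ContDiffOn ℝ ∞ F dom)
    (hF0 : ∀ p : Space × ℝ, 4 * ‖p.1‖ ^ 2 - p.2 ^ 2 ≤ ε ^ 2 → F p = 0)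
    (hF1 : ∀ p ∈ domInt, 1 < ‖p.1‖ → p.2 < 4 - 2 * ‖p.1‖ → F p = 0)
    (hM : 0 ≤ M) (hN0 : ∀ p, 0 ≤ N p)
    (hop : ∀ p ∈ core ε, 0 < p.2 → |charOp s F p| ≤ ‖p.1‖ ^ 2 * (M * |F p| + N p))
    (hN : ∀ p : Space × ℝ, p.1 ∉ annulus ε → N p = 0)
    (hNi : IntegrableOn (fun p => (‖p.1‖ ^ 2)⁻¹ * (weight σ κ p ^ 2 * N p ^ 2))
      (annulus ε ×ˢ Ioc δ 3))
    (h3 : M ^ 2 / (4 * σ) ≤ 8 * σ ^ 2 * (ε ^ 2 / 2) ^ 2 - 32 * σ) (hδ : 0 < δ) (hδε : δ < ε) :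
    ∫ x in annulus ε, currentTW s σ κ (fun y => weight σ κ y * F y) (x, δ) ≤
      1 / (4 * σ) * ∫ p in annulus ε ×ˢ Ioc δ 3,
        (‖p.1‖ ^ 2)⁻¹ * (weight σ κ p ^ 2 * N p ^ 2) := by
  set W : Set (Space × ℝ) := domInt ∩ {p | p.2 < 4 - 2 * ‖p.1‖} with hW
  have hWo : IsOpen W := isOpen_domInt.inter (isOpen_lt (by fun_prop) (by fun_prop))
  set K : Set (Space × ℝ) := core ε ∩ {p | δ ≤ p.2} with hK
  have hKc : IsCompact K := (isCompact_core hε).inter_right (isClosed_le (by fun_prop) (by fun_prop))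
  have hKI : K ⊆ domInt := fun p hp => ⟨hδ.trans_le hp.2, (core_subset_dom hε hp.1).2⟩
  have hKW : K ⊆ W := fun p hp => ⟨hKI hp, by
    have h1 := (hKI hp).2
    have h2 := hp.1.1
    change p.2 < 4 - 2 * ‖p.1‖
    linarith⟩
  obtain ⟨g, hg, hgK, hg0⟩ := exists_localization hWo hKc hKW
    (hF.mono fun p hp => domInt_subset_dom hp.1)
  have hout {p : Space × ℝ} (hp : 1 < ‖p.1‖) : g =ᶠ[𝓝 p] 0 := by
    filter_upwards [continuous_fst.norm.continuousAt.eventually_const_lt hp] with y hy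
    by_cases hyW : y ∈ W
    · exact hg0 y (Or.inr (hF1 y hyW.1 hy hyW.2))
    · exact hg0 y (Or.inl hyW)
  have hlow {p : Space × ℝ} (hp : 4 * ‖p.1‖ ^ 2 - p.2 ^ 2 < ε ^ 2) : F =ᶠ[𝓝 p] 0 := by
    filter_upwards [(by fun_prop : Continuous fun p : Space × ℝ =>
      4 * ‖p.1‖ ^ 2 - p.2 ^ 2).continuousAt.eventually_lt_const hp] with y hy
    exact hF0 y hy.le
  have hlow' {p : Space × ℝ} (hp : 4 * ‖p.1‖ ^ 2 - p.2 ^ 2 < ε ^ 2) : g =ᶠ[𝓝 p] 0 := by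
    filter_upwards [hlow hp] with y hy using hg0 y (Or.inr hy)
  have hcase {p : Space × ℝ} (hp : δ ≤ p.2) : g =ᶠ[𝓝 p] 0 ∨ p ∈ K := by
    rcases lt_or_ge 1 ‖p.1‖ with h | h
    · exact .inl (hout h)
    rcases lt_or_ge (4 * ‖p.1‖ ^ 2 - p.2 ^ 2) (ε ^ 2) with h' | h'
    · exact .inl (hlow' h')
    · exact .inr ⟨⟨h, hδ.le.trans hp, h'⟩, hp⟩
  have hann : annulus ε ⊆ ext (ε / 4) := fun x hx => by
    have := hx.1
    change ε / 4 < ‖x‖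
    linarith
  have hmeas : MeasurableSet (annulus ε) := isCompact_annulus.isClosed.measurableSet
  have hinteg : IntegrableOn (fun p => (‖p.1‖ ^ 2)⁻¹ * (weight σ κ p ^ 2 * N p ^ 2))
      (ext (ε / 4) ×ˢ Ioc δ 3) := by
    refine hNi.of_forall_sdiff_eq_zero ((measurableSet_ext _).prod measurableSet_Ioc) ?_
    rintro p ⟨hp, hp'⟩
    rw [hN p fun h => hp' ⟨h, hp.2⟩]
    simp
  have hcar := carleman (M := M) (d := ε ^ 2 / 2) hs hσ hg (ρ := ε / 4) (by positivity)
    (by linarith : δ ≤ 3) (by positivity) hinteg ?_ ?_ h3 ?_ ?_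
  · rw [setIntegral_eq_of_subset_of_forall_sdiff_eq_zero (s := annulus ε) (measurableSet_ext _)
      hann, setIntegral_eq_of_subset_of_forall_sdiff_eq_zero (s := annulus ε ×ˢ Ioc δ 3)
      ((measurableSet_ext _).prod measurableSet_Ioc) (prod_mono hann subset_rfl)] at hcar
    · refine le_trans (le_of_eq (setIntegral_congr_fun hmeas fun x hx => ?_)) hcar
      have hx1 := hx.1
      rw [currentTW_eq (p := (x, δ)) ⟨hδ, by change δ < 2 * ‖x‖; linarith⟩]
      refine currentT_congr ?_
      rcases lt_or_ge (4 * ‖x‖ ^ 2 - δ ^ 2) (ε ^ 2) with h | h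
      · filter_upwards [hlow (p := (x, δ)) h, hlow' (p := (x, δ)) h] with y hy hy'
        rw [hy, hy']
      · filter_upwards [hgK (x, δ) ⟨⟨hx.2, hδ.le, h⟩, le_refl δ⟩] with y hy
        rw [hy]
    · rintro p ⟨hp, hp'⟩
      rw [hN p fun h => hp' ⟨h, hp.2⟩]
      simp
    · rintro x ⟨hx, hx'⟩
      apply currentT_eq_zero
      have : g =ᶠ[𝓝 (x, δ)] 0 := by
        rcases hcase (p := (x, δ)) le_rfl with h | h
        · exact h
        · exact absurd (core_annulus h.1) hx'
      filter_upwards [this] with y hy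
      simp [hy]
  · rintro p ⟨hp1, hp2⟩
    rcases hcase hp2.1.le with h | h
    · rw [charOp_eq_zero h, abs_zero]
      have := hN0 p
      positivity
    · rw [charOp_congr (hgK p h), (hgK p h).eq_of_nhds]
      exact hop p h.1 (hδ.trans hp2.1)
  · rintro p ⟨hp1, hp2⟩
    refine (hcase hp2.1.le).imp id fun h => ?_
    have h1 := core_gap hε h.1
    have h2 := (core_annulus h.1).1
    have h3 := h.1.2.1
    rcases hs with rfl | rfl
    · nlinarith
    · linarith
  · intro p hp hp2
    apply hlow'
    rw [hp]
    nlinarith [sq_nonneg p.2]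
  · intro x hx
    rcases hcase (p := (x, 3)) (by change δ ≤ 3; linarith) with h | h
    · exact h
    · have : (3 : ℝ) < 2 := core_snd_lt hε h.1
      linarith

end Flux

section FluxTrace

variable {s ε : ℝ} {f w F : Space × ℝ → ℝ} {p : Space × ℝ} {q : Space → ℝ}

/-- The transition region of the cutoff. -/
def cutZone (ε : ℝ) : Set (Space × ℝ) := core ε ∩ {p | 4 * ‖p.1‖ ^ 2 - p.2 ^ 2 ≤ 2 * ε ^ 2}

theorem isClosed_cutZone : IsClosed (cutZone ε) :=
  isClosed_core.inter (isClosed_le (by fun_prop) continuous_const)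

/-- The weighted potential energy density. -/
noncomputable def potDensity (q : Space → ℝ) (n : ℕ) (x : Space) : ℝ :=
  (‖x‖ ^ 2)⁻¹ * (Real.exp (8 * (n : ℝ) ^ 2 * ‖x‖ ^ 2) * q x ^ 2)

theorem potDensity_nonneg (q : Space → ℝ) (n : ℕ) (x : Space) : 0 ≤ potDensity q n x := by
  unfold potDensity
  positivity

theorem norm_pos_of_mem_annulus {x : Space} (hε : 0 < ε) (hx : x ∈ annulus ε) : 0 < ‖x‖ := by
  have := hx.1
  linarith

theorem measurableSet_annulus : MeasurableSet (annulus ε) :=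
  isCompact_annulus.isClosed.measurableSet

theorem integrableOn_potDensity (hε : 0 < ε) (hq : Continuous q) (n : ℕ) :
    IntegrableOn (potDensity q n) (annulus ε) := by
  refine ContinuousOn.integrableOn_compact isCompact_annulus ?_
  have : ContinuousOn (fun x : Space => (‖x‖ ^ 2)⁻¹) (annulus ε) :=
    (continuous_norm.pow 2).continuousOn.inv₀ fun x hx =>
      (pow_pos (norm_pos_of_mem_annulus hε hx) 2).ne'
  unfold potDensity
  fun_prop

theorem weighted_source_le {C₁ C₂ : ℝ} {n : ℕ} (hn : 1 ≤ n) (hε : 0 < ε)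
    (hp : p.1 ∈ annulus ε) (hp3 : p.2 ≤ 3) :
    (‖p.1‖ ^ 2)⁻¹ * (weight ((n : ℝ) ^ 2) (n : ℝ)⁻¹ p ^ 2 *
        (C₁ * |q p.1| + C₂ * (cutZone ε).indicator 1 p) ^ 2) ≤
      2 * C₁ ^ 2 * Real.exp 1 * potDensity q n p.1 +
        8 * C₂ ^ 2 / ε ^ 2 * Real.exp (4 * ε ^ 2 * (n : ℝ) ^ 2 + 6 * n) := by
  have hn0 : (0 : ℝ) < n := by exact_mod_cast hn
  have hr := norm_pos_of_mem_annulus hε hp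
  have hr2 : (‖p.1‖ ^ 2)⁻¹ ≤ 4 / ε ^ 2 := by
    rw [inv_le_comm₀ (by positivity) (by positivity), inv_div]
    nlinarith [hp.1]
  have hw : weight ((n : ℝ) ^ 2) (n : ℝ)⁻¹ p ^ 2 =
      Real.exp (2 * ((n : ℝ) ^ 2 * (4 * ‖p.1‖ ^ 2 - p.2 ^ 2) + n * p.2)) := by
    rw [weight, ← Real.exp_nat_mul]
    congr 1
    push_cast
    field_simp
  have hw1 : weight ((n : ℝ) ^ 2) (n : ℝ)⁻¹ p ^ 2 ≤
      Real.exp 1 * Real.exp (8 * (n : ℝ) ^ 2 * ‖p.1‖ ^ 2) := by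
    rw [hw, ← Real.exp_add, Real.exp_le_exp]
    nlinarith [sq_nonneg (n * p.2 - 1 / 2)]
  have hI : C₂ ^ 2 * (‖p.1‖ ^ 2)⁻¹ * (weight ((n : ℝ) ^ 2) (n : ℝ)⁻¹ p ^ 2 *
      (cutZone ε).indicator 1 p ^ 2) ≤
      C₂ ^ 2 * (4 / ε ^ 2) * Real.exp (4 * ε ^ 2 * (n : ℝ) ^ 2 + 6 * n) := by
    by_cases hZ : p ∈ cutZone ε
    · rw [indicator_of_mem hZ, Pi.one_apply, one_pow, mul_one, hw]
      gcongr
      have h1 : 4 * ‖p.1‖ ^ 2 - p.2 ^ 2 ≤ 2 * ε ^ 2 := hZ.2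
      have h2 := mul_le_mul_of_nonneg_left h1 (sq_nonneg (n : ℝ))
      have h3 := mul_le_mul_of_nonneg_left hp3 hn0.le
      linarith
    · rw [indicator_of_notMem hZ]
      simp only [ne_eq, OfNat.ofNat_ne_zero, not_false_eq_true, zero_pow, mul_zero]
      positivity
  set J : ℝ := (cutZone ε).indicator 1 p
  set e := weight ((n : ℝ) ^ 2) (n : ℝ)⁻¹ p
  have hsq : (C₁ * |q p.1| + C₂ * J) ^ 2 ≤ 2 * (C₁ ^ 2 * q p.1 ^ 2) + 2 * (C₂ ^ 2 * J ^ 2) := by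
    nlinarith [sq_nonneg (C₁ * |q p.1| - C₂ * J), sq_abs (q p.1)]
  calc (‖p.1‖ ^ 2)⁻¹ * (e ^ 2 * (C₁ * |q p.1| + C₂ * J) ^ 2)
      ≤ (‖p.1‖ ^ 2)⁻¹ * (e ^ 2 * (2 * (C₁ ^ 2 * q p.1 ^ 2) + 2 * (C₂ ^ 2 * J ^ 2))) := by gcongr
    _ = 2 * C₁ ^ 2 * (‖p.1‖ ^ 2)⁻¹ * q p.1 ^ 2 * e ^ 2 +
        2 * (C₂ ^ 2 * (‖p.1‖ ^ 2)⁻¹ * (e ^ 2 * J ^ 2)) := by ring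
    _ ≤ 2 * C₁ ^ 2 * (‖p.1‖ ^ 2)⁻¹ * q p.1 ^ 2 *
          (Real.exp 1 * Real.exp (8 * (n : ℝ) ^ 2 * ‖p.1‖ ^ 2)) +
        2 * (C₂ ^ 2 * (4 / ε ^ 2) * Real.exp (4 * ε ^ 2 * (n : ℝ) ^ 2 + 6 * n)) := by gcongr
    _ = _ := by
      rw [potDensity]
      ring

theorem integral_weighted_source_le {C₁ C₂ δ : ℝ} {n : ℕ} (hn : 1 ≤ n) (hε : 0 < ε)
    (hq : Continuous q) (hδ : 0 < δ) (hδ3 : δ ≤ 3) :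
    IntegrableOn (fun p => (‖p.1‖ ^ 2)⁻¹ * (weight ((n : ℝ) ^ 2) (n : ℝ)⁻¹ p ^ 2 *
        (C₁ * |q p.1| + C₂ * (cutZone ε).indicator 1 p) ^ 2)) (annulus ε ×ˢ Ioc δ 3) ∧
    ∫ p in annulus ε ×ˢ Ioc δ 3, (‖p.1‖ ^ 2)⁻¹ * (weight ((n : ℝ) ^ 2) (n : ℝ)⁻¹ p ^ 2 *
        (C₁ * |q p.1| + C₂ * (cutZone ε).indicator 1 p) ^ 2) ≤
      3 * ∫ x in annulus ε, (2 * C₁ ^ 2 * Real.exp 1 * potDensity q n x +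
        8 * C₂ ^ 2 / ε ^ 2 * Real.exp (4 * ε ^ 2 * (n : ℝ) ^ 2 + 6 * n)) := by
  set G : Space → ℝ := fun x => 2 * C₁ ^ 2 * Real.exp 1 * potDensity q n x +
    8 * C₂ ^ 2 / ε ^ 2 * Real.exp (4 * ε ^ 2 * (n : ℝ) ^ 2 + 6 * n) with hG
  have hG0 x : 0 ≤ G x := by
    have := potDensity_nonneg q n x
    positivity
  have hGi : IntegrableOn G (annulus ε) :=
    ((integrableOn_potDensity hε hq n).const_mul _).add
      (integrableOn_const isCompact_annulus.measure_lt_top.ne)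
  have hfin : volume (Ioc δ 3) ≠ ⊤ := measure_Ioc_lt_top.ne
  have hGp : IntegrableOn (fun p : Space × ℝ => G p.1) (annulus ε ×ˢ Ioc δ 3) := by
    have h1 : IntegrableOn (fun _ : ℝ => (1 : ℝ)) (Ioc δ 3) := integrableOn_const hfin
    have := Integrable.mul_prod hGi h1
    rw [Measure.prod_restrict] at this
    simp only [mul_one] at this
    exact this
  have hm : MeasurableSet (annulus ε ×ˢ Ioc δ 3) := measurableSet_annulus.prod measurableSet_Ioc
  have hbd : ∀ p ∈ annulus ε ×ˢ Ioc δ 3, (‖p.1‖ ^ 2)⁻¹ * (weight ((n : ℝ) ^ 2) (n : ℝ)⁻¹ p ^ 2 *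
        (C₁ * |q p.1| + C₂ * (cutZone ε).indicator 1 p) ^ 2) ≤ G p.1 := fun p hp =>
    weighted_source_le hn hε hp.1 hp.2.2
  have hint : IntegrableOn (fun p => (‖p.1‖ ^ 2)⁻¹ * (weight ((n : ℝ) ^ 2) (n : ℝ)⁻¹ p ^ 2 *
        (C₁ * |q p.1| + C₂ * (cutZone ε).indicator 1 p) ^ 2)) (annulus ε ×ˢ Ioc δ 3) := by
    refine Integrable.mono' hGp (Measurable.aestronglyMeasurable ?_) ?_
    · have h1 : Measurable (weight ((n : ℝ) ^ 2) (n : ℝ)⁻¹) := by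
        unfold weight
        fun_prop
      have h2 : Measurable fun p : Space × ℝ => q p.1 := hq.measurable.comp measurable_fst
      have h3 : Measurable ((cutZone ε).indicator (1 : Space × ℝ → ℝ)) :=
        measurable_one.indicator isClosed_cutZone.measurableSet
      fun_prop
    · filter_upwards [ae_restrict_mem hm] with p hp
      rw [Real.norm_of_nonneg (by positivity)]
      exact hbd p hp
  refine ⟨hint, (setIntegral_mono_on hint hGp hm hbd).trans ?_⟩
  have h1 : ∫ p in annulus ε ×ˢ Ioc δ 3, G p.1 = (∫ x in annulus ε, G x) * (3 - δ) := by
    have := setIntegral_prod_mul (μ := volume) (ν := volume) G (fun _ : ℝ => (1 : ℝ))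
      (annulus ε) (Ioc δ 3)
    simp only [mul_one] at this
    rw [Measure.volume_eq_prod, this]
    simp [hδ3]
  rw [h1]
  have : 0 ≤ ∫ x in annulus ε, G x := integral_nonneg hG0
  nlinarith

theorem flux_trace_le {M C₁ C₂ : ℝ} {n : ℕ} (hs : s = 1 ∨ s = -1) (hn : 1 ≤ n)
    (hnε : (n : ℝ)⁻¹ ≤ ε) (hε : 0 < ε) (hε1 : ε ≤ 1) (hF : ContDiffOn ℝ ∞ F dom)
    (hF0 : ∀ p : Space × ℝ, 4 * ‖p.1‖ ^ 2 - p.2 ^ 2 ≤ ε ^ 2 → F p = 0)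
    (hF1 : ∀ p ∈ domInt, 1 < ‖p.1‖ → p.2 < 4 - 2 * ‖p.1‖ → F p = 0)
    (hM : 0 ≤ M) (hC₁ : 0 ≤ C₁) (hC₂ : 0 ≤ C₂) (hq : Continuous q)
    (hq0 : ∀ x, x ∉ annulus ε → q x = 0)
    (hop : ∀ p ∈ core ε, 0 < p.2 → |charOp s F p| ≤
      ‖p.1‖ ^ 2 * (M * |F p| + (C₁ * |q p.1| + C₂ * (cutZone ε).indicator 1 p)))
    (hnM : M ^ 2 / (4 * (n : ℝ) ^ 2) ≤ 8 * ((n : ℝ) ^ 2) ^ 2 * (ε ^ 2 / 2) ^ 2 - 32 * (n : ℝ) ^ 2) :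
    ∫ x in annulus ε, currentTW s ((n : ℝ) ^ 2) (n : ℝ)⁻¹
        (fun y => weight ((n : ℝ) ^ 2) (n : ℝ)⁻¹ y * F y) (x, 0) ≤
      1 / (4 * (n : ℝ) ^ 2) * (3 * ∫ x in annulus ε, (2 * C₁ ^ 2 * Real.exp 1 * potDensity q n x +
        8 * C₂ ^ 2 / ε ^ 2 * Real.exp (4 * ε ^ 2 * (n : ℝ) ^ 2 + 6 * n))) := by
  have hn0 : (0 : ℝ) < n := by exact_mod_cast hn
  have hw : ContDiffOn ℝ ∞ (fun y => weight ((n : ℝ) ^ 2) (n : ℝ)⁻¹ y * F y) dom :=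
    offAxis_weight.contDiffOn_dom.mul hF
  have hlim := tendsto_slice_integral (A := annulus ε) (b := ε / 2) isCompact_annulus
    measurableSet_annulus subset_rfl (by positivity) ((continuousOn_currentTW (s := s)
      (σ := (n : ℝ) ^ 2) (κ := (n : ℝ)⁻¹) hw).mono
      fun p hp => by
        have h1 := hp.1.1
        have h2 := hp.2.2
        exact ⟨hp.2.1, by linarith⟩)
  refine le_of_tendsto hlim ?_
  filter_upwards [Ioo_mem_nhdsGT hε] with δ hδ
  have hsrc := integral_weighted_source_le (C₁ := C₁) (C₂ := C₂) hn hε hq hδ.1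
    (by linarith [hδ.2] : δ ≤ 3)
  refine (flux_slice_le hs (by positivity) hnε (by positivity) hε hε1 hF hF0 hF1 hM ?_ hop ?_
    hsrc.1 hnM hδ.1 hδ.2).trans ?_
  · intro p
    have : 0 ≤ (cutZone ε).indicator (1 : Space × ℝ → ℝ) p := indicator_nonneg (fun _ _ => zero_le_one) p
    positivity
  · intro p hp
    rw [hq0 _ hp, indicator_of_notMem fun h => hp (core_annulus h.1)]
    simp
  · exact mul_le_mul_of_nonneg_left hsrc.2 (by positivity)

end FluxTrace

section Cutoff

variable {s ε : ℝ} {f : Space × ℝ → ℝ} {p : Space × ℝ} {q : Space → ℝ}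

/-- Cutoff away from the light cone `τ = 2|x|`. -/
noncomputable def cutoff (ε : ℝ) (p : Space × ℝ) : ℝ :=
  Real.smoothTransition ((ε ^ 2)⁻¹ * (4 * ‖p.1‖ ^ 2 - p.2 ^ 2) - 1)

theorem cutoff_eq_zero (hε : 0 < ε) (hp : 4 * ‖p.1‖ ^ 2 - p.2 ^ 2 ≤ ε ^ 2) : cutoff ε p = 0 := by
  refine Real.smoothTransition.zero_of_nonpos ?_
  rw [sub_nonpos, inv_mul_le_one₀ (by positivity)]
  exact hp

theorem cutoff_eq_one (hε : 0 < ε) (hp : 2 * ε ^ 2 ≤ 4 * ‖p.1‖ ^ 2 - p.2 ^ 2) :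
    cutoff ε p = 1 := by
  refine Real.smoothTransition.one_of_one_le ?_
  have h : (2 : ℝ) ≤ (ε ^ 2)⁻¹ * (4 * ‖p.1‖ ^ 2 - p.2 ^ 2) := by
    rw [le_inv_mul_iff₀ (by positivity)]
    linarith
  linarith

theorem cutoff_nonneg : 0 ≤ cutoff ε p := Real.smoothTransition.nonneg _

theorem cutoff_le_one : cutoff ε p ≤ 1 := Real.smoothTransition.le_one _

theorem offAxis_cutoff : OffAxis (cutoff ε) :=
  .comp Real.smoothTransition.contDiff (.sub (.mul (.const _) (.sub (.mul (.const _)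
    (.pow .norm _)) (.pow .snd _))) (.const _))

theorem HasAlong.dO_cutoff (i : Fin 3) (hp : p.1 ≠ 0) : HasAlong (rotField i) (cutoff ε) p 0 := by
  have hd : HasDerivAt Real.smoothTransition
      (deriv Real.smoothTransition ((ε ^ 2)⁻¹ * (4 * ‖p.1‖ ^ 2 - p.2 ^ 2) - 1))
      ((ε ^ 2)⁻¹ * (4 * ‖p.1‖ ^ 2 - p.2 ^ 2) - 1) :=
    ((Real.smoothTransition.contDiff (n := 1)).differentiable (by simp) _).hasDerivAt
  refine HasAlong.eq (HasAlong.comp hd (.sub (.mul (.const _) (.sub (.mul (.const _)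
    (.pow_two (.dO_norm i hp))) (.pow_two (.dO_snd i)))) (.const _))) ?_
  ring

/-- The commutator of the characteristic operator with the cutoff. -/
noncomputable def cutoffCommutator (s ε : ℝ) (f : Space × ℝ → ℝ) (p : Space × ℝ) : ℝ :=
  2 * s * ‖p.1‖ * (dR (cutoff ε) p * alongW timeField f p + dT (cutoff ε) p * alongW radialField f p
    + dR (dT (cutoff ε)) p * f p) - 2 * dR (cutoff ε) p * alongW radialField f p
    - dR (dR (cutoff ε)) p * f p + dR (cutoff ε) p * f p

theorem continuousOn_cutoffCommutator (hf : ContDiffOn ℝ ∞ f dom) :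
    ContinuousOn (cutoffCommutator s ε f) dom := by
  have hT := continuousOn_alongW contDiff_timeField.continuous hf
  have hR := continuousOn_alongW contDiff_radialField.continuous hf
  have h0 := hf.continuousOn
  have cR := (offAxis_cutoff (ε := ε)).along contDiff_radialField
  have cT := (offAxis_cutoff (ε := ε)).along contDiff_timeField
  have k1 := cR.contDiffOn_dom.continuousOn
  have k2 := cT.contDiffOn_dom.continuousOn
  have k3 := (cR.along contDiff_radialField).contDiffOn_dom.continuousOn
  have k4 := (cT.along contDiff_radialField).contDiffOn_dom.continuousOn
  unfold cutoffCommutator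
  fun_prop

theorem charOp_cutoff (hf : ContDiffOn ℝ ∞ f dom) (hp : p ∈ domInt) :
    charOp s (fun y => cutoff ε y * f y) p =
      cutoff ε p * charOp s f p + cutoffCommutator s ε f p := by
  have hp0 := fst_ne_zero_of_mem_dom (domInt_subset_dom hp)
  have he : ∀ᶠ y in 𝓝 p, y ∈ domInt := isOpen_domInt.mem_nhds hp
  have hfp := contDiffAt_of_mem_domInt hf hp
  have hc := offAxis_cutoff (ε := ε) p hp0
  have a0 {ξ} : HasAlong ξ f p (along ξ f p) := .of_contDiffAt hfp
  have aT {ξ} : HasAlong ξ (dT f) p (along ξ (dT f) p) := .of_contDiffAt (contDiffAt_dT hfp)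
  have aR {ξ} : HasAlong ξ (dR f) p (along ξ (dR f) p) := .of_contDiffAt (contDiffAt_dR hfp)
  have aO {ξ} (i : Fin 3) : HasAlong ξ (dO i f) p (along ξ (dO i f) p) :=
    .of_contDiffAt (contDiffAt_dO i hfp)
  have c0 {ξ} : HasAlong ξ (cutoff ε) p (along ξ (cutoff ε) p) := .of_contDiffAt hc
  have cT {ξ} : HasAlong ξ (dT (cutoff ε)) p (along ξ (dT (cutoff ε)) p) :=
    .of_contDiffAt (contDiffAt_dT hc)
  have cR {ξ} : HasAlong ξ (dR (cutoff ε)) p (along ξ (dR (cutoff ε)) p) :=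
    .of_contDiffAt (contDiffAt_dR hc)
  have hmul (ξ : Space × ℝ → Space × ℝ) : along ξ (fun y => cutoff ε y * f y) =ᶠ[𝓝 p]
      fun y => along ξ (cutoff ε) y * f y + cutoff ε y * along ξ f y := by
    filter_upwards [he] with y hy
    exact ((HasAlong.of_contDiffAt (offAxis_cutoff y (fst_ne_zero_of_mem_dom
      (domInt_subset_dom hy)))).mul (.of_contDiffAt (contDiffAt_of_mem_domInt hf hy))).2
  have hmulO (i : Fin 3) : dO i (fun y => cutoff ε y * f y) =ᶠ[𝓝 p]
      fun y => cutoff ε y * dO i f y := by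
    filter_upwards [he, hmul (rotField i)] with y hy hy'
    rw [hy', (HasAlong.dO_cutoff i (fst_ne_zero_of_mem_dom (domInt_subset_dom hy))).2]
    ring
  have h1 := (HasAlong.congr ((cT (ξ := radialField)).mul a0 |>.add (c0.mul aT)) (hmul timeField)).2
  have h2 := (HasAlong.congr ((cR (ξ := radialField)).mul a0 |>.add (c0.mul aR))
    (hmul radialField)).2
  have h3 (i : Fin 3) := (HasAlong.congr ((HasAlong.dO_cutoff (ε := ε) i hp0).mul (aO i))
    (hmulO i)).2
  have h4 := (hmul radialField).eq_of_nhds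
  unfold charOp cutoffCommutator
  rw [h1, h2, h4, alongW_eq hp, alongW_eq hp]
  simp only [h3, Fin.sum_univ_three]
  ring

theorem cutoffCommutator_eq_zero (hε : 0 < ε) (hp : 2 * ε ^ 2 < 4 * ‖p.1‖ ^ 2 - p.2 ^ 2) :
    cutoffCommutator s ε f p = 0 := by
  have h : cutoff ε =ᶠ[𝓝 p] fun _ => 1 := by
    filter_upwards [(by fun_prop : Continuous fun p : Space × ℝ =>
      4 * ‖p.1‖ ^ 2 - p.2 ^ 2).continuousAt.eventually_const_lt hp] with y hy
    exact cutoff_eq_one hε hy.le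
  have h1 (ξ : Space × ℝ → Space × ℝ) : along ξ (cutoff ε) =ᶠ[𝓝 p] 0 :=
    (along_congr h).trans (Eventually.of_forall fun y => along_const 1)
  simp [cutoffCommutator, along_eq_zero (h1 _), (h1 _).eq_of_nhds]

theorem exists_charOp_cutoff_bound {M : ℝ} {f₂ : Space × ℝ → ℝ} {q₁ : Space → ℝ} (hε : 0 < ε)
    (hf : ContDiffOn ℝ ∞ f dom) (hf₂ : ContDiffOn ℝ ∞ f₂ dom)
    (hpde : ∀ p ∈ domInt, charOp s f p = -(‖p.1‖ ^ 2 * (q₁ p.1 * f p + q p.1 * f₂ p)))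
    (hM : ∀ x, |q₁ x| ≤ M) :
    ∃ C₁ C₂ : ℝ, 0 ≤ C₁ ∧ 0 ≤ C₂ ∧ ∀ p ∈ core ε, 0 < p.2 →
      |charOp s (fun y => cutoff ε y * f y) p| ≤ ‖p.1‖ ^ 2 * (M * |cutoff ε p * f p| +
        (C₁ * |q p.1| + C₂ * (cutZone ε).indicator 1 p)) := by
  obtain ⟨B₁, hB₁⟩ := (isCompact_core hε).exists_bound_of_continuousOn
    (hf₂.continuousOn.mono (core_subset_dom hε))
  obtain ⟨B₂, hB₂⟩ := (isCompact_core hε).exists_bound_of_continuousOn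
    ((continuousOn_cutoffCommutator (s := s) (ε := ε) hf).mono (core_subset_dom hε))
  refine ⟨|B₁|, 4 / ε ^ 2 * |B₂|, abs_nonneg _, by positivity, fun p hp hp0 => ?_⟩
  have hpI : p ∈ domInt := ⟨hp0, (core_subset_dom hε hp).2⟩
  rw [charOp_cutoff hf hpI, hpde p hpI]
  have h1 : |f₂ p| ≤ |B₁| := (hB₁ p hp).trans (le_abs_self _)
  have h2 : |cutoffCommutator s ε f p| ≤
      ‖p.1‖ ^ 2 * (4 / ε ^ 2 * |B₂| * (cutZone ε).indicator 1 p) := by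
    by_cases hZ : p ∈ cutZone ε
    · rw [indicator_of_mem hZ, Pi.one_apply, mul_one]
      have h3 : 1 ≤ ‖p.1‖ ^ 2 * (4 / ε ^ 2) := by
        rw [mul_div_assoc', one_le_div (by positivity)]
        nlinarith [(core_annulus hp).1]
      calc |cutoffCommutator s ε f p| ≤ 1 * |B₂| := by
            rw [one_mul]
            exact (hB₂ p hp).trans (le_abs_self _)
        _ ≤ (‖p.1‖ ^ 2 * (4 / ε ^ 2)) * |B₂| := by gcongr
        _ = _ := by ring
    · rw [cutoffCommutator_eq_zero hε, indicator_of_notMem hZ]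
      · simp
      · by_contra hcon
        exact hZ ⟨hp, not_lt.1 hcon⟩
  have hc0 := cutoff_nonneg (ε := ε) (p := p)
  have hc1 := cutoff_le_one (ε := ε) (p := p)
  have h3 : |cutoff ε p * -(‖p.1‖ ^ 2 * (q₁ p.1 * f p + q p.1 * f₂ p))| ≤
      ‖p.1‖ ^ 2 * (M * |cutoff ε p * f p| + |B₁| * |q p.1|) := by
    have e1 : cutoff ε p * -(‖p.1‖ ^ 2 * (q₁ p.1 * f p + q p.1 * f₂ p)) =
        -(‖p.1‖ ^ 2 * (q₁ p.1 * (cutoff ε p * f p) + q p.1 * (cutoff ε p * f₂ p))) := by ring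
    rw [e1, abs_neg, abs_mul, abs_of_nonneg (sq_nonneg ‖p.1‖)]
    gcongr
    refine (abs_add_le _ _).trans ?_
    rw [abs_mul (q₁ p.1), abs_mul (q p.1), abs_mul (cutoff ε p) (f₂ p), abs_of_nonneg hc0]
    have e2 : cutoff ε p * |f₂ p| ≤ |B₁| := by
      nlinarith [abs_nonneg (f₂ p)]
    have := mul_le_mul_of_nonneg_left e2 (abs_nonneg (q p.1))
    have := mul_le_mul_of_nonneg_right (hM p.1) (abs_nonneg (cutoff ε p * f p))
    linarith
  refine (abs_add_le _ _).trans ((add_le_add h3 h2).trans (le_of_eq ?_))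
  ring

end Cutoff

section Combination

variable {s ε σ κ c : ℝ} {f F F' : Space × ℝ → ℝ} {p : Space × ℝ} {q : Space → ℝ} {x : Space}

theorem alongW_mul_weight {ξ : Space × ℝ → Space × ℝ} (hF : ContDiffOn ℝ ∞ F dom) (hp : p ∈ dom) :
    alongW ξ (fun y => weight σ κ y * F y) p =
      along ξ (weight σ κ) p * F p + weight σ κ p * alongW ξ F p := by
  have hu := uniqueDiffOn_dom p hp
  have hw : DifferentiableAt ℝ (weight σ κ) p := offAxis_weight.diff (fst_ne_zero_of_mem_dom hp)
  have hd : HasFDerivWithinAt (fun y => weight σ κ y * F y)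
      (weight σ κ p • fderivWithin ℝ F dom p + F p • fderiv ℝ (weight σ κ) p) dom p :=
    (hw.hasFDerivAt.hasFDerivWithinAt (s := dom)).mul
      (hF.differentiableOn (by simp) p hp).hasFDerivWithinAt
  rw [alongW, hd.fderivWithin hu]
  simp only [along, alongW, add_apply, smul_apply, smul_eq_mul]
  ring

/-- The fluxes of the two families through `τ = 0` combine to a positive quantity. -/
theorem flux_sum_ge (hκ : 0 ≤ κ) (hF : ContDiffOn ℝ ∞ F dom) (hF' : ContDiffOn ℝ ∞ F' dom)
    (hFF' : ∀ y ≠ 0, F' (y, 0) = -F (y, 0)) (hx : x ≠ 0)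
    (hr : fderiv ℝ (fun y => F (y, 0)) x x = c * (‖x‖ * q x)) :
    κ * c ^ 2 * ((‖x‖ ^ 2)⁻¹ * (Real.exp (8 * σ * ‖x‖ ^ 2) * q x ^ 2)) ≤
      currentTW 1 σ κ (fun y => weight σ κ y * F y) (x, 0) +
        currentTW (-1) σ κ (fun y => weight σ κ y * F' y) (x, 0) := by
  have hdx := mk_zero_mem_dom hx
  have hn : 0 < ‖x‖ := norm_pos_iff.2 hx
  have hneg (ξ : Space × ℝ → Space × ℝ) (hξ : (ξ (x, 0)).2 = 0) :
      alongW ξ F' (x, 0) = -alongW ξ F (x, 0) := by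
    rw [alongW_trace hF' hx hξ, alongW_trace hF hx hξ]
    have : (fun y => F' (y, 0)) =ᶠ[𝓝 x] -fun y => F (y, 0) := by
      filter_upwards [isOpen_ne.mem_nhds hx] with y hy
      exact hFF' y hy
    rw [this.fderiv_eq, fderiv_neg]
    rfl
  have hR : alongW radialField F (x, 0) = c * (‖x‖ * q x) := by
    rw [alongW_trace hF hx rfl]
    exact hr
  have hw2 : weight σ κ (x, 0) ^ 2 = Real.exp (8 * σ * ‖x‖ ^ 2) := by
    rw [weight, ← Real.exp_nat_mul]
    congr 1
    push_cast
    ring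
  simp only [currentTW, alongW_mul_weight hF hdx, alongW_mul_weight hF' hdx,
    (HasAlong.dR_weight (p := (x, (0 : ℝ))) hx).2,
    (HasAlong.dO_weight (p := (x, (0 : ℝ))) _ hx).2, hneg radialField rfl, hneg (rotField _) rfl,
    hFF' x hx, hR, ← hw2]
  set e := weight σ κ (x, 0)
  set S := ∑ i, (0 * F (x, 0) + e * alongW (rotField i) F (x, 0)) ^ 2 with hS
  have hS' : ∑ i, (0 * -F (x, 0) + e * -alongW (rotField i) F (x, 0)) ^ 2 = S :=
    Finset.sum_congr rfl fun i _ => by ring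
  rw [hS']
  have key : 0 ≤ κ * e ^ 2 * (‖x‖ ^ 4)⁻¹ * ((16 * σ * ‖x‖ ^ 2 * F (x, 0) + c * (‖x‖ * q x)) ^ 2) := by
    positivity
  have hid : ∀ a b : ℝ, a - b = κ * e ^ 2 * (‖x‖ ^ 4)⁻¹ *
      ((16 * σ * ‖x‖ ^ 2 * F (x, 0) + c * (‖x‖ * q x)) ^ 2) → b ≤ a := fun a b h => by linarith
  apply hid
  field_simp
  ring

theorem exists_flux_bound {M : ℝ} {f₂ : Space × ℝ → ℝ} {q₁ : Space → ℝ} (hs : s = 1 ∨ s = -1)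
    (hε : 0 < ε) (hε1 : ε ≤ 1) (hf : ContDiffOn ℝ ∞ f dom) (hf₂ : ContDiffOn ℝ ∞ f₂ dom)
    (hpde : ∀ p ∈ domInt, charOp s f p = -(‖p.1‖ ^ 2 * (q₁ p.1 * f p + q p.1 * f₂ p)))
    (hM : ∀ x, |q₁ x| ≤ M) (hf1 : ∀ p ∈ domInt, 1 < ‖p.1‖ → p.2 < 4 - 2 * ‖p.1‖ → f p = 0)
    (hq : Continuous q) (hq0 : ∀ x, x ∉ annulus ε → q x = 0) :
    ∃ B : ℝ, 0 ≤ B ∧ ∀ᶠ n : ℕ in atTop,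
      ∫ x in annulus ε, currentTW s ((n : ℝ) ^ 2) (n : ℝ)⁻¹
        (fun y => weight ((n : ℝ) ^ 2) (n : ℝ)⁻¹ y * (cutoff ε y * f y)) (x, 0) ≤
      B / (n : ℝ) ^ 2 * ((∫ x in annulus ε, potDensity q n x) +
        Real.exp (4 * ε ^ 2 * (n : ℝ) ^ 2 + 6 * n)) := by
  obtain ⟨C₁, C₂, hC₁, hC₂, hC⟩ := exists_charOp_cutoff_bound hε hf hf₂ hpde hM
  have hM0 : 0 ≤ M := (abs_nonneg _).trans (hM 0)
  set V := volume.real (annulus ε) with hV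
  have hV0 : 0 ≤ V := measureReal_nonneg
  refine ⟨2 * C₁ ^ 2 * Real.exp 1 + 8 * C₂ ^ 2 / ε ^ 2 * V, by positivity, ?_⟩
  have hinv : Tendsto (fun n : ℕ => (n : ℝ)⁻¹) atTop (𝓝 0) := tendsto_inv_atTop_nhds_zero_nat
  have hsq : Tendsto (fun n : ℕ => (n : ℝ) ^ 2) atTop atTop :=
    (tendsto_pow_atTop two_ne_zero).comp tendsto_natCast_atTop_atTop
  filter_upwards [eventually_ge_atTop 1, hinv.eventually_le_const hε,
    hsq.eventually_ge_atTop ((32 + M ^ 2) / (2 * ε ^ 4))] with n hn hnε hnM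
  have hn1 : (1 : ℝ) ≤ n := by exact_mod_cast hn
  have hnM' : M ^ 2 / (4 * (n : ℝ) ^ 2) ≤
      8 * ((n : ℝ) ^ 2) ^ 2 * (ε ^ 2 / 2) ^ 2 - 32 * (n : ℝ) ^ 2 := by
    have h1 : (1 : ℝ) ≤ (n : ℝ) ^ 2 := one_le_pow₀ hn1
    rw [div_le_iff₀ (by positivity)] at hnM ⊢
    generalize (n : ℝ) ^ 2 = N at *
    have e1 : (8 * N ^ 2 * (ε ^ 2 / 2) ^ 2 - 32 * N) * (4 * N) =
      4 * N ^ 2 * (N * (2 * ε ^ 4) - 32) := by ring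
    rw [e1]
    have h2 : 1 * M ^ 2 ≤ 4 * N ^ 2 * (N * (2 * ε ^ 4) - 32) :=
      mul_le_mul (by nlinarith) (by linarith) (by positivity) (by positivity)
    linarith
  have hmain := flux_trace_le (F := fun y => cutoff ε y * f y) hs hn hnε hε hε1
    (offAxis_cutoff.contDiffOn_dom.mul hf)
    (fun p hp => by simp only [cutoff_eq_zero hε hp, zero_mul])
    (fun p hp h1 h2 => by simp only [hf1 p hp h1 h2, mul_zero]) hM0 hC₁ hC₂ hq hq0 hC hnM'
  refine hmain.trans ?_
  rw [integral_add ((integrableOn_potDensity hε hq n).const_mul _)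
    (integrableOn_const isCompact_annulus.measure_lt_top.ne), integral_const_mul,
    setIntegral_const, smul_eq_mul, ← hV]
  have hI : 0 ≤ ∫ x in annulus ε, potDensity q n x := integral_nonneg (potDensity_nonneg q n)
  set I := ∫ x in annulus ε, potDensity q n x
  set X := Real.exp (4 * ε ^ 2 * (n : ℝ) ^ 2 + 6 * n)
  have hX : 0 ≤ X := (Real.exp_pos _).le
  have e1 : 1 / (4 * (n : ℝ) ^ 2) * (3 * (2 * C₁ ^ 2 * Real.exp 1 * I + V * (8 * C₂ ^ 2 / ε ^ 2 * X)))
      = 1 / (n : ℝ) ^ 2 * (3 / 4 * (2 * C₁ ^ 2 * Real.exp 1 * I + 8 * C₂ ^ 2 / ε ^ 2 * V * X)) := by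
    field_simp
  have e2 : ∀ B : ℝ, B / (n : ℝ) ^ 2 * (I + X) = 1 / (n : ℝ) ^ 2 * (B * (I + X)) := fun B => by ring
  rw [e1, e2]
  refine mul_le_mul_of_nonneg_left ?_ (by positivity)
  have k1 : 0 ≤ 2 * C₁ ^ 2 * Real.exp 1 := by positivity
  have k2 : 0 ≤ 8 * C₂ ^ 2 / ε ^ 2 * V := by positivity
  nlinarith [mul_nonneg k1 hI, mul_nonneg k2 hX, mul_nonneg k1 hX, mul_nonneg k2 hI]

theorem potential_eq_zero {M : ℝ} {f f' f₂ f₂' : Space × ℝ → ℝ} {q₁ : Space → ℝ}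
    (hε : 0 < ε) (hε1 : ε ≤ 1) (hf : ContDiffOn ℝ ∞ f dom) (hf' : ContDiffOn ℝ ∞ f' dom)
    (hf₂ : ContDiffOn ℝ ∞ f₂ dom) (hf₂' : ContDiffOn ℝ ∞ f₂' dom)
    (hpde : ∀ p ∈ domInt, charOp 1 f p = -(‖p.1‖ ^ 2 * (q₁ p.1 * f p + q p.1 * f₂ p)))
    (hpde' : ∀ p ∈ domInt, charOp (-1) f' p = -(‖p.1‖ ^ 2 * (q₁ p.1 * f' p + q p.1 * f₂' p)))
    (hM : ∀ x, |q₁ x| ≤ M) (hf1 : ∀ p ∈ domInt, 1 < ‖p.1‖ → p.2 < 4 - 2 * ‖p.1‖ → f p = 0)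
    (hf1' : ∀ p ∈ domInt, 1 < ‖p.1‖ → p.2 < 4 - 2 * ‖p.1‖ → f' p = 0)
    (hq : Continuous q) (hq0 : ∀ x, ‖x‖ < ε → q x = 0) (hq1 : ∀ x, 1 < ‖x‖ → q x = 0)
    (hneg : ∀ y ≠ 0, f' (y, 0) = -f (y, 0)) (hzero : ∀ y, ‖y‖ < ε → f (y, 0) = 0)
    (hc : c ≠ 0) (hr : ∀ x ≠ 0, fderiv ℝ (fun y => f (y, 0)) x x = c * (‖x‖ * q x)) : q = 0 := by
  have hqA : ∀ x, x ∉ annulus ε → q x = 0 := fun x hx => by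
    rcases lt_or_ge ‖x‖ ε with h | h
    · exact hq0 x h
    · refine hq1 x ?_
      by_contra hcon
      exact hx ⟨by linarith, not_lt.1 hcon⟩
  obtain ⟨B, hB, hBn⟩ := exists_flux_bound (Or.inl rfl) hε hε1 hf hf₂ hpde hM hf1 hq hqA
  obtain ⟨B', hB', hBn'⟩ := exists_flux_bound (Or.inr rfl) hε hε1 hf' hf₂' hpde' hM hf1' hq hqA
  have hF := (offAxis_cutoff (ε := ε)).contDiffOn_dom.mul hf
  have hF' := (offAxis_cutoff (ε := ε)).contDiffOn_dom.mul hf'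
  have htrace (y : Space) : cutoff ε (y, 0) * f (y, 0) = f (y, 0) := by
    rcases lt_or_ge ‖y‖ ε with h | h
    · rw [hzero y h, mul_zero]
    · rw [cutoff_eq_one hε, one_mul]
      change 2 * ε ^ 2 ≤ 4 * ‖y‖ ^ 2 - (0 : ℝ) ^ 2
      nlinarith
  have hint {s σ κ : ℝ} {G : Space × ℝ → ℝ} (hG : ContDiffOn ℝ ∞ G dom) :
      IntegrableOn (fun x => currentTW s σ κ (fun y => weight σ κ y * G y) (x, 0)) (annulus ε) := by
    refine ContinuousOn.integrableOn_compact isCompact_annulus ?_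
    exact (continuousOn_currentTW (offAxis_weight.contDiffOn_dom.mul hG)).comp (by fun_prop)
      fun x hx => mk_zero_mem_dom (norm_pos_iff.1 (norm_pos_of_mem_annulus hε hx))
  have hlow (n : ℕ) : (n : ℝ)⁻¹ * c ^ 2 * ∫ x in annulus ε, potDensity q n x ≤
      (∫ x in annulus ε, currentTW 1 ((n : ℝ) ^ 2) (n : ℝ)⁻¹
        (fun y => weight ((n : ℝ) ^ 2) (n : ℝ)⁻¹ y * (cutoff ε y * f y)) (x, 0)) +
      ∫ x in annulus ε, currentTW (-1) ((n : ℝ) ^ 2) (n : ℝ)⁻¹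
        (fun y => weight ((n : ℝ) ^ 2) (n : ℝ)⁻¹ y * (cutoff ε y * f' y)) (x, 0) := by
    rw [← integral_add (hint hF) (hint hF'), ← integral_const_mul]
    refine setIntegral_mono_on ((integrableOn_potDensity hε hq n).const_mul _)
      ((hint hF).add (hint hF')) measurableSet_annulus fun x hx => ?_
    have hx0 : x ≠ 0 := norm_pos_iff.1 (norm_pos_of_mem_annulus hε hx)
    refine flux_sum_ge (by positivity) hF hF' (fun y hy => ?_) hx0 ?_
    · rw [hneg y hy, mul_neg]
    · simp only [htrace]
      exact hr x hx0
  have hgrow (n : ℕ) : Real.exp (8 * (n : ℝ) ^ 2 * ε ^ 2) * ∫ x in annulus ε, potDensity q 0 x ≤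
      ∫ x in annulus ε, potDensity q n x := by
    rw [← integral_const_mul]
    refine setIntegral_mono_on ((integrableOn_potDensity hε hq 0).const_mul _)
      (integrableOn_potDensity hε hq n) measurableSet_annulus fun x hx => ?_
    rcases lt_or_ge ‖x‖ ε with h | h
    · simp [potDensity, hq0 x h]
    · have : Real.exp (8 * (n : ℝ) ^ 2 * ε ^ 2) ≤ Real.exp (8 * (n : ℝ) ^ 2 * ‖x‖ ^ 2) := by
        gcongr
      simp only [potDensity, Nat.cast_zero, ne_eq, OfNat.ofNat_ne_zero, not_false_eq_true, zero_pow,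
        mul_zero, zero_mul, Real.exp_zero, one_mul]
      rw [mul_left_comm]
      gcongr
  set I₀ := ∫ x in annulus ε, potDensity q 0 x with hI₀
  have hbound : ∀ᶠ n : ℕ in atTop, I₀ ≤ (B + B') * Real.exp (-(n : ℝ)) := by
    have hlin : Tendsto (fun n : ℕ => (n : ℝ)) atTop atTop := tendsto_natCast_atTop_atTop
    filter_upwards [hBn, hBn', eventually_ge_atTop 1,
      hlin.eventually_ge_atTop ((B + B' + 1) / c ^ 2),
      hlin.eventually_ge_atTop (7 / (4 * ε ^ 2))] with n h1 h2 hn h3 h4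
    have hn0 : (0 : ℝ) < n := by exact_mod_cast hn
    have h5 := (hlow n).trans (add_le_add h1 h2)
    have h6 := hgrow n
    have hI : 0 ≤ ∫ x in annulus ε, potDensity q n x := integral_nonneg (potDensity_nonneg q n)
    set I := ∫ x in annulus ε, potDensity q n x
    set X := Real.exp (4 * ε ^ 2 * (n : ℝ) ^ 2 + 6 * n) with hX
    rw [div_le_iff₀ (by positivity)] at h3 h4
    have h7 : n * c ^ 2 * I ≤ (B + B') * (I + X) := by
      have := mul_le_mul_of_nonneg_left h5 (sq_nonneg (n : ℝ))
      calc n * c ^ 2 * I = (n : ℝ) ^ 2 * ((n : ℝ)⁻¹ * c ^ 2 * I) := by field_simp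
        _ ≤ _ := this
        _ = _ := by field_simp
    have h8 : I ≤ (B + B') * X := by
      nlinarith [mul_le_mul_of_nonneg_right h3 hI]
    have h9 : X = Real.exp (8 * (n : ℝ) ^ 2 * ε ^ 2) *
        Real.exp (-(4 * ε ^ 2 * (n : ℝ) ^ 2) + 6 * n) := by
      rw [hX, ← Real.exp_add]
      congr 1
      ring
    have h10 : I₀ ≤ (B + B') * Real.exp (-(4 * ε ^ 2 * (n : ℝ) ^ 2) + 6 * n) := by
      rw [h9] at h8
      have := h6.trans h8
      rw [mul_left_comm] at this
      exact le_of_mul_le_mul_left this (Real.exp_pos _)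
    refine h10.trans ?_
    gcongr
    nlinarith
  have hI₀0 : I₀ ≤ 0 := by
    refine ge_of_tendsto ?_ hbound
    have : Tendsto (fun n : ℕ => Real.exp (-(n : ℝ))) atTop (𝓝 0) :=
      Real.tendsto_exp_neg_atTop_nhds_zero.comp tendsto_natCast_atTop_atTop
    simpa using this.const_mul (B + B')
  have hae := (setIntegral_eq_zero_iff_of_nonneg_ae
    (Eventually.of_forall fun x => potDensity_nonneg q 0 x)
    (integrableOn_potDensity hε hq 0)).1 (le_antisymm hI₀0 (integral_nonneg (potDensity_nonneg q 0)))
  rw [← Continuous.ae_eq_iff_eq volume hq continuous_zero]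
  filter_upwards [(ae_restrict_iff' measurableSet_annulus).1 hae] with x hx
  by_cases hxA : x ∈ annulus ε
  · have h1 := hx hxA
    have := norm_pos_of_mem_annulus hε hxA
    simpa [potDensity, this.ne'] using h1
  · exact hqA x hxA

end Combination

/-! ### Ray transforms of the potential -/

section Rays

variable {q : Space → ℝ} {x : Space}

theorem continuous_ray (hq : Continuous q) (x : Space) : Continuous fun a : ℝ => q (a • x) :=
  hq.comp (continuous_id.smul continuous_const)

theorem ray_eq_zero (hq1 : ∀ y, 1 < ‖y‖ → q y = 0) {a : ℝ} (hx : ‖x‖ = 1) (ha : 1 < a) :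
    q (a • x) = 0 :=
  hq1 _ (by rw [norm_smul, hx, mul_one, Real.norm_eq_abs]; exact ha.trans_le (le_abs_self a))

theorem integrable_ray (hq : Continuous q) (hq1 : ∀ y, 1 < ‖y‖ → q y = 0) (hx : x ≠ 0) :
    Integrable fun a : ℝ => q (a • x) := by
  have hn : 0 < ‖x‖ := norm_pos_iff.2 hx
  refine (continuous_ray hq x).integrable_of_hasCompactSupport
    (HasCompactSupport.intro (isCompact_closedBall (0 : ℝ) ‖x‖⁻¹) fun a ha => hq1 _ ?_)
  rw [mem_closedBall_zero_iff, not_le] at ha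
  rw [norm_smul]
  calc 1 = ‖x‖⁻¹ * ‖x‖ := (inv_mul_cancel₀ hn.ne').symm
    _ < ‖a‖ * ‖x‖ := by gcongr

theorem ray_smul_normalize (hx : x ≠ 0) (a : ℝ) : q (a • x) = q ((a * ‖x‖) • (‖x‖⁻¹ • x)) := by
  rw [smul_smul, mul_assoc, mul_inv_cancel₀ (norm_ne_zero_iff.2 hx), mul_one]

theorem norm_normalize (hx : x ≠ 0) : ‖‖x‖⁻¹ • x‖ = 1 := by
  rw [norm_smul, norm_inv, norm_norm, inv_mul_cancel₀ (norm_ne_zero_iff.2 hx)]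

theorem norm_mul_inner_ray (hx : x ≠ 0) :
    ‖x‖ * ∫ a in Icc (0 : ℝ) 1, q (a • x) = ∫ a in (0 : ℝ)..‖x‖, q (a • (‖x‖⁻¹ • x)) := by
  rw [integral_Icc_eq_integral_Ioc, ← intervalIntegral.integral_of_le zero_le_one]
  simp only [ray_smul_normalize (q := q) hx]
  rw [← smul_eq_mul, intervalIntegral.smul_integral_comp_mul_right
    (fun a : ℝ => q (a • (‖x‖⁻¹ • x)))]
  simp

theorem norm_mul_outer_ray (hx : x ≠ 0) :
    ‖x‖ * ∫ a in Ici (1 : ℝ), q (a • x) = ∫ a in Ioi ‖x‖, q (a • (‖x‖⁻¹ • x)) := by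
  have hn : 0 < ‖x‖ := norm_pos_iff.2 hx
  rw [integral_Ici_eq_integral_Ioi]
  simp only [ray_smul_normalize (q := q) hx]
  rw [integral_comp_mul_right_Ioi (fun a : ℝ => q (a • (‖x‖⁻¹ • x))) 1 hn, one_mul, smul_eq_mul,
    mul_inv_cancel_left₀ (ne_of_gt hn)]

/-- The outer ray integral vanishes outside the support of the potential. -/
theorem outer_ray_eq_zero (hq1 : ∀ y, 1 < ‖y‖ → q y = 0) (hx : 1 ≤ ‖x‖) :
    ∫ a in Ici (1 : ℝ), q (a • x) = 0 := by
  have hx0 : x ≠ 0 := norm_pos_iff.1 (zero_lt_one.trans_le hx)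
  have h := norm_mul_outer_ray (q := q) hx0
  rw [setIntegral_eq_zero_of_forall_eq_zero (t := Ioi ‖x‖) fun a ha =>
    ray_eq_zero hq1 (norm_normalize hx0) (hx.trans_lt ha)] at h
  exact (mul_eq_zero.1 h).resolve_left (norm_ne_zero_iff.2 hx0)

/-- If the potential has zero integral over all radii of the unit ball, then the inner and outer
ray integrals are opposite. -/
theorem outer_ray_eq_neg_inner_ray (hq : Continuous q) (hq1 : ∀ y, 1 < ‖y‖ → q y = 0)
    (h0 : ∀ y : Space, ‖y‖ = 1 → ∫ a in Icc (0 : ℝ) 1, q (a • y) = 0) (hx : x ≠ 0) :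
    ∫ a in Ici (1 : ℝ), q (a • x) = -∫ a in Icc (0 : ℝ) 1, q (a • x) := by
  have he := norm_normalize hx
  have he0 : ‖x‖⁻¹ • x ≠ 0 := norm_ne_zero_iff.1 (by rw [he]; exact one_ne_zero)
  have hi := integrable_ray hq hq1 he0
  have h1 := intervalIntegral.integral_interval_add_Ioi (a := (0 : ℝ)) (b := ‖x‖)
    hi.integrableOn hi.integrableOn
  have h2 := intervalIntegral.integral_interval_add_Ioi (a := (0 : ℝ)) (b := 1)
    hi.integrableOn hi.integrableOn
  rw [← integral_Ici_eq_integral_Ioi (x := (1 : ℝ)), outer_ray_eq_zero hq1 he.ge,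
    intervalIntegral.integral_of_le zero_le_one, ← integral_Icc_eq_integral_Ioc, h0 _ he] at h2
  rw [← norm_mul_inner_ray hx, ← norm_mul_outer_ray hx, ← h2, ← mul_add] at h1
  have := (mul_eq_zero.1 (h1.trans (add_zero 0))).resolve_left (norm_ne_zero_iff.2 hx)
  linarith

theorem inner_ray_eq_zero {ε : ℝ} (hq0 : ∀ y, ‖y‖ < ε → q y = 0) (hx : ‖x‖ < ε) :
    ∫ a in Icc (0 : ℝ) 1, q (a • x) = 0 :=
  setIntegral_eq_zero_of_forall_eq_zero fun a ha => hq0 _ (by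
    rw [norm_smul, Real.norm_of_nonneg ha.1]
    exact (mul_le_of_le_one_left (norm_nonneg x) ha.2).trans_lt hx)

/-- The radial derivative of the weighted inner ray integral. -/
theorem hasDerivAt_inner_ray (hq : Continuous q) (x : Space) :
    HasDerivAt (fun b : ℝ => ‖b • x‖ * ∫ a in Icc (0 : ℝ) 1, q (a • b • x)) (‖x‖ * q x) 1 := by
  have h1 : HasDerivAt (fun b : ℝ => ‖x‖ * ∫ a in (0 : ℝ)..b, q (a • x)) (‖x‖ * q x) 1 := by
    have := ((continuous_ray hq x).integral_hasStrictDerivAt 0 1).hasDerivAt.const_mul ‖x‖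
    simpa using this
  refine h1.congr_of_eventuallyEq ?_
  filter_upwards [lt_mem_nhds (zero_lt_one (α := ℝ))] with b hb
  rw [integral_Icc_eq_integral_Ioc, ← intervalIntegral.integral_of_le zero_le_one]
  simp only [smul_smul]
  have h2 := intervalIntegral.smul_integral_comp_mul_right (a := 0) (b := 1)
    (fun a : ℝ => q (a • x)) b
  rw [zero_mul, one_mul, smul_eq_mul] at h2
  rw [← h2, norm_smul, Real.norm_of_nonneg hb.le]
  ring

end Rays

/-! ### Solutions in characteristic coordinates -/

section Lift

variable {s : ℝ} {u u₁ u₂ : Space × ℝ → ℝ} {p : Space × ℝ}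

/-- The function `|x| u` in characteristic coordinates. -/
noncomputable def lift (s : ℝ) (u : Space × ℝ → ℝ) (p : Space × ℝ) : ℝ := ‖p.1‖ * u (shear s p)

theorem shear_neg_shear (s : ℝ) (p : Space × ℝ) : shear (-s) (shear s p) = p := by
  simp [shear]

theorem continuous_shear (s : ℝ) : Continuous (shear s) := by
  unfold shear; fun_prop

theorem contDiffOn_lift (hu : ContDiffOn ℝ ∞ u (shear (-s) ⁻¹' dom)) :
    ContDiffOn ℝ ∞ (lift s u) dom := by
  have h1 : ContDiffOn ℝ ∞ (shear s) dom := fun p hp =>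
    (contDiffAt_shear (fst_ne_zero_of_mem_dom hp)).contDiffWithinAt
  have h2 : ContDiffOn ℝ ∞ (fun p : Space × ℝ => ‖p.1‖) dom := fun p hp =>
    (contDiffAt_norm_fst (fst_ne_zero_of_mem_dom hp)).contDiffWithinAt
  exact h2.mul (hu.comp h1 fun p hp => by rwa [mem_preimage, shear_neg_shear])

theorem eventually_contDiffAt_shear (hu : ContDiffOn ℝ ∞ u (shear (-s) ⁻¹' dom))
    (hp : p ∈ domInt) : ∀ᶠ y in 𝓝 (shear s p), ContDiffAt ℝ ∞ u y := by
  have ho : IsOpen (shear (-s) ⁻¹' domInt) := isOpen_domInt.preimage (continuous_shear _)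
  have hm : shear s p ∈ shear (-s) ⁻¹' domInt := by rwa [mem_preimage, shear_neg_shear]
  filter_upwards [ho.mem_nhds hm] with y hy
  exact hu.contDiffAt (mem_of_superset (ho.mem_nhds hy) (preimage_mono domInt_subset_dom))

theorem charOp_sub {g h : Space × ℝ → ℝ} (hg : ContDiffOn ℝ ∞ g dom) (hh : ContDiffOn ℝ ∞ h dom)
    (hp : p ∈ domInt) : charOp s (fun y => g y - h y) p = charOp s g p - charOp s h p := by
  have hg' : ∀ y ∈ domInt, ContDiffAt ℝ ∞ g y := fun y hy => contDiffAt_of_mem_domInt hg hy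
  have hh' : ∀ y ∈ domInt, ContDiffAt ℝ ∞ h y := fun y hy => contDiffAt_of_mem_domInt hh hy
  have key (ξ η : Space × ℝ → Space × ℝ) (hη : ContDiff ℝ ∞ η) :
      along ξ (along η fun y => g y - h y) p = along ξ (along η g) p - along ξ (along η h) p := by
    have : along η (fun y => g y - h y) =ᶠ[𝓝 p] fun y => along η g y - along η h y := by
      filter_upwards [isOpen_domInt.mem_nhds hp] with y hy
      exact along_sub ((hg' y hy).differentiableAt (by simp))
        ((hh' y hy).differentiableAt (by simp))
    rw [(along_congr this).eq_of_nhds]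
    exact along_sub ((contDiffAt_along hη (hg' p hp)).differentiableAt (by simp))
      ((contDiffAt_along hη (hh' p hp)).differentiableAt (by simp))
  simp only [charOp, key _ _ contDiff_radialField, key _ _ contDiff_timeField,
    key _ _ (contDiff_rotField _), Finset.sum_sub_distrib,
    along_sub ((hg' p hp).differentiableAt (by simp)) ((hh' p hp).differentiableAt (by simp))]
  ring

/-- The equation satisfied by the difference of two solutions in characteristic coordinates. -/
theorem charOp_lift_sub {q₁ q₂ : Space → ℝ} (hs : s = 1 ∨ s = -1)
    (hu₁ : ContDiffOn ℝ ∞ u₁ (shear (-s) ⁻¹' dom)) (hu₂ : ContDiffOn ℝ ∞ u₂ (shear (-s) ⁻¹' dom))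
    (h₁ : ∀ p ∈ domInt, waveOp3 u₁ (shear s p) + q₁ p.1 * u₁ (shear s p) = 0)
    (h₂ : ∀ p ∈ domInt, waveOp3 u₂ (shear s p) + q₂ p.1 * u₂ (shear s p) = 0)
    (hp : p ∈ domInt) :
    charOp s (fun y => lift s u₁ y - lift s u₂ y) p =
      -(‖p.1‖ ^ 2 * (q₁ p.1 * (lift s u₁ p - lift s u₂ p) + (q₁ p.1 - q₂ p.1) * lift s u₂ p)) := by
  have hp0 := fst_ne_zero_of_mem_dom (domInt_subset_dom hp)
  have e₁ : charOp s (lift s u₁) p = _ :=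
    charOp_shear hs (eventually_contDiffAt_shear hu₁ hp) hp0
  have e₂ : charOp s (lift s u₂) p = _ :=
    charOp_shear hs (eventually_contDiffAt_shear hu₂ hp) hp0
  rw [charOp_sub (contDiffOn_lift hu₁) (contDiffOn_lift hu₂) hp, e₁, e₂,
    eq_neg_of_add_eq_zero_left (h₁ p hp), eq_neg_of_add_eq_zero_left (h₂ p hp)]
  simp only [lift]
  ring

end Lift

/-- Uniqueness in characteristic coordinates: `f` and `f'` are the differences of the outgoing and
incoming solutions. -/
theorem potential_eq_zero_of_rays {M ε c : ℝ} {f f' f₂ f₂' : Space × ℝ → ℝ} {q q₁ : Space → ℝ}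
    (hε : 0 < ε) (hε1 : ε ≤ 1)
    (hf : ContDiffOn ℝ ∞ f dom) (hf' : ContDiffOn ℝ ∞ f' dom)
    (hf₂ : ContDiffOn ℝ ∞ f₂ dom) (hf₂' : ContDiffOn ℝ ∞ f₂' dom)
    (hpde : ∀ p ∈ domInt, charOp 1 f p = -(‖p.1‖ ^ 2 * (q₁ p.1 * f p + q p.1 * f₂ p)))
    (hpde' : ∀ p ∈ domInt, charOp (-1) f' p = -(‖p.1‖ ^ 2 * (q₁ p.1 * f' p + q p.1 * f₂' p)))
    (hM : ∀ x, |q₁ x| ≤ M) (hq₁1 : ∀ x, 1 < ‖x‖ → q₁ x = 0)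
    (hq : Continuous q) (hq0 : ∀ x, ‖x‖ < ε → q x = 0) (hq1 : ∀ x, 1 < ‖x‖ → q x = 0) (hc : c ≠ 0)
    (hray : ∀ x ≠ 0, f (x, 0) = c * (‖x‖ * ∫ a in Icc (0 : ℝ) 1, q (a • x)))
    (hray' : ∀ x ≠ 0, f' (x, 0) = c * (‖x‖ * ∫ a in Ici (1 : ℝ), q (a • x)))
    (hdata : ∀ x τ, ‖x‖ = 1 → 0 ≤ τ → τ < 2 → f (x, τ) = 0)
    (hdata' : ∀ x τ, ‖x‖ = 1 → 0 ≤ τ → τ < 2 → f' (x, τ) = 0)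
    (hic : ∀ p ∈ domInt, p.2 < ‖p.1‖ - 1 → f' p = 0)
    (hf0 : f (0, 0) = 0) : q = 0 := by
  have hunit (y : Space) (hy : ‖y‖ = 1) : ∫ a in Icc (0 : ℝ) 1, q (a • y) = 0 := by
    have h := hray y (norm_ne_zero_iff.1 (by rw [hy]; exact one_ne_zero))
    rw [hdata y 0 hy le_rfl two_pos, hy, one_mul] at h
    exact (mul_eq_zero.1 h.symm).resolve_left hc
  have hne (x : Space) (hx : 1 ≤ ‖x‖) : x ≠ 0 := norm_pos_iff.1 (zero_lt_one.trans_le hx)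
  have hout' (x : Space) (hx : 1 ≤ ‖x‖) : f' (x, 0) = 0 := by
    rw [hray' x (hne x hx), outer_ray_eq_zero hq1 hx, mul_zero, mul_zero]
  have hneg (y : Space) (hy : y ≠ 0) : f' (y, 0) = -f (y, 0) := by
    rw [hray y hy, hray' y hy, outer_ray_eq_neg_inner_ray hq hq1 hunit hy]
    ring
  have hout (x : Space) (hx : 1 ≤ ‖x‖) : f (x, 0) = 0 := by
    rw [← neg_eq_zero, ← hneg x (hne x hx), hout' x hx]
  refine potential_eq_zero hε hε1 hf hf' hf₂ hf₂' hpde hpde' hM ?_ ?_ hq hq0 hq1 hneg ?_ hc ?_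
  · intro p hp h1 h2
    refine exterior_vanish (Or.inl rfl) hf (fun p hp h => ?_) hout hdata ?_ h1.le hp.1 h2
    · rw [hpde p hp, hq₁1 _ h, hq1 _ h]; ring
    · intro h; norm_num at h
  · intro p hp h1 h2
    refine exterior_vanish (Or.inr rfl) hf' (fun p hp h => ?_) hout' hdata' (fun _ => hic)
      h1.le hp.1 h2
    rw [hpde' p hp, hq₁1 _ h, hq1 _ h]; ring
  · intro y hy
    rcases eq_or_ne y 0 with rfl | hy0
    · exact hf0
    · rw [hray y hy0, inner_ray_eq_zero hq0 hy, mul_zero, mul_zero]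
  · intro x hx
    have h1 := (hasFDerivAt_trace hf hx).differentiableAt.hasFDerivAt
    have hl : HasDerivAt (fun b : ℝ => b • x) x 1 := by
      simpa using (hasDerivAt_id (1 : ℝ)).smul_const x
    have h2 := HasFDerivAt.comp_hasDerivAt_of_eq (1 : ℝ) h1 hl (one_smul ℝ x).symm
    refine h2.unique (((hasDerivAt_inner_ray hq x).const_mul c).congr_of_eventuallyEq ?_)
    filter_upwards [lt_mem_nhds (zero_lt_one (α := ℝ))] with b hb
    exact hray _ (smul_ne_zero hb.ne' hx)

end WaveUniqueness

open WaveUniqueness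
/-- Theorem 1.6 (point source and spherical source data): two smooth potentials supported
in the closed unit ball and vanishing near the origin, whose point-source regular parts `v`
agree on `S × [1,3]` and whose spherical-wave regular parts `w` agree on `S × [−1,1)`,
must coincide. -/
theorem point_and_spherical_source_uniqueness
    (q₁ q₂ : EuclideanSpace ℝ (Fin 3) → ℝ)
    (hq₁ : ContDiff ℝ (⊤ : ℕ∞) q₁) (hq₂ : ContDiff ℝ (⊤ : ℕ∞) q₂)
    (hq₁supp : ∀ x : EuclideanSpace ℝ (Fin 3), 1 < ‖x‖ → q₁ x = 0)
    (hq₂supp : ∀ x : EuclideanSpace ℝ (Fin 3), 1 < ‖x‖ → q₂ x = 0)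
    (hq₁orig : ∃ ε > (0 : ℝ), ∀ x : EuclideanSpace ℝ (Fin 3), ‖x‖ < ε → q₁ x = 0)
    (hq₂orig : ∃ ε > (0 : ℝ), ∀ x : EuclideanSpace ℝ (Fin 3), ‖x‖ < ε → q₂ x = 0)
    (v₁ v₂ w₁ w₂ : EuclideanSpace ℝ (Fin 3) × ℝ → ℝ)
    -- (a) v_i : regular part of the point source solution, smooth on {t ≥ |x|}
    (hv₁_smooth : ContDiffOn ℝ (⊤ : ℕ∞) v₁ {p | ‖p.1‖ ≤ p.2})
    (hv₂_smooth : ContDiffOn ℝ (⊤ : ℕ∞) v₂ {p | ‖p.1‖ ≤ p.2})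
    (hv₁_pde : ∀ p : EuclideanSpace ℝ (Fin 3) × ℝ, ‖p.1‖ < p.2 →
      waveOp3 v₁ p + q₁ p.1 * v₁ p = 0)
    (hv₂_pde : ∀ p : EuclideanSpace ℝ (Fin 3) × ℝ, ‖p.1‖ < p.2 →
      waveOp3 v₂ p + q₂ p.1 * v₂ p = 0)
    (hv₁_char : ∀ x : EuclideanSpace ℝ (Fin 3),
      v₁ (x, ‖x‖) = -(1 / (8 * Real.pi)) * ∫ s in Set.Icc (0 : ℝ) 1, q₁ (s • x))
    (hv₂_char : ∀ x : EuclideanSpace ℝ (Fin 3),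
      v₂ (x, ‖x‖) = -(1 / (8 * Real.pi)) * ∫ s in Set.Icc (0 : ℝ) 1, q₂ (s • x))
    -- (b) w_i : regular part of the incoming spherical wave, smooth on {x ≠ 0, −|x| ≤ t < |x|}
    (hw₁_smooth : ContDiffOn ℝ (⊤ : ℕ∞) w₁ {p | p.1 ≠ 0 ∧ -‖p.1‖ ≤ p.2 ∧ p.2 < ‖p.1‖})
    (hw₂_smooth : ContDiffOn ℝ (⊤ : ℕ∞) w₂ {p | p.1 ≠ 0 ∧ -‖p.1‖ ≤ p.2 ∧ p.2 < ‖p.1‖})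
    (hw₁_pde : ∀ p : EuclideanSpace ℝ (Fin 3) × ℝ, p.1 ≠ 0 → -‖p.1‖ < p.2 → p.2 < ‖p.1‖ →
      waveOp3 w₁ p + q₁ p.1 * w₁ p = 0)
    (hw₂_pde : ∀ p : EuclideanSpace ℝ (Fin 3) × ℝ, p.1 ≠ 0 → -‖p.1‖ < p.2 → p.2 < ‖p.1‖ →
      waveOp3 w₂ p + q₂ p.1 * w₂ p = 0)
    (hw₁_char : ∀ x : EuclideanSpace ℝ (Fin 3), x ≠ 0 →
      w₁ (x, -‖x‖) = -(1 / (8 * Real.pi)) * ∫ s in Set.Ici (1 : ℝ), q₁ (s • x))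
    (hw₂_char : ∀ x : EuclideanSpace ℝ (Fin 3), x ≠ 0 →
      w₂ (x, -‖x‖) = -(1 / (8 * Real.pi)) * ∫ s in Set.Ici (1 : ℝ), q₂ (s • x))
    (hw₁_ic : ∀ (x : EuclideanSpace ℝ (Fin 3)) (t : ℝ), -‖x‖ ≤ t → t < -1 → w₁ (x, t) = 0)
    (hw₂_ic : ∀ (x : EuclideanSpace ℝ (Fin 3)) (t : ℝ), -‖x‖ ≤ t → t < -1 → w₂ (x, t) = 0)
    -- the data agree
    (hdata_v : ∀ (x : EuclideanSpace ℝ (Fin 3)) (t : ℝ), ‖x‖ = 1 → 1 ≤ t → t ≤ 3 →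
      v₁ (x, t) = v₂ (x, t))
    (hdata_w : ∀ (x : EuclideanSpace ℝ (Fin 3)) (t : ℝ), ‖x‖ = 1 → -1 ≤ t → t < 1 →
      w₁ (x, t) = w₂ (x, t)) :
    q₁ = q₂ := by
  obtain ⟨ε₁, hε₁, hq₁0⟩ := hq₁orig
  obtain ⟨ε₂, hε₂, hq₂0⟩ := hq₂orig
  have hsv : shear (-1) ⁻¹' dom ⊆ {p | ‖p.1‖ ≤ p.2} := fun p hp => by
    have h : 0 ≤ p.2 + -1 * ‖p.1‖ := hp.1
    change ‖p.1‖ ≤ p.2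
    linarith
  have hsw : shear (-(-1)) ⁻¹' dom ⊆ {p | p.1 ≠ 0 ∧ -‖p.1‖ ≤ p.2 ∧ p.2 < ‖p.1‖} := fun p hp => by
    have h1 : 0 ≤ p.2 + -(-1) * ‖p.1‖ := hp.1
    have h2 : p.2 + -(-1) * ‖p.1‖ < 2 * ‖p.1‖ := hp.2
    exact ⟨fst_ne_zero_of_mem_dom (p := shear (-(-1)) p) hp, by linarith, by linarith⟩
  have hv₁ := hv₁_smooth.mono hsv
  have hv₂ := hv₂_smooth.mono hsv
  have hw₁ := hw₁_smooth.mono hsw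
  have hw₂ := hw₂_smooth.mono hsw
  have hsv' : ∀ p ∈ domInt, ‖(shear 1 p).1‖ < (shear 1 p).2 := fun p hp => by
    have := hp.1
    simp only [shear]
    linarith
  have hsw' : ∀ p ∈ domInt, (shear (-1) p).1 ≠ 0 ∧ -‖(shear (-1) p).1‖ < (shear (-1) p).2 ∧
      (shear (-1) p).2 < ‖(shear (-1) p).1‖ := fun p hp => by
    have h1 := hp.1
    have h2 := hp.2
    refine ⟨fst_ne_zero_of_mem_dom (p := p) (domInt_subset_dom hp), ?_, ?_⟩ <;>
      simp only [shear] <;> linarith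
  have hq1 : ∀ x, 1 < ‖x‖ → q₁ x - q₂ x = 0 := fun x hx => by
    rw [hq₁supp x hx, hq₂supp x hx, sub_zero]
  obtain ⟨M, hM⟩ := (isCompact_closedBall (0 : EuclideanSpace ℝ (Fin 3)) 1).bddAbove_image
    hq₁.continuous.norm.continuousOn
  have hfinal : (fun x => q₁ x - q₂ x) = 0 := by
    refine potential_eq_zero_of_rays (M := max M 0) (ε := min 1 (min ε₁ ε₂))
      (c := -(1 / (8 * Real.pi))) (q₁ := q₁)
      (f := fun y => lift 1 v₁ y - lift 1 v₂ y) (f' := fun y => lift (-1) w₁ y - lift (-1) w₂ y)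
      (f₂ := lift 1 v₂) (f₂' := lift (-1) w₂) (by positivity) (min_le_left _ _)
      ((contDiffOn_lift hv₁).sub (contDiffOn_lift hv₂))
      ((contDiffOn_lift hw₁).sub (contDiffOn_lift hw₂)) (contDiffOn_lift hv₂) (contDiffOn_lift hw₂)
      (fun p hp => charOp_lift_sub (Or.inl rfl) hv₁ hv₂ (fun p hp => hv₁_pde _ (hsv' p hp))
        (fun p hp => hv₂_pde _ (hsv' p hp)) hp)
      (fun p hp => charOp_lift_sub (Or.inr rfl) hw₁ hw₂
        (fun p hp => hw₁_pde _ (hsw' p hp).1 (hsw' p hp).2.1 (hsw' p hp).2.2)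
        (fun p hp => hw₂_pde _ (hsw' p hp).1 (hsw' p hp).2.1 (hsw' p hp).2.2) hp)
      (fun x => ?_) hq₁supp (hq₁.continuous.sub hq₂.continuous) (fun x hx => ?_) hq1
      (by simp [Real.pi_ne_zero]) (fun x hx => ?_) (fun x hx => ?_) (fun x τ hx h0 h2 => ?_)
      (fun x τ hx h0 h2 => ?_) (fun p hp h => ?_) ?_
    · rcases le_or_gt ‖x‖ 1 with hx | hx
      · exact (hM (Set.mem_image_of_mem _ (mem_closedBall_zero_iff.2 hx))).trans (le_max_left _ _)
      · rw [hq₁supp x hx, abs_zero]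
        exact le_max_right _ _
    · rw [lt_min_iff, lt_min_iff] at hx
      rw [hq₁0 x hx.2.1, hq₂0 x hx.2.2, sub_zero]
    · have h₁ := (integrable_ray hq₁.continuous hq₁supp hx).integrableOn (s := Set.Icc (0 : ℝ) 1)
      have h₂ := (integrable_ray hq₂.continuous hq₂supp hx).integrableOn (s := Set.Icc (0 : ℝ) 1)
      simp only [lift, shear, zero_add, one_mul, hv₁_char, hv₂_char]
      rw [integral_sub h₁ h₂]
      ring
    · have h₁ := (integrable_ray hq₁.continuous hq₁supp hx).integrableOn (s := Set.Ici (1 : ℝ))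
      have h₂ := (integrable_ray hq₂.continuous hq₂supp hx).integrableOn (s := Set.Ici (1 : ℝ))
      simp only [lift, shear, zero_add, neg_one_mul, hw₁_char x hx, hw₂_char x hx]
      rw [integral_sub h₁ h₂]
      ring
    · simp only [lift, shear, hx]
      rw [hdata_v x _ hx (by linarith) (by linarith), sub_self]
    · simp only [lift, shear, hx]
      rw [hdata_w x _ hx (by linarith) (by linarith), sub_self]
    · have h0 := hp.1
      simp only [lift, shear]
      rw [hw₁_ic _ _ (by linarith) (by linarith), hw₂_ic _ _ (by linarith) (by linarith), sub_self]
    · simp [lift]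
  funext x
  exact sub_eq_zero.1 (congrFun hfinal x)
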